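/- Let t1 = inf{ t ∈ ℝ : dim_H((−∞, t] ∩ M) = 1 }, where M is the Markov spectrum and dim_H denotes Hausdorff dimension. Then 3.334384009 ≤ t1 ≤ 3.3343849341; in particular t1 = 3.334384… accurately to the six decimal places shown. -/

import Mathlib

open Filter

/-- Numerators of the convergents of the continued fraction `[a 0; a 1, a 2, …]`. -/
def cfNum (a : ℕ → ℕ) : ℕ → ℕ
  | 0 => a 0
  | 1 => a 1 * a 0 + 1
  | n + 2 => a (n + 2) * cfNum a (n + 1) + cfNum a n

/-- Denominators of the convergents of the continued fraction `[a 0; a 1, a 2, …]`. -/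
def cfDen (a : ℕ → ℕ) : ℕ → ℕ
  | 0 => 1
  | 1 => a 1
  | n + 2 => a (n + 2) * cfDen a (n + 1) + cfDen a n

/-- Value of the infinite continued fraction `[a 0; a 1, a 2, …]` (the limit of its
convergents). -/
noncomputable def cfVal (a : ℕ → ℕ) : ℝ :=
  limUnder atTop fun n => (cfNum a n : ℝ) / (cfDen a n)

/-- Value of the infinite continued fraction `[0; a 0, a 1, …]`. -/
noncomputable def cf01 (a : ℕ → ℕ) : ℝ := 1 / cfVal a

/-- `λ₀(α) = [α 0; α 1, α 2, …] + [0; α (-1), α (-2), …]`. -/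
noncomputable def lambda0 (α : ℤ → ℕ) : ℝ :=
  cfVal (fun n : ℕ => α (n : ℤ)) + cf01 (fun n : ℕ => α (-((n : ℤ) + 1)))

/-- The shift `σ^N` on bi-infinite sequences. -/
def shiftZ (N : ℤ) (α : ℤ → ℕ) : ℤ → ℕ := fun i => α (i + N)

/-- The Markov value `m(α) = sup_{n ∈ ℤ} λ₀(σⁿ α)`. -/
noncomputable def markovValue (α : ℤ → ℕ) : ℝ := ⨆ n : ℤ, lambda0 (shiftZ n α)

/-- The Lagrange value `ℓ(α) = limsup_{n → +∞} λ₀(σⁿ α)`. -/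
noncomputable def lagrangeValue (α : ℤ → ℕ) : ℝ :=
  limsup (fun n : ℕ => lambda0 (shiftZ (n : ℤ) α)) atTop

/-- The Markov spectrum `M`. -/
def MarkovSpectrum : Set ℝ :=
  { x | ∃ α : ℤ → ℕ, (∀ i, 1 ≤ α i) ∧ markovValue α = x }

/-- The Lagrange spectrum `L`. -/
def LagrangeSpectrum : Set ℝ :=
  { x | ∃ α : ℤ → ℕ, (∀ i, 1 ≤ α i) ∧ lagrangeValue α = x }

namespace CF

/-- Words in the digits `1` (`false`) and `2` (`true`), stored with the last digit first. -/
abbrev Word := List Bool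

/-- The digit encoded by a Boolean. -/
def dig (b : Bool) : ℕ := match b with
  | true => 2
  | false => 1

/-- The continuant of a word. -/
def cont : Word → ℕ
  | [] => 1
  | [b] => dig b
  | b :: c :: w => dig b * cont (c :: w) + cont w

/-- The continuant of a word with its last digit dropped. -/
def cont' : Word → ℕ
  | [] => 0
  | _ :: w => cont w

@[simp] lemma cont_nil : cont [] = 1 := rfl
@[simp] lemma cont'_nil : cont' [] = 0 := rfl
@[simp] lemma cont'_cons (b : Bool) (w : Word) : cont' (b :: w) = cont w := rfl

lemma cont_cons (b : Bool) (w : Word) : cont (b :: w) = dig b * cont w + cont' w := by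
  cases w <;> simp [cont]

lemma one_le_dig (b : Bool) : 1 ≤ dig b := by cases b <;> decide
lemma dig_le_two (b : Bool) : dig b ≤ 2 := by cases b <;> decide

lemma cont_le_cont_cons (b : Bool) (w : Word) : cont w ≤ cont (b :: w) := by
  rw [cont_cons]; nlinarith [one_le_dig b]

lemma one_le_cont (w : Word) : 1 ≤ cont w := by
  induction w with
  | nil => exact le_rfl
  | cons b w ih => exact ih.trans (cont_le_cont_cons b w)

lemma cont'_le_cont (w : Word) : cont' w ≤ cont w := by
  cases w with
  | nil => simp
  | cons b w => exact cont_le_cont_cons b w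

lemma cont_cons_le (b : Bool) (w : Word) : cont (b :: w) ≤ 3 * cont w := by
  rw [cont_cons]; nlinarith [dig_le_two b, cont'_le_cont w]

lemma length_le_cont (w : Word) : w.length ≤ cont w := by
  suffices h : w.length ≤ cont w ∧ (w.tail.length ≤ cont' w) from h.1
  induction w with
  | nil => simp
  | cons b w ih =>
    refine ⟨?_, ih.1⟩
    rw [cont_cons]
    cases w with
    | nil => simpa using one_le_dig b
    | cons c w =>
      have := one_le_cont w
      have h2 := one_le_dig b
      have := ih.1
      have h3 : cont (c :: w) ≤ dig b * cont (c :: w) := Nat.le_mul_of_pos_left _ h2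
      simp only [List.length_cons, cont'_cons] at *
      omega

lemma cont_mul_le_cont_append (c w : Word) : cont c * cont w ≤ cont (c ++ w) := by
  suffices h : cont c * cont w ≤ cont (c ++ w) ∧ cont' c * cont w ≤ cont' (c ++ w) from h.1
  induction c with
  | nil => simp
  | cons b c ih =>
    refine ⟨?_, by simpa using ih.1⟩
    rw [List.cons_append, cont_cons, cont_cons]
    nlinarith [ih.1, ih.2]

lemma cont_append_le (c w : Word) : cont (c ++ w) ≤ 2 * cont c * cont w := by
  suffices h : ∀ c : Word, cont (c ++ w) ≤ 2 * cont c * cont w ∧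
      ∀ b, cont (b :: c ++ w) ≤ 2 * cont (b :: c) * cont w from (h c).1
  intro c
  induction c with
  | nil =>
    have := one_le_cont w
    refine ⟨by simp; omega, fun b => ?_⟩
    have h1 := one_le_dig b
    have h2 := cont'_le_cont w
    rw [List.cons_append, cont_cons, cont_cons]
    simp
    nlinarith
  | cons c l ih =>
    refine ⟨ih.2 c, fun b => ?_⟩
    have h1 := ih.1
    have h2 := ih.2 c
    have e1 : cont (b :: (c :: l) ++ w) = dig b * cont (c :: l ++ w) + cont (l ++ w) := by
      simp [cont]
    have e2 : cont (b :: (c :: l)) = dig b * cont (c :: l) + cont l := by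
      simp [cont]
    rw [e1, e2]
    nlinarith [one_le_dig b]

/-- The ratio of the last two continuants of a word. -/
noncomputable def beta (w : Word) : ℝ := cont' w / cont w

lemma cont_pos (w : Word) : (0 : ℝ) < cont w := by exact_mod_cast one_le_cont w
lemma beta_nonneg (w : Word) : 0 ≤ beta w := by unfold beta; positivity
lemma beta_le_one (w : Word) : beta w ≤ 1 := by
  unfold beta
  rw [div_le_one (cont_pos w)]
  exact_mod_cast cont'_le_cont w

lemma beta_cons (b : Bool) (w : Word) : beta (b :: w) = 1 / (dig b + beta w) := by
  have h := cont_pos w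
  have h2 : (0 : ℝ) < dig b := by exact_mod_cast one_le_dig b
  unfold beta
  rw [cont'_cons, cont_cons]
  push_cast
  have : (0 : ℝ) ≤ cont' w := by positivity
  field_simp

lemma cont_cons_eq (b : Bool) (w : Word) : (cont (b :: w) : ℝ) = cont w * (dig b + beta w) := by
  have h := cont_pos w
  unfold beta
  rw [cont_cons]
  push_cast
  field_simp

/-- The Möbius map attached to a word: `mob w x = [0; w + x]`. -/
noncomputable def mob : Word → ℝ → ℝ
  | [], x => x
  | b :: w, x => mob w (1 / (dig b + x))

@[simp] lemma mob_nil (x : ℝ) : mob [] x = x := rfl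
@[simp] lemma mob_cons (b : Bool) (w : Word) (x : ℝ) :
    mob (b :: w) x = mob w (1 / (dig b + x)) := rfl

lemma mob_append (c w : Word) (x : ℝ) : mob (c ++ w) x = mob w (mob c x) := by
  induction c generalizing x with
  | nil => rfl
  | cons b c ih => exact ih _

/-- The interval `[1/3, 3/4]`, invariant under all maps `mob w`. -/
def Iv : Set ℝ := Set.Icc (1 / 3) (3 / 4)

lemma one_div_mem_Iv (b : Bool) {x : ℝ} (hx : x ∈ Iv) : 1 / (dig b + x) ∈ Iv := by
  obtain ⟨h1, h2⟩ := hx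
  constructor
  · apply one_div_le_one_div_of_le
    · positivity
    · cases b <;> norm_num [dig] <;> linarith
  · rw [div_le_div_iff₀ (by positivity) (by norm_num)]
    cases b <;> norm_num [dig] <;> linarith

lemma mob_mem_Iv (w : Word) {x : ℝ} (hx : x ∈ Iv) : mob w x ∈ Iv := by
  induction w generalizing x with
  | nil => exact hx
  | cons b w ih => exact ih (one_div_mem_Iv b hx)

/-- The distortion map `x ↦ x / (1 + β x)`. -/
noncomputable def psi (β x : ℝ) : ℝ := x / (1 + β * x)

lemma psi_sub {β x y : ℝ} (hβ : 0 ≤ β) (hx : 0 ≤ x) (hy : 0 ≤ y) :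
    psi β x - psi β y = (x - y) / ((1 + β * x) * (1 + β * y)) := by
  unfold psi
  have : 0 < 1 + β * x := by positivity
  have : 0 < 1 + β * y := by positivity
  field_simp
  ring

lemma mob_sub (w : Word) {x y : ℝ} (hx : 0 ≤ x) (hy : 0 ≤ y) :
    mob w x - mob w y = (-1) ^ w.length * (psi (beta w) x - psi (beta w) y) / (cont w : ℝ) ^ 2 := by
  rw [psi_sub (beta_nonneg w) hx hy]
  induction w generalizing x y with
  | nil => simp [beta]
  | cons b w ih =>
    have h1 : (0 : ℝ) < dig b := by exact_mod_cast one_le_dig b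
    have hc := cont_pos w
    have hb := beta_nonneg w
    rw [mob_cons, mob_cons, ih (by positivity) (by positivity), beta_cons, cont_cons_eq,
      List.length_cons, pow_succ]
    have : 0 < dig b + x := by positivity
    have : 0 < dig b + y := by positivity
    have : 0 < dig b + beta w := by positivity
    have : 0 < dig b + beta w + x := by positivity
    have : 0 < dig b + beta w + y := by positivity
    have : 0 < (dig b + x) + beta w := by positivity
    have : 0 < (dig b + y) + beta w := by positivity
    have e1 : 1 / (dig b + x) - 1 / (dig b + y) = - (x - y) / ((dig b + x) * (dig b + y)) := by
      field_simp; ring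
    have e2 : 1 + beta w * (1 / (dig b + x)) = (dig b + x + beta w) / (dig b + x) := by
      field_simp
    have e3 : 1 + beta w * (1 / (dig b + y)) = (dig b + y + beta w) / (dig b + y) := by
      field_simp
    have e4 : 1 + 1 / (dig b + beta w) * x = (dig b + x + beta w) / (dig b + beta w) := by
      field_simp; ring
    have e5 : 1 + 1 / (dig b + beta w) * y = (dig b + y + beta w) / (dig b + beta w) := by
      field_simp; ring
    rw [e1, e2, e3, e4, e5]
    field_simp
    ring

/-- The `n`-th convergent of `[a 0; a 1, …]`. -/
noncomputable def conv (a : ℕ → ℕ) (n : ℕ) : ℝ := (cfNum a n : ℝ) / cfDen a n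

lemma cfNum_cfDen_succ (a : ℕ → ℕ) (n : ℕ) :
    cfNum a (n + 1) = a 0 * cfNum (fun k => a (k + 1)) n + cfDen (fun k => a (k + 1)) n ∧
      cfDen a (n + 1) = cfNum (fun k => a (k + 1)) n := by
  induction n using Nat.twoStepInduction with
  | zero => simp [cfNum, cfDen]; ring
  | one => simp [cfNum, cfDen]; ring
  | more n ih1 ih2 =>
    constructor
    · rw [cfNum, ih2.1, ih1.1, cfNum, cfDen]; ring
    · rw [cfDen, ih2.2, ih1.2, cfNum]

lemma cfNum_pos {a : ℕ → ℕ} (ha : ∀ i, 1 ≤ a i) (n : ℕ) : 0 < cfNum a n ∧ 0 < cfDen a n := by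
  induction n generalizing a with
  | zero => exact ⟨ha 0, Nat.one_pos⟩
  | succ n ih =>
    have h := ih (a := fun k => a (k + 1)) fun i => ha (i + 1)
    rw [(cfNum_cfDen_succ a n).1, (cfNum_cfDen_succ a n).2]
    exact ⟨by have := h.2; omega, h.1⟩

lemma conv_pos {a : ℕ → ℕ} (ha : ∀ i, 1 ≤ a i) (n : ℕ) : 0 < conv a n := by
  have := cfNum_pos ha n
  unfold conv
  exact div_pos (by exact_mod_cast this.1) (by exact_mod_cast this.2)

lemma conv_succ {a : ℕ → ℕ} (ha : ∀ i, 1 ≤ a i) (n : ℕ) :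
    conv a (n + 1) = a 0 + 1 / conv (fun k => a (k + 1)) n := by
  have h := cfNum_pos (a := fun k => a (k + 1)) (fun i => ha (i + 1)) n
  have h1 : (0 : ℝ) < cfNum (fun k => a (k + 1)) n := by exact_mod_cast h.1
  have h2 : (0 : ℝ) < cfDen (fun k => a (k + 1)) n := by exact_mod_cast h.2
  unfold conv
  rw [(cfNum_cfDen_succ a n).1, (cfNum_cfDen_succ a n).2]
  push_cast
  field_simp

lemma conv_bounds {a : ℕ → ℕ} (ha : ∀ i, 1 ≤ a i) (n : ℕ) :
    (a 0 : ℝ) ≤ conv a n ∧ conv a n ≤ a 0 + 1 := by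
  cases n with
  | zero => simp [conv, cfNum, cfDen]
  | succ n =>
    have ha' : ∀ i, 1 ≤ (fun k => a (k + 1)) i := fun i => ha (i + 1)
    rw [conv_succ ha]
    have hp := conv_pos ha' n
    refine ⟨by have : 0 < 1 / conv (fun k => a (k + 1)) n := by positivity
               linarith, ?_⟩
    suffices h : 1 ≤ conv (fun k => a (k + 1)) n by
      have : 1 / conv (fun k => a (k + 1)) n ≤ 1 := by rw [div_le_one hp]; exact h
      linarith
    cases n with
    | zero => simp [conv, cfNum, cfDen]; exact_mod_cast ha 1
    | succ n =>
      rw [conv_succ ha']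
      have hp := conv_pos (a := fun k => a (k + 1 + 1)) (fun i => ha (i + 2)) n
      have h1 : (1 : ℝ) ≤ a 1 := by exact_mod_cast ha 1
      have : 0 < 1 / conv (fun k => a (k + 1 + 1)) n := by positivity
      simp only [zero_add]
      linarith

lemma conv_dist {a : ℕ → ℕ} (ha : ∀ i, 1 ≤ a i) (N n m : ℕ) (hn : 2 * N ≤ n) (hm : 2 * N ≤ m) :
    |conv a n - conv a m| ≤ (1 / 4) ^ N := by
  induction N generalizing a n m with
  | zero =>
    have h1 := conv_bounds ha n
    have h2 := conv_bounds ha m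
    rw [pow_zero, abs_le]; constructor <;> linarith
  | succ N ih =>
    obtain ⟨n, rfl⟩ : ∃ k, n = k + 2 := ⟨n - 2, by omega⟩
    obtain ⟨m, rfl⟩ : ∃ k, m = k + 2 := ⟨m - 2, by omega⟩
    have ha1 : ∀ i, 1 ≤ (fun k => a (k + 1)) i := fun i => ha (i + 1)
    have ha2 : ∀ i, 1 ≤ (fun k => a (k + 1 + 1)) i := fun i => ha (i + 2)
    have key := ih ha2 n m (by omega) (by omega)
    rw [conv_succ ha, conv_succ ha, conv_succ ha1, conv_succ ha1]
    have b1 := (conv_bounds ha2 n).1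
    have b2 := (conv_bounds ha2 m).1
    have h2 : (1 : ℝ) ≤ a 2 := by exact_mod_cast ha 2
    have h1 : (1 : ℝ) ≤ a 1 := by exact_mod_cast ha 1
    set x := conv (fun k => a (k + 1 + 1)) n
    set y := conv (fun k => a (k + 1 + 1)) m
    have hx : 1 ≤ x := by simp only [zero_add] at b1; linarith
    have hy : 1 ≤ y := by simp only [zero_add] at b2; linarith
    simp only [zero_add]
    have e : (a 0 : ℝ) + 1 / (a 1 + 1 / x) - (a 0 + 1 / (a 1 + 1 / y))
        = (x - y) / ((a 1 * x + 1) * (a 1 * y + 1)) := by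
      field_simp; ring
    rw [e, abs_div, abs_of_pos (by positivity : 0 < (a 1 * x + 1) * ((a 1 : ℝ) * y + 1)),
      div_le_iff₀ (by positivity), pow_succ]
    have hax : 2 ≤ a 1 * x + 1 := by nlinarith
    have hay : 2 ≤ a 1 * y + 1 := by nlinarith
    have h4 : 4 ≤ (a 1 * x + 1) * (a 1 * y + 1) := by nlinarith
    have hp : (0 : ℝ) < (1 / 4) ^ N := by positivity
    nlinarith

lemma conv_tendsto {a : ℕ → ℕ} (ha : ∀ i, 1 ≤ a i) : Tendsto (conv a) atTop (nhds (cfVal a)) := by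
  have hc : CauchySeq (conv a) := by
    rw [Metric.cauchySeq_iff]
    intro ε hε
    obtain ⟨N, hN⟩ := exists_pow_lt_of_lt_one hε (by norm_num : (1 / 4 : ℝ) < 1)
    exact ⟨2 * N, fun m hm n hn => (conv_dist ha N m n hm hn).trans_lt hN⟩
  exact (cauchySeq_tendsto_of_complete hc).choose_spec |> fun h => by
    have := h.limUnder_eq
    unfold cfVal
    rw [show (fun n => (cfNum a n : ℝ) / cfDen a n) = conv a from rfl, this]
    exact h

lemma cfVal_bounds {a : ℕ → ℕ} (ha : ∀ i, 1 ≤ a i) :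
    (a 0 : ℝ) ≤ cfVal a ∧ cfVal a ≤ a 0 + 1 :=
  ⟨ge_of_tendsto' (conv_tendsto ha) fun n => (conv_bounds ha n).1,
    le_of_tendsto' (conv_tendsto ha) fun n => (conv_bounds ha n).2⟩

lemma one_le_cfVal {a : ℕ → ℕ} (ha : ∀ i, 1 ≤ a i) : 1 ≤ cfVal a :=
  le_trans (by exact_mod_cast ha 0) (cfVal_bounds ha).1

lemma cfVal_eq {a : ℕ → ℕ} (ha : ∀ i, 1 ≤ a i) :
    cfVal a = a 0 + 1 / cfVal (fun k => a (k + 1)) := by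
  have ha' : ∀ i, 1 ≤ (fun k => a (k + 1)) i := fun i => ha (i + 1)
  have h1 := (tendsto_add_atTop_iff_nat 1).2 (conv_tendsto ha)
  have h2 : Tendsto (fun n => (a 0 : ℝ) + 1 / conv (fun k => a (k + 1)) n) atTop
      (nhds (a 0 + 1 / cfVal (fun k => a (k + 1)))) :=
    tendsto_const_nhds.add
      (tendsto_const_nhds.div (conv_tendsto ha') (by linarith [one_le_cfVal ha']))
  refine tendsto_nhds_unique h1 (h2.congr fun n => (conv_succ ha n).symm)

lemma cf01_bounds {a : ℕ → ℕ} (ha : ∀ i, 1 ≤ a i) : 0 < cf01 a ∧ cf01 a ≤ 1 := by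
  have := one_le_cfVal ha
  unfold cf01
  exact ⟨by positivity, by rw [div_le_one (by linarith)]; exact this⟩

lemma cf01_eq {a : ℕ → ℕ} (ha : ∀ i, 1 ≤ a i) :
    cf01 a = 1 / (a 0 + cf01 (fun k => a (k + 1))) := by
  unfold cf01
  rw [cfVal_eq ha]

/-- The value `[0; x 0, x 1, …]` for a sequence of digits in `{1, 2}`. -/
noncomputable def val (x : ℕ → Bool) : ℝ := cf01 fun n => dig (x n)

lemma val_eq (x : ℕ → Bool) : val x = 1 / (dig (x 0) + val (fun n => x (n + 1))) :=
  cf01_eq fun i => one_le_dig (x i)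

lemma val_bounds (x : ℕ → Bool) : 0 < val x ∧ val x ≤ 1 := cf01_bounds fun i => one_le_dig (x i)

lemma val_mem_Iv (x : ℕ → Bool) : val x ∈ Iv := by
  have h3 : ∀ x, 1 / 3 ≤ val x := fun x => by
    have h := val_bounds fun n => x (n + 1)
    have hd : (dig (x 0) : ℝ) ≤ 2 := by exact_mod_cast dig_le_two (x 0)
    rw [val_eq]
    apply one_div_le_one_div_of_le (by linarith [h.1]) (by linarith)
  refine ⟨h3 x, ?_⟩
  have h := h3 fun n => x (n + 1)
  have hd : (1 : ℝ) ≤ dig (x 0) := by exact_mod_cast one_le_dig (x 0)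
  rw [val_eq, div_le_div_iff₀ (by linarith) (by norm_num)]
  linarith

/-- The word formed by the first `n` terms of a sequence. -/
def pre (x : ℕ → Bool) : ℕ → Word
  | 0 => []
  | n + 1 => x n :: pre x n

@[simp] lemma length_pre (x : ℕ → Bool) (n : ℕ) : (pre x n).length = n := by
  induction n with
  | zero => rfl
  | succ n ih => simp [pre, ih]

lemma val_eq_mob (x : ℕ → Bool) (n : ℕ) : val x = mob (pre x n) (val fun k => x (k + n)) := by
  induction n with
  | zero => rfl
  | succ n ih =>
    rw [ih, val_eq, pre, mob_cons]
    simp only [zero_add]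
    congr 3
    refine congrArg val (funext fun k => ?_)
    rw [show k + 1 + n = k + (n + 1) by ring]

lemma pre_append (x : ℕ → Bool) (n m : ℕ) : pre x (m + n) = pre (fun k => x (k + n)) m ++ pre x n := by
  induction m with
  | zero => simp [pre]
  | succ m ih =>
    rw [show m + 1 + n = (m + n) + 1 by ring, pre, ih]; rfl

open scoped NNReal ENNReal in
lemma le_dimH_range {M : ℕ} (hM : 1 < M) {c γ : ℝ} (hc : 0 < c) (hγ : 0 < γ) {d : ℝ≥0}
    (hd : 0 < d) (h : 1 ≤ γ ^ (d : ℝ) * M) (G : (ℕ → Fin M) → ℝ)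
    (hG : ∀ s t n, (∀ i < n, s i = t i) → s n ≠ t n → c * γ ^ n ≤ |G s - G t|) :
    (d : ℝ≥0∞) ≤ dimH (Set.range G) := by
  classical
  have hdiff : ∀ s t : ℕ → Fin M, s ≠ t → ∃ n, (∀ i < n, s i = t i) ∧ s n ≠ t n := fun s t hst => by
    have hex : ∃ n, s n ≠ t n := Function.ne_iff.1 hst
    exact ⟨Nat.find hex, fun i hi => not_not.1 (Nat.find_min hex hi), Nat.find_spec hex⟩
  have hinj : Function.Injective G := fun s t hst => by
    by_contra hne
    obtain ⟨n, h1, h2⟩ := hdiff s t hne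
    have := hG s t n h1 h2
    rw [hst, sub_self, abs_zero] at this
    have : 0 < c * γ ^ n := by positivity
    linarith
  have : Nonempty (ℕ → Fin M) := ⟨fun _ => ⟨0, by omega⟩⟩
  set f : ℝ → ℝ := fun x => Real.ofDigits (Function.invFun G x) with hf
  have hfG : ∀ s, f (G s) = Real.ofDigits s := fun s => by
    simp only [hf, Function.leftInverse_invFun hinj s]
  have hM0 : (0 : ℝ) < M := by exact_mod_cast (by omega : 0 < M)
  have hol : HolderOnWith (Real.toNNReal ((1 / c) ^ (d : ℝ))) d f (Set.range G) := by
    rintro _ ⟨s, rfl⟩ _ ⟨t, rfl⟩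
    rw [hfG, hfG]
    by_cases hst : s = t
    · simp [hst]
    obtain ⟨n, h1, h2⟩ := hdiff s t hst
    have h3 := hG s t n h1 h2
    have h4 := Real.abs_ofDigits_sub_ofDigits_le h1
    have h5 : ((M : ℝ) ^ n)⁻¹ ≤ (1 / c) ^ (d : ℝ) * |G s - G t| ^ (d : ℝ) := by
      rw [← Real.mul_rpow (by positivity) (abs_nonneg _)]
      calc ((M : ℝ) ^ n)⁻¹ ≤ (γ ^ (d : ℝ)) ^ n := by
            rw [inv_le_iff_one_le_mul₀ (by positivity), ← mul_pow]
            exact one_le_pow₀ h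
        _ = (γ ^ n) ^ (d : ℝ) := by
            rw [← Real.rpow_natCast, ← Real.rpow_mul hγ.le, mul_comm, Real.rpow_mul hγ.le,
              Real.rpow_natCast]
        _ ≤ _ := by
            apply Real.rpow_le_rpow (by positivity) _ d.coe_nonneg
            rw [div_mul_eq_mul_div, one_mul, le_div_iff₀ hc]
            linarith
    rw [edist_dist, edist_dist, Real.dist_eq, Real.dist_eq, ENNReal.ofReal_rpow_of_nonneg
      (abs_nonneg _) d.coe_nonneg]
    change _ ≤ ENNReal.ofReal _ * _
    rw [← ENNReal.ofReal_mul (by positivity)]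
    exact ENNReal.ofReal_le_ofReal (h4.trans h5)
  have himg : Set.Icc (0 : ℝ) 1 ⊆ f '' Set.range G := fun y hy => by
    obtain ⟨s, -, hs⟩ := Real.ofDigits_SurjOn hM hy
    exact ⟨G s, ⟨s, rfl⟩, (hfG s).trans hs⟩
  have h1 : dimH (Set.Icc (0 : ℝ) 1) = 1 := by
    rw [Real.dimH_of_nonempty_interior (by simp [interior_Icc])]
    simp
  have h2 := (dimH_mono himg).trans (hol.dimH_image_le hd)
  rw [h1, ENNReal.le_div_iff_mul_le (by simp [hd.ne']) (by simp), one_mul] at h2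
  exact h2

lemma exists_greedy {ι : Type*} [DecidableEq ι] (F N : ι → ℝ) {ρ : ℝ} (hρ : 0 ≤ ρ) (Z : Finset ι) :
    ∃ (S : Finset ι) (s : ι → ι), S ⊆ Z ∧ (∀ x ∈ S, ∀ y ∈ S, x ≠ y → ρ < |F x - F y|) ∧
      ∀ z ∈ Z, s z ∈ S ∧ |F z - F (s z)| ≤ ρ ∧ N z ≤ N (s z) := by
  induction Z using Finset.strongInduction with
  | H Z ih =>
    rcases Z.eq_empty_or_nonempty with rfl | hne
    · exact ⟨∅, id, by simp, by simp, by simp⟩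
    obtain ⟨z₀, hz₀, hmax⟩ := Z.exists_max_image N hne
    have hself : |F z₀ - F z₀| ≤ ρ := by simpa using hρ
    obtain ⟨S, s, hS, hsep, hs⟩ := ih (Z.filter fun z => ρ < |F z - F z₀|) (by
      refine (Finset.filter_ssubset).2 ⟨z₀, hz₀, not_lt.2 hself⟩)
    have hS' : ∀ z ∈ S, z ∈ Z ∧ ρ < |F z - F z₀| := fun z hz => by
      simpa using Finset.mem_filter.1 (hS hz)
    refine ⟨insert z₀ S, fun z => if ρ < |F z - F z₀| then s z else z₀, ?_, ?_, ?_⟩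
    · intro z hz
      rcases Finset.mem_insert.1 hz with rfl | hz
      exacts [hz₀, (hS' z hz).1]
    · intro x hx y hy hxy
      rcases Finset.mem_insert.1 hx with rfl | hx' <;>
        rcases Finset.mem_insert.1 hy with rfl | hy'
      · exact absurd rfl hxy
      · rw [abs_sub_comm]; exact (hS' y hy').2
      · exact (hS' x hx').2
      · exact hsep x hx' y hy' hxy
    · intro z hz
      by_cases h : ρ < |F z - F z₀|
      · have := hs z (Finset.mem_filter.2 ⟨hz, h⟩)
        simp only [h, if_true]
        exact ⟨Finset.mem_insert_of_mem this.1, this.2⟩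
      · simp only [h, if_false]
        exact ⟨Finset.mem_insert_self _ _, not_lt.1 h, hmax z hz⟩

/-- A weighted family of points contains a separated subset whose total multiplicity is controlled
from below by the collision probability of the weights. -/
lemma exists_separated {ι : Type*} [DecidableEq ι] (Z : Finset ι) (π F D : ι → ℝ)
    (hπ : ∀ z ∈ Z, 0 < π z) (hsum : ∑ z ∈ Z, π z = 1) {ρ : ℝ} (hρ : 0 ≤ ρ) :
    ∃ S ⊆ Z, S.Nonempty ∧ (∀ x ∈ S, ∀ y ∈ S, x ≠ y → ρ < |F x - F y|) ∧
      -Real.log (∑ z ∈ Z, ∑ z' ∈ Z, if |F z - F z'| ≤ 2 * ρ then π z * π z' else 0)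
        + ∑ z ∈ Z, π z * D z ≤ Real.log (∑ z ∈ S, Real.exp (D z)) := by
  obtain ⟨S, s, hS, hsep, hs⟩ := exists_greedy F D hρ Z
  refine ⟨S, hS, ?_, hsep, ?_⟩
  · have hZ : Z.Nonempty := by
      rw [Finset.nonempty_iff_ne_empty]; rintro rfl; simp at hsum
    obtain ⟨z, hz⟩ := hZ
    exact ⟨s z, (hs z hz).1⟩
  set col := ∑ z ∈ Z, ∑ z' ∈ Z, if |F z - F z'| ≤ 2 * ρ then π z * π z' else 0
  set P : ι → ℝ := fun x => ∑ z ∈ Z with s z = x, π z with hP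
  have hZ : Z.Nonempty := by
    rw [Finset.nonempty_iff_ne_empty]; rintro rfl; simp at hsum
  have hPpos : ∀ z ∈ Z, 0 < P (s z) := fun z hz =>
    Finset.sum_pos (fun y hy => hπ y (Finset.mem_filter.1 hy).1)
      ⟨z, Finset.mem_filter.2 ⟨hz, rfl⟩⟩
  have hcol1 : ∑ z ∈ Z, π z * P (s z) ≤ col := by
    refine Finset.sum_le_sum fun z hz => ?_
    rw [hP]
    simp only
    rw [Finset.mul_sum, Finset.sum_filter]
    refine Finset.sum_le_sum fun y hy => ?_
    by_cases h : s y = s z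
    · have h1 := (hs y hy).2.1
      have h2 := (hs z hz).2.1
      rw [h] at h1
      have h3 : |F z - F y| ≤ 2 * ρ := by
        rw [abs_le] at *; constructor <;> linarith
      simp [h, h3]
    · simp only [h, if_false]
      split_ifs
      exacts [(mul_pos (hπ z hz) (hπ y hy)).le, le_rfl]
  have hcol : 0 < col :=
    (Finset.sum_pos (fun z hz => mul_pos (hπ z hz) (hPpos z hz)) hZ).trans_le hcol1
  have hSS : ∑ z ∈ Z, π z * (Real.exp (D (s z)) / P (s z)) = ∑ x ∈ Z.image s, Real.exp (D x) := by
    rw [← Finset.sum_fiberwise_of_maps_to (g := s) (t := Z.image s)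
      (fun z hz => Finset.mem_image_of_mem s hz)]
    refine Finset.sum_congr rfl fun x hx => ?_
    obtain ⟨z, hz, rfl⟩ := Finset.mem_image.1 hx
    have hp := hPpos z hz
    rw [Finset.sum_congr rfl (g := fun i => π i * (Real.exp (D (s z)) / P (s z)))]
    · rw [← Finset.sum_mul]
      change P (s z) * _ = _
      field_simp
    · intro i hi
      rw [(Finset.mem_filter.1 hi).2]
  set Y := ∑ x ∈ S, Real.exp (D x)
  have hY1 : ∑ z ∈ Z, π z * (Real.exp (D (s z)) / P (s z)) ≤ Y := by
    rw [hSS]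
    refine Finset.sum_le_sum_of_subset_of_nonneg ?_ fun _ _ _ => (Real.exp_pos _).le
    intro x hx
    obtain ⟨z, hz, rfl⟩ := Finset.mem_image.1 hx
    exact (hs z hz).1
  have hY : 0 < Y := (Finset.sum_pos (fun z hz => mul_pos (hπ z hz)
    (div_pos (Real.exp_pos _) (hPpos z hz))) hZ).trans_le hY1
  have key : ∀ z ∈ Z, π z * D z ≤ π z * (Real.log Y + Real.log col - 2)
      + π z * (Real.exp (D (s z)) / P (s z)) / Y + π z * P (s z) / col := fun z hz => by
    have hp := hPpos z hz
    have e1 := Real.log_le_sub_one_of_pos (div_pos (div_pos (Real.exp_pos (D (s z))) hp) hY)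
    have e2 := Real.log_le_sub_one_of_pos (div_pos hp hcol)
    rw [Real.log_div (by positivity) hY.ne', Real.log_div (by positivity) hp.ne', Real.log_exp] at e1
    rw [Real.log_div hp.ne' hcol.ne'] at e2
    have e3 := (hs z hz).2.2
    have : D z ≤ (Real.log Y + Real.log col - 2) + (Real.exp (D (s z)) / P (s z)) / Y
        + P (s z) / col := by linarith
    calc π z * D z ≤ π z * _ := mul_le_mul_of_nonneg_left this (hπ z hz).le
      _ = _ := by ring
  have := Finset.sum_le_sum key
  rw [Finset.sum_add_distrib, Finset.sum_add_distrib, ← Finset.sum_mul, hsum, ← Finset.sum_div,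
    ← Finset.sum_div] at this
  have h1 : (∑ z ∈ Z, π z * (Real.exp (D (s z)) / P (s z))) / Y ≤ 1 := by
    rw [div_le_one hY]; exact hY1
  have h2 : (∑ z ∈ Z, π z * P (s z)) / col ≤ 1 := by
    rw [div_le_one hcol]; exact hcol1
  linarith

/-- A weight on words, comparable on its support to the inverse continuant, whose mass grows by a
factor `1 + ε` under the transfer operator. -/
structure Weight where
  /-- the weight -/
  u : Word → ℝ
  /-- the growth rate -/
  ε : ℝ
  /-- the lower comparison constant -/
  lo : ℝ
  /-- the upper comparison constant -/
  hi : ℝ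
  ε_pos : 0 < ε
  lo_pos : 0 < lo
  hi_pos : 0 < hi
  nonneg : ∀ w, 0 ≤ u w
  grow : ∀ w, (1 + ε) * u w ≤ u (true :: w) + u (false :: w)
  le_hi : ∀ w, u w ≤ hi / cont w
  lo_le : ∀ w, 0 < u w → lo / cont w ≤ u w
  of_cons : ∀ b w, 0 < u (b :: w) → 0 < u w

namespace Weight

variable (W : Weight)

/-- The total weight of the two children of a word. -/
def children (w : Word) : ℝ := W.u (true :: w) + W.u (false :: w)

/-- The density, with respect to `W.u`, of the Markov measure obtained by normalising `W.u`. -/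
noncomputable def dens : Word → ℝ
  | [] => 1
  | _ :: w => dens w * W.u w / W.children w

/-- The mass of the cylinder of a word. -/
noncomputable def mass (w : Word) : ℝ := W.dens w * W.u w

lemma children_nonneg (w : Word) : 0 ≤ W.children w := add_nonneg (W.nonneg _) (W.nonneg _)

lemma dens_nonneg (w : Word) : 0 ≤ W.dens w := by
  induction w with
  | nil => exact zero_le_one
  | cons b w ih => exact div_nonneg (mul_nonneg ih (W.nonneg w)) (W.children_nonneg w)

lemma mass_nonneg (w : Word) : 0 ≤ W.mass w := mul_nonneg (W.dens_nonneg w) (W.nonneg w)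

lemma u_le_children (w : Word) : W.u w ≤ W.children w := by
  have := W.grow w
  have h := mul_nonneg W.ε_pos.le (W.nonneg w)
  unfold children
  nlinarith

lemma dens_cons_le (b : Bool) (w : Word) : (1 + W.ε) * W.dens (b :: w) ≤ W.dens w := by
  have hε := W.ε_pos
  rcases (W.children_nonneg w).eq_or_lt with h | h
  · simp [dens, ← h, W.dens_nonneg w]
  · rw [dens, mul_div_assoc', div_le_iff₀ h]
    have := mul_le_mul_of_nonneg_left (W.grow w) (W.dens_nonneg w)
    unfold children
    linarith

lemma dens_cons_le' (b : Bool) (w : Word) : W.dens (b :: w) ≤ W.dens w := by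
  have := W.dens_cons_le b w
  have := mul_nonneg W.ε_pos.le (W.dens_nonneg (b :: w))
  linarith

lemma mass_split (w : Word) : W.mass (true :: w) + W.mass (false :: w) = W.mass w := by
  unfold mass
  simp only [dens]
  rcases (W.children_nonneg w).eq_or_lt with h | h
  · have := W.u_le_children w
    have h2 := W.nonneg w
    have : W.u w = 0 := by linarith
    simp [this]
  · rw [← mul_add]
    change _ * W.children w = _
    field_simp

lemma dens_pos {w : Word} (h : 0 < W.u w) : 0 < W.dens w := by
  induction w with
  | nil => exact zero_lt_one
  | cons b w ih =>
    have h1 := W.of_cons b w h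
    exact div_pos (mul_pos (ih h1) h1) (h1.trans_le (W.u_le_children w))

lemma mass_pos {w : Word} (h : 0 < W.u w) : 0 < W.mass w := mul_pos (W.dens_pos h) h

lemma mass_le (w : Word) : W.mass w ≤ W.dens w * (W.hi / cont w) :=
  mul_le_mul_of_nonneg_left (W.le_hi w) (W.dens_nonneg w)

end Weight

/-- The words extending `w` whose continuant first reaches `θ`. -/
def leaves (θ : ℕ) : ℕ → Word → Finset Word
  | 0, w => {w}
  | n + 1, w => if θ ≤ cont w then {w} else leaves θ n (true :: w) ∪ leaves θ n (false :: w)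

lemma mem_leaves {θ n : ℕ} {w z : Word} (h : z ∈ leaves θ n w) : ∃ c, z = c ++ w := by
  induction n generalizing w with
  | zero => exact ⟨[], by simpa [leaves] using h⟩
  | succ n ih =>
    rw [leaves] at h
    split_ifs at h
    · exact ⟨[], by simpa using h⟩
    · rcases Finset.mem_union.1 h with h | h <;> obtain ⟨c, rfl⟩ := ih h
      exacts [⟨c ++ [true], by simp⟩, ⟨c ++ [false], by simp⟩]

lemma cont_of_mem_leaves {θ n : ℕ} {w z : Word} (h : z ∈ leaves θ n w) (hn : θ ≤ n + w.length)
    (hw : cont w ≤ 3 * θ) : θ ≤ cont z ∧ cont z ≤ 3 * θ := by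
  induction n generalizing w with
  | zero =>
    obtain rfl : z = w := by simpa [leaves] using h
    exact ⟨(by omega : θ ≤ z.length).trans (length_le_cont z), hw⟩
  | succ n ih =>
    rw [leaves] at h
    split_ifs at h with h1
    · obtain rfl : z = w := by simpa using h
      exact ⟨h1, hw⟩
    · have hb : ∀ b, cont (b :: w) ≤ 3 * θ := fun b => by have := cont_cons_le b w; omega
      rcases Finset.mem_union.1 h with h | h <;> refine ih h (by simp; omega) (hb _)

lemma append_cons_ne {c c' w : Word} {b b' : Bool} (h : b ≠ b') : c ++ b :: w ≠ c' ++ b' :: w := by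
  intro he
  have h1 : c.length = c'.length := by simpa using congrArg List.length he
  have := (List.append_inj he h1).2
  simp [h] at this

lemma disjoint_leaves (θ n : ℕ) (w : Word) :
    Disjoint (leaves θ n (true :: w)) (leaves θ n (false :: w)) := by
  rw [Finset.disjoint_left]
  intro z h1 h2
  obtain ⟨c, rfl⟩ := mem_leaves h1
  obtain ⟨c', h⟩ := mem_leaves h2
  exact append_cons_ne (by decide) h

lemma sum_leaves_succ (θ n : ℕ) (w : Word) (h : cont w < θ) (g : Word → ℝ) :
    ∑ z ∈ leaves θ (n + 1) w, g z =
      ∑ z ∈ leaves θ n (true :: w), g z + ∑ z ∈ leaves θ n (false :: w), g z := by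
  rw [leaves, if_neg (not_le.2 h), Finset.sum_union (disjoint_leaves θ n w)]

lemma Weight.sum_mass (W : Weight) (θ n : ℕ) (w : Word) :
    ∑ z ∈ leaves θ n w, W.mass z = W.mass w := by
  induction n generalizing w with
  | zero => simp [leaves]
  | succ n ih =>
    rcases le_or_gt θ (cont w) with h | h
    · simp [leaves, h]
    · rw [sum_leaves_succ θ n w h, ih, ih, W.mass_split]

/-- A base point of the cylinder of a word. -/
noncomputable def pt (w : Word) : ℝ := mob w (1 / 2)

lemma half_mem_Iv : (1 / 2 : ℝ) ∈ Iv := by constructor <;> norm_num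

lemma pt_mem_Iv (w : Word) : pt w ∈ Iv := mob_mem_Iv w half_mem_Iv

lemma pt_append (c w : Word) : pt (c ++ w) = mob w (pt c) := mob_append c w _

lemma psi_diff_bounds {β x y : ℝ} (h0 : 0 ≤ β) (h1 : β ≤ 1) (hx : x ∈ Iv) (hy : y ∈ Iv) :
    |x - y| / 4 ≤ |psi β x - psi β y| ∧ |psi β x - psi β y| ≤ |x - y| := by
  obtain ⟨hx0, hx1⟩ := hx
  obtain ⟨hy0, hy1⟩ := hy
  have ex : 1 ≤ 1 + β * x := by nlinarith
  have ey : 1 ≤ 1 + β * y := by nlinarith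
  have ex' : 1 + β * x ≤ 2 := by nlinarith
  have ey' : 1 + β * y ≤ 2 := by nlinarith
  have hp : 0 < (1 + β * x) * (1 + β * y) := by positivity
  rw [psi_sub h0 (by linarith) (by linarith), abs_div, abs_of_pos hp]
  constructor
  · apply div_le_div_of_nonneg_left (abs_nonneg _) hp; nlinarith
  · apply div_le_self (abs_nonneg _); nlinarith

lemma abs_mob_sub (w : Word) {x y : ℝ} (hx : 0 ≤ x) (hy : 0 ≤ y) :
    |mob w x - mob w y| = |psi (beta w) x - psi (beta w) y| / (cont w : ℝ) ^ 2 := by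
  rw [mob_sub w hx hy, abs_div, abs_mul, abs_pow, abs_neg, abs_one, one_pow, one_mul,
    abs_of_nonneg (sq_nonneg (cont w : ℝ))]

lemma Iv_nonneg {x : ℝ} (hx : x ∈ Iv) : 0 ≤ x := le_trans (by norm_num) hx.1

lemma abs_mob_sub_le (w : Word) {x y : ℝ} (hx : x ∈ Iv) (hy : y ∈ Iv) :
    |mob w x - mob w y| ≤ 1 / (2 * (cont w : ℝ) ^ 2) := by
  have hc := cont_pos w
  rw [abs_mob_sub w (Iv_nonneg hx) (Iv_nonneg hy), div_le_div_iff₀ (by positivity) (by positivity)]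
  have h1 := (psi_diff_bounds (beta_nonneg w) (beta_le_one w) hx hy).2
  have h2 : |x - y| ≤ 1 / 2 := by
    obtain ⟨hx0, hx1⟩ := hx
    obtain ⟨hy0, hy1⟩ := hy
    rw [abs_le]; constructor <;> linarith
  have := sq_nonneg (cont w : ℝ)
  nlinarith

lemma abs_pt_append_sub_le (c c' w : Word) :
    |pt (c ++ w) - pt (c' ++ w)| ≤ 1 / (2 * (cont w : ℝ) ^ 2) := by
  rw [pt_append, pt_append]
  exact abs_mob_sub_le w (pt_mem_Iv c) (pt_mem_Iv c')

lemma le_abs_pt_sub (c c' w : Word) :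
    1 / (28 * (cont w : ℝ) ^ 2) ≤ |pt (c ++ true :: w) - pt (c' ++ false :: w)| := by
  have hc := cont_pos w
  rw [pt_append, pt_append, mob_cons, mob_cons]
  have h1 := pt_mem_Iv c
  have h2 := pt_mem_Iv c'
  have k1 := one_div_mem_Iv true h1
  have k2 := one_div_mem_Iv false h2
  rw [abs_mob_sub w (Iv_nonneg k1) (Iv_nonneg k2)]
  have h3 := (psi_diff_bounds (beta_nonneg w) (beta_le_one w) k1 k2).1
  have h4 : 1 / 7 ≤ |1 / ((dig true : ℝ) + pt c) - 1 / (dig false + pt c')| := by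
    have e1 : 1 / ((dig true : ℝ) + pt c) ≤ 3 / 7 := by
      rw [div_le_div_iff₀ (by have := h1.1; simp [dig]; linarith) (by norm_num)]
      have := h1.1; simp [dig]; linarith
    have e2 : 4 / 7 ≤ 1 / ((dig false : ℝ) + pt c') := by
      rw [div_le_div_iff₀ (by norm_num) (by have := h2.1; simp [dig]; linarith)]
      have := h2.2; simp [dig]; linarith
    rw [abs_sub_comm]
    exact le_trans (by linarith) (le_abs_self _)
  rw [div_le_div_iff₀ (by positivity) (by positivity)]
  have := sq_nonneg (cont w : ℝ)
  nlinarith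

namespace Weight

variable (W : Weight)

lemma sum_mass_aux (w : Word) (s : ℝ) (hs : 0 < s) (h : 1 ≤ 57 * s * (cont w : ℝ) ^ 2) :
    W.mass w ≤ 8 * W.hi * W.dens w * √s := by
  have hc := cont_pos w
  have hhi := W.hi_pos
  have h1 : 1 ≤ 8 * √s * cont w := by
    have : (1 : ℝ) ≤ (8 * √s * cont w) ^ 2 := by
      rw [mul_pow, mul_pow, Real.sq_sqrt hs.le]
      have : 0 < s * (cont w : ℝ) ^ 2 := by positivity
      linarith
    exact (one_le_sq_iff₀ (by positivity)).1 this
  refine (W.mass_le w).trans ?_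
  have h2 : W.hi / cont w ≤ 8 * W.hi * √s := by
    rw [div_le_iff₀ hc]
    nlinarith
  have := mul_le_mul_of_nonneg_left h2 (W.dens_nonneg w)
  linarith

lemma sum_mass_near_le (θ n : ℕ) (w : Word) (hn : θ ≤ n + w.length) (t s : ℝ)
    (hs : 1 ≤ 57 * s * (θ : ℝ) ^ 2) :
    ∑ z ∈ leaves θ n w, (if |pt z - t| ≤ s then W.mass z else 0) ≤
      8 * W.hi * W.dens w * √s := by
  have hhi := W.hi_pos
  have hs0 : 0 < s := by
    by_contra h
    have := mul_nonneg (by linarith [not_lt.1 h] : 0 ≤ -(57 * s)) (sq_nonneg (θ : ℝ))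
    linarith
  induction n generalizing w with
  | zero =>
    refine (?_ : _ ≤ W.mass w).trans ?_
    · simp only [leaves, Finset.sum_singleton]
      split_ifs
      exacts [le_rfl, W.mass_nonneg w]
    · refine W.sum_mass_aux w s hs0 (hs.trans ?_)
      have : (θ : ℝ) ≤ cont w := by
        exact_mod_cast (by omega : θ ≤ w.length).trans (length_le_cont w)
      gcongr
  | succ n ih =>
    by_cases hbig : 1 ≤ 57 * s * (cont w : ℝ) ^ 2
    · refine (?_ : _ ≤ W.mass w).trans (W.sum_mass_aux w s hs0 hbig)
      rw [← W.sum_mass θ (n + 1) w]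
      refine Finset.sum_le_sum fun z _ => ?_
      split_ifs
      exacts [le_rfl, W.mass_nonneg z]
    have hθ : cont w < θ := by
      by_contra h
      have : (θ : ℝ) ≤ cont w := by exact_mod_cast not_lt.1 h
      exact hbig (hs.trans (by gcongr))
    rw [sum_leaves_succ θ n w hθ]
    have hih : ∀ b, ∑ z ∈ leaves θ n (b :: w), (if |pt z - t| ≤ s then W.mass z else 0) ≤
        8 * W.hi * W.dens w * √s := fun b => by
      refine (ih (b :: w) (by simp; omega)).trans ?_
      have := W.dens_cons_le' b w
      gcongr
    by_cases hT : ∃ z ∈ leaves θ n (true :: w), |pt z - t| ≤ s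
    · have hF : ∑ z ∈ leaves θ n (false :: w), (if |pt z - t| ≤ s then W.mass z else 0) = 0 := by
        refine Finset.sum_eq_zero fun z' hz' => if_neg fun h' => hbig ?_
        obtain ⟨z, hz, h⟩ := hT
        obtain ⟨c, rfl⟩ := mem_leaves hz
        obtain ⟨c', rfl⟩ := mem_leaves hz'
        have h1 := le_abs_pt_sub c c' w
        have h2 : |pt (c ++ true :: w) - pt (c' ++ false :: w)| ≤ 2 * s := by
          rw [abs_le] at *; constructor <;> linarith
        have h3 := h1.trans h2
        have hc := cont_pos w
        rw [div_le_iff₀ (by positivity)] at h3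
        have : 0 < s * (cont w : ℝ) ^ 2 := by positivity
        linarith
      rw [hF, add_zero]
      exact hih true
    · have hF : ∑ z ∈ leaves θ n (true :: w), (if |pt z - t| ≤ s then W.mass z else 0) = 0 :=
        Finset.sum_eq_zero fun z' hz' => if_neg fun h' => hT ⟨z', hz', h'⟩
      rw [hF, zero_add]
      exact hih false

/-- The constant of the energy estimate. -/
noncomputable def en : ℝ := 12 * W.hi * (1 + W.ε) / W.ε

lemma en_pos : 0 < W.en := by
  have h1 := W.ε_pos
  have h2 := W.hi_pos
  unfold en
  positivity

lemma sum_cross_le (θ n : ℕ) (w : Word) {r : ℝ} (hr : 0 < r) (b b' : Bool) (hb : b ≠ b') :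
    ∑ z ∈ leaves θ n (b :: w), ∑ z' ∈ leaves θ n (b' :: w),
      W.mass z * W.mass z' / √(|pt z - pt z'| + r) ≤ 6 * W.hi * W.mass (b :: w) * W.dens w := by
  have hc := cont_pos w
  have hhi := W.hi_pos
  have h1 : ∀ z ∈ leaves θ n (b :: w), ∀ z' ∈ leaves θ n (b' :: w),
      W.mass z * W.mass z' / √(|pt z - pt z'| + r) ≤ W.mass z * W.mass z' * (6 * cont w) := by
    intro z hz z' hz'
    have hd : 1 / (28 * (cont w : ℝ) ^ 2) ≤ |pt z - pt z'| := by
      obtain ⟨c, rfl⟩ := mem_leaves hz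
      obtain ⟨c', rfl⟩ := mem_leaves hz'
      cases b <;> cases b'
      · exact absurd rfl hb
      · rw [abs_sub_comm]; exact le_abs_pt_sub c' c w
      · exact le_abs_pt_sub c c' w
      · exact absurd rfl hb
    have h6 : 1 / (6 * (cont w : ℝ)) ≤ √(|pt z - pt z'| + r) := by
      apply Real.le_sqrt_of_sq_le
      refine le_trans ?_ (hd.trans (by linarith))
      rw [div_pow, one_pow, mul_pow]
      exact one_div_le_one_div_of_le (by positivity) (by nlinarith [sq_nonneg (cont w : ℝ)])
    rw [div_eq_mul_inv]
    apply mul_le_mul_of_nonneg_left _ (mul_nonneg (W.mass_nonneg z) (W.mass_nonneg z'))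
    rw [← one_div]
    refine (one_div_le_one_div_of_le (by positivity) h6).trans ?_
    rw [one_div_one_div]
  refine (Finset.sum_le_sum fun z hz => Finset.sum_le_sum (h1 z hz)).trans ?_
  simp only [← Finset.sum_mul, ← Finset.mul_sum]
  rw [W.sum_mass, W.sum_mass]
  have h2 : W.mass (b' :: w) * (6 * cont w) ≤ 6 * W.hi * W.dens w := by
    have h3 := W.mass_le (b' :: w)
    have h4 := W.dens_cons_le' b' w
    have h5 : W.hi / cont (b' :: w) ≤ W.hi / cont w := by
      apply div_le_div_of_nonneg_left hhi.le hc
      exact_mod_cast cont_le_cont_cons b' w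
    have h6 : W.mass (b' :: w) ≤ W.dens w * (W.hi / cont w) :=
      h3.trans (mul_le_mul h4 h5 (by positivity) (W.dens_nonneg w))
    calc W.mass (b' :: w) * (6 * cont w) ≤ W.dens w * (W.hi / cont w) * (6 * cont w) := by gcongr
      _ = _ := by field_simp
  calc _ = W.mass (b :: w) * (W.mass (b' :: w) * (6 * cont w)) := by ring
    _ ≤ W.mass (b :: w) * (6 * W.hi * W.dens w) :=
      mul_le_mul_of_nonneg_left h2 (W.mass_nonneg _)
    _ = _ := by ring

lemma energy_le (θ n : ℕ) (w : Word) (hn : θ ≤ n + w.length) {r : ℝ}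
    (hr : 1 ≤ r * (θ : ℝ) ^ 2) (hr0 : 0 < r) :
    ∑ z ∈ leaves θ n w, ∑ z' ∈ leaves θ n w, W.mass z * W.mass z' / √(|pt z - pt z'| + r) ≤
      W.en * W.mass w * W.dens w := by
  have hhi := W.hi_pos
  have hε := W.ε_pos
  have leaf : ∀ w : Word, θ ≤ cont w →
      W.mass w * W.mass w / √(|pt w - pt w| + r) ≤ W.en * W.mass w * W.dens w := by
    intro w hw
    have hc := cont_pos w
    have hrc : 1 ≤ √r * cont w := by
      have h1 : (θ : ℝ) ≤ cont w := by exact_mod_cast hw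
      have h2 : (1 : ℝ) ≤ r * (cont w : ℝ) ^ 2 := hr.trans (by gcongr)
      have h3 := Real.sqrt_le_sqrt h2
      rwa [Real.sqrt_one, Real.sqrt_mul hr0.le, Real.sqrt_sq hc.le] at h3
    have hs : 0 < √r := Real.sqrt_pos.2 hr0
    rw [sub_self, abs_zero, zero_add, div_le_iff₀ hs]
    have h1 : W.mass w ≤ W.dens w * (W.hi / cont w) := W.mass_le w
    have h2 : W.hi / cont w ≤ W.en * √r := by
      rw [div_le_iff₀ hc]
      have h3 : W.hi ≤ W.en := by
        unfold en
        rw [le_div_iff₀ hε]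
        nlinarith [mul_pos hhi hε]
      have := W.en_pos
      nlinarith
    calc W.mass w * W.mass w ≤ W.mass w * (W.dens w * (W.en * √r)) := by
          apply mul_le_mul_of_nonneg_left _ (W.mass_nonneg w)
          exact h1.trans (mul_le_mul_of_nonneg_left h2 (W.dens_nonneg w))
      _ = _ := by ring
  induction n generalizing w with
  | zero =>
    simp only [leaves, Finset.sum_singleton]
    exact leaf w ((by omega : θ ≤ w.length).trans (length_le_cont w))
  | succ n ih =>
    rcases le_or_gt θ (cont w) with h | h
    · simp only [leaves, h, if_true, Finset.sum_singleton]
      exact leaf w h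
    · simp only [sum_leaves_succ θ n w h, Finset.sum_add_distrib]
      have i1 := ih (true :: w) (by simp; omega)
      have i2 := ih (false :: w) (by simp; omega)
      have c1 := W.sum_cross_le θ n w hr0 true false (by decide)
      have c2 := W.sum_cross_le θ n w hr0 false true (by decide)
      have d : ∀ b, W.en * W.mass (b :: w) * W.dens (b :: w) ≤
          W.en * W.mass (b :: w) * (W.dens w / (1 + W.ε)) := fun b => by
        apply mul_le_mul_of_nonneg_left _ (mul_nonneg W.en_pos.le (W.mass_nonneg _))
        rw [le_div_iff₀ (by linarith)]
        linarith [W.dens_cons_le b w]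
      have d1 := d true
      have d2 := d false
      have hsp := W.mass_split w
      have e : W.en * (1 / (1 + W.ε)) + 12 * W.hi = W.en := by
        unfold en; field_simp
      have : W.en * W.mass w * W.dens w =
          W.en * W.mass (true :: w) * (W.dens w / (1 + W.ε)) +
          W.en * W.mass (false :: w) * (W.dens w / (1 + W.ε)) + 12 * W.hi * W.mass w * W.dens w := by
        calc _ = (W.en * (1 / (1 + W.ε)) + 12 * W.hi) * W.mass w * W.dens w := by rw [e]
          _ = _ := by rw [← hsp]; ring
      have h0 := mul_nonneg (mul_nonneg hhi.le (W.mass_nonneg w)) (W.dens_nonneg w)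
      rw [this]
      rw [← hsp] at h0 ⊢
      nlinarith

end Weight

/-- The local coordinate on the sum of two cylinders. -/
noncomputable def loc (β β' κ : ℝ) (x y : ℝ) : ℝ := psi β x + κ * psi β' y

lemma card_le_of_diam (A : Finset ℕ) {D : ℝ} (hD : 0 ≤ D)
    (h : ∀ i ∈ A, ∀ j ∈ A, (j : ℝ) - i ≤ D) : (A.card : ℝ) ≤ 1 + D := by
  rcases A.eq_empty_or_nonempty with rfl | hne
  · simp; linarith
  set i := A.min' hne
  have hsub : A ⊆ Finset.Icc i (i + ⌊D⌋₊) := fun j hj => by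
    have h1 := A.min'_le j hj
    have h2 := h i (A.min'_mem hne) j hj
    refine Finset.mem_Icc.2 ⟨h1, ?_⟩
    have : j - i ≤ ⌊D⌋₊ := Nat.le_floor (by rw [Nat.cast_sub h1]; exact h2)
    omega
  have h1 := Finset.card_le_card hsub
  rw [Nat.card_Icc] at h1
  have h2 : A.card ≤ 1 + ⌊D⌋₊ := by omega
  have h3 : (A.card : ℝ) ≤ 1 + (⌊D⌋₊ : ℝ) := by exact_mod_cast h2
  linarith [Nat.floor_le hD]

/-- The grid of scaling parameters. -/
noncomputable def kap (J j : ℕ) : ℝ := 1 + j / J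

lemma kap_bounds {J j : ℕ} (hj : j < J) : 1 ≤ kap J j ∧ kap J j ≤ 2 := by
  have hJ : (0 : ℝ) < J := by exact_mod_cast (by omega : 0 < J)
  have h : (j : ℝ) / J ≤ 1 := by rw [div_le_one hJ]; exact_mod_cast hj.le
  have h0 : (0 : ℝ) ≤ (j : ℝ) / J := by positivity
  unfold kap
  constructor <;> linarith

lemma count_le {β β' x x' y y' r : ℝ} (h0 : 0 ≤ β) (h1 : β ≤ 1) (h0' : 0 ≤ β') (h1' : β' ≤ 1)
    (hx : x ∈ Iv) (hx' : x' ∈ Iv) (hy : y ∈ Iv) (hy' : y' ∈ Iv) (hr : 0 < r) {J : ℕ}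
    (hJ : |y - y'| + r ≤ J * r) :
    ∑ j ∈ Finset.range J, (if |loc β β' (kap J j) x y - loc β β' (kap J j) x' y'| ≤ 40 * r
      then (1 : ℝ) else 0) ≤
    if |x - x'| ≤ 168 * (|y - y'| + r) then 642 * J * r / (|y - y'| + r) else 0 := by
  set X := psi β x - psi β x' with hX
  set Y := psi β' y - psi β' y' with hY
  have e : ∀ j, loc β β' (kap J j) x y - loc β β' (kap J j) x' y' = X + kap J j * Y := fun j => by
    simp only [loc, hX, hY]; ring
  obtain ⟨hX1, hX2⟩ := psi_diff_bounds h0 h1 hx hx'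
  obtain ⟨hY1, hY2⟩ := psi_diff_bounds h0' h1' hy hy'
  rw [← hX] at hX1 hX2
  rw [← hY] at hY1 hY2
  have hyr : 0 < |y - y'| + r := by positivity
  have hJ0 : (0 : ℝ) < J := by
    by_contra h
    have : (J : ℝ) * r ≤ 0 := mul_nonpos_of_nonpos_of_nonneg (not_lt.1 h) hr.le
    linarith
  simp only [e]
  split_ifs with hc
  · rw [Finset.sum_ite, Finset.sum_const_zero, add_zero, Finset.sum_const, nsmul_eq_mul, mul_one]
    rcases le_or_gt |y - y'| r with hle | hgt
    · have : ((Finset.filter (fun j => |X + kap J j * Y| ≤ 40 * r) (Finset.range J)).card : ℝ) ≤ J := by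
        exact_mod_cast (Finset.card_filter_le _ _).trans (Finset.card_range J).le
      refine this.trans ?_
      rw [le_div_iff₀ hyr]
      nlinarith
    · have hYpos : 0 < |Y| := by linarith
      have hcard := card_le_of_diam
        (Finset.filter (fun j => |X + kap J j * Y| ≤ 40 * r) (Finset.range J))
        (D := 80 * r * J / |Y|) (by positivity) (by
          intro i hi j hj
          have hi := (Finset.mem_filter.1 hi).2
          have hj := (Finset.mem_filter.1 hj).2
          rw [le_div_iff₀ hYpos]
          have h3 : |(kap J j - kap J i) * Y| ≤ 80 * r := by
            rw [show (kap J j - kap J i) * Y = (X + kap J j * Y) - (X + kap J i * Y) by ring]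
            exact (abs_sub _ _).trans (by linarith)
          have h4 : kap J j - kap J i = ((j : ℝ) - i) / J := by unfold kap; ring
          rw [h4, abs_mul, abs_div, abs_of_pos hJ0, div_mul_eq_mul_div, div_le_iff₀ hJ0] at h3
          exact (mul_le_mul_of_nonneg_right (le_abs_self _) hYpos.le).trans h3)
      refine hcard.trans ?_
      have h5 : 80 * r * J / |Y| ≤ 640 * J * r / (|y - y'| + r) := by
        rw [div_le_div_iff₀ hYpos hyr]
        have : |y - y'| + r ≤ 8 * |Y| := by linarith
        have h6 : 0 < r * J := by positivity
        nlinarith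
      have h6 : 1 ≤ J * r / (|y - y'| + r) := by rw [le_div_iff₀ hyr]; linarith
      have h7 : 642 * J * r / (|y - y'| + r) =
          640 * J * r / (|y - y'| + r) + 2 * (J * r / (|y - y'| + r)) := by ring
      rw [h7]
      linarith
  · refine (Finset.sum_eq_zero fun j hj => if_neg fun h => hc ?_).le
    have hk := kap_bounds (Finset.mem_range.1 hj)
    have h8 : |X| ≤ 40 * r + 2 * |Y| := by
      have : X = (X + kap J j * Y) - kap J j * Y := by ring
      rw [this]
      refine (abs_sub _ _).trans ?_
      rw [abs_mul, abs_of_nonneg (by linarith : 0 ≤ kap J j)]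
      have := mul_le_mul_of_nonneg_right hk.2 (abs_nonneg Y)
      linarith
    linarith [abs_nonneg (y - y')]

namespace Weight

variable (W : Weight)

lemma collision_le {β β' r : ℝ} (h0 : 0 ≤ β) (h1 : β ≤ 1) (h0' : 0 ≤ β') (h1' : β' ≤ 1)
    (θ n : ℕ) (w v : Word) (hn : θ ≤ n + w.length) (hn' : θ ≤ n + v.length)
    (hr : 1 ≤ r * (θ : ℝ) ^ 2) (hr0 : 0 < r) {J : ℕ}
    (hJ : ∀ b ∈ leaves θ n v, ∀ b' ∈ leaves θ n v, |pt b - pt b'| + r ≤ J * r) :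
    ∑ j ∈ Finset.range J, ∑ b ∈ leaves θ n v, ∑ b' ∈ leaves θ n v, ∑ a ∈ leaves θ n w,
      ∑ a' ∈ leaves θ n w, (if |loc β β' (kap J j) (pt a) (pt b) - loc β β' (kap J j) (pt a') (pt b')|
        ≤ 40 * r then W.mass a * W.mass b * (W.mass a' * W.mass b') else 0) ≤
      66768 * W.hi * W.en * J * r * (W.mass w * W.dens w) * (W.mass v * W.dens v) := by
  have hhi := W.hi_pos
  have inner : ∀ b ∈ leaves θ n v, ∀ b' ∈ leaves θ n v, ∀ a ∈ leaves θ n w,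
      ∑ a' ∈ leaves θ n w, ∑ j ∈ Finset.range J,
        (if |loc β β' (kap J j) (pt a) (pt b) - loc β β' (kap J j) (pt a') (pt b')|
        ≤ 40 * r then W.mass a * W.mass b * (W.mass a' * W.mass b') else 0) ≤
      W.mass a * (66768 * W.hi * J * r * W.dens w *
        (W.mass b * W.mass b' / √(|pt b - pt b'| + r))) := by
    intro b hb b' hb' a ha
    set q := |pt b - pt b'| + r with hq
    have hq0 : 0 < q := by positivity
    have hM : 0 ≤ W.mass a * W.mass b * W.mass b' :=
      mul_nonneg (mul_nonneg (W.mass_nonneg a) (W.mass_nonneg b)) (W.mass_nonneg b')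
    have step : ∀ a' ∈ leaves θ n w, ∑ j ∈ Finset.range J,
        (if |loc β β' (kap J j) (pt a) (pt b) - loc β β' (kap J j) (pt a') (pt b')|
        ≤ 40 * r then W.mass a * W.mass b * (W.mass a' * W.mass b') else 0) ≤
        W.mass a * W.mass b * W.mass b' * (642 * J * r / q) *
          (if |pt a' - pt a| ≤ 168 * q then W.mass a' else 0) := by
      intro a' ha'
      have hcnt := count_le h0 h1 h0' h1' (pt_mem_Iv a) (pt_mem_Iv a') (pt_mem_Iv b)
        (pt_mem_Iv b') hr0 (hJ b hb b' hb')
      rw [← hq, abs_sub_comm (pt a)] at hcnt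
      have e1 : ∀ j, (if |loc β β' (kap J j) (pt a) (pt b) - loc β β' (kap J j) (pt a') (pt b')|
        ≤ 40 * r then W.mass a * W.mass b * (W.mass a' * W.mass b') else 0) =
        W.mass a * W.mass b * W.mass b' * W.mass a' *
        (if |loc β β' (kap J j) (pt a) (pt b) - loc β β' (kap J j) (pt a') (pt b')|
        ≤ 40 * r then 1 else 0) := fun j => by split_ifs <;> ring
      simp only [e1]
      rw [← Finset.mul_sum]
      refine (mul_le_mul_of_nonneg_left hcnt (mul_nonneg hM (W.mass_nonneg a'))).trans (le_of_eq ?_)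
      split_ifs <;> ring
    refine (Finset.sum_le_sum step).trans ?_
    rw [← Finset.mul_sum]
    have hF := W.sum_mass_near_le θ n w hn (pt a) (168 * q) (by
      have : 1 ≤ q * (θ : ℝ) ^ 2 := hr.trans (by
        apply mul_le_mul_of_nonneg_right _ (sq_nonneg _)
        linarith [abs_nonneg (pt b - pt b')])
      linarith)
    have hs : √(168 * q) ≤ 13 * √q := by
      rw [show 13 * √q = √(13 ^ 2 * q) by rw [Real.sqrt_mul (by norm_num), Real.sqrt_sq (by norm_num)]]
      exact Real.sqrt_le_sqrt (by linarith)
    have hF' := hF.trans (mul_le_mul_of_nonneg_left hs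
      (mul_nonneg (by positivity : 0 ≤ 8 * W.hi) (W.dens_nonneg w)))
    refine (mul_le_mul_of_nonneg_left hF' (mul_nonneg hM (by positivity))).trans (le_of_eq ?_)
    have hsq : 0 < √q := Real.sqrt_pos.2 hq0
    have hqq : q = √q * √q := (Real.mul_self_sqrt hq0.le).symm
    have : √q / q = 1 / √q := by
      rw [div_eq_div_iff hq0.ne' hsq.ne', one_mul, ← hqq]
    calc _ = W.mass a * (66768 * W.hi * J * r * W.dens w * (W.mass b * W.mass b' * (√q / q))) := by
          ring
      _ = _ := by rw [this]; ring
  calc _ = ∑ b ∈ leaves θ n v, ∑ b' ∈ leaves θ n v, ∑ a ∈ leaves θ n w, ∑ a' ∈ leaves θ n w,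
        ∑ j ∈ Finset.range J,
        (if |loc β β' (kap J j) (pt a) (pt b) - loc β β' (kap J j) (pt a') (pt b')|
        ≤ 40 * r then W.mass a * W.mass b * (W.mass a' * W.mass b') else 0) := by
        rw [Finset.sum_comm]
        refine Finset.sum_congr rfl fun b _ => ?_
        rw [Finset.sum_comm]
        refine Finset.sum_congr rfl fun b' _ => ?_
        rw [Finset.sum_comm]
        refine Finset.sum_congr rfl fun a _ => ?_
        rw [Finset.sum_comm]
    _ ≤ ∑ b ∈ leaves θ n v, ∑ b' ∈ leaves θ n v, ∑ a ∈ leaves θ n w,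
        W.mass a * (66768 * W.hi * J * r * W.dens w *
        (W.mass b * W.mass b' / √(|pt b - pt b'| + r))) :=
        Finset.sum_le_sum fun b hb => Finset.sum_le_sum fun b' hb' =>
          Finset.sum_le_sum fun a ha => inner b hb b' hb' a ha
    _ = W.mass w * (66768 * W.hi * J * r * W.dens w *
        ∑ b ∈ leaves θ n v, ∑ b' ∈ leaves θ n v, W.mass b * W.mass b' / √(|pt b - pt b'| + r)) := by
        simp only [← Finset.sum_mul, W.sum_mass, ← Finset.mul_sum]
    _ ≤ W.mass w * (66768 * W.hi * J * r * W.dens w * (W.en * W.mass v * W.dens v)) := by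
        apply mul_le_mul_of_nonneg_left _ (W.mass_nonneg w)
        apply mul_le_mul_of_nonneg_left (W.energy_le θ n v hn' hr hr0)
        exact mul_nonneg (by positivity) (W.dens_nonneg w)
    _ = _ := by ring

end Weight

lemma abs_psi_perturb {β β₁ δ x y : ℝ} (h0 : 0 ≤ β) (h1 : β ≤ 1) (h0' : 0 ≤ β₁) (h1' : β₁ ≤ 1)
    (hδ : |β₁ - β| ≤ δ) (hx : x ∈ Iv) (hy : y ∈ Iv) :
    |(psi β₁ x - psi β₁ y) - (psi β x - psi β y)| ≤ 3 * δ * |x - y| := by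
  obtain ⟨hx0, hx1⟩ := hx
  obtain ⟨hy0, hy1⟩ := hy
  have hx : 0 ≤ x := by linarith
  have hy : 0 ≤ y := by linarith
  rw [psi_sub h0' hx hy, psi_sub h0 hx hy]
  have p1 : 1 ≤ (1 + β₁ * x) * (1 + β₁ * y) := by
    have := mul_nonneg h0' hx; have := mul_nonneg h0' hy; nlinarith
  have p2 : 1 ≤ (1 + β * x) * (1 + β * y) := by
    have := mul_nonneg h0 hx; have := mul_nonneg h0 hy; nlinarith
  have e : (x - y) / ((1 + β₁ * x) * (1 + β₁ * y)) - (x - y) / ((1 + β * x) * (1 + β * y)) =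
      (x - y) * ((β - β₁) * (x + y + (β + β₁) * (x * y))) /
        (((1 + β₁ * x) * (1 + β₁ * y)) * ((1 + β * x) * (1 + β * y))) := by
    field_simp; ring
  have hxy : 0 ≤ x * y := mul_nonneg hx hy
  have hxy' : x * y ≤ 9 / 16 := by nlinarith
  have hs : 0 ≤ x + y + (β + β₁) * (x * y) := by positivity
  have hs' : x + y + (β + β₁) * (x * y) ≤ 3 := by nlinarith
  rw [e, abs_div, abs_mul, abs_mul, abs_of_nonneg hs, abs_sub_comm β]
  refine (div_le_self (by positivity) ?_).trans ?_
  · rw [abs_of_pos (by positivity)]; nlinarith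
  · have := mul_le_mul hδ hs' hs (le_trans (abs_nonneg _) hδ)
    have := mul_le_mul_of_nonneg_left this (abs_nonneg (x - y))
    linarith

/-- `(β₁, β₁', κ₁)` is a `δ`-perturbation of `(β, β', κ)`. -/
def Near (δ β β' κ β₁ β₁' κ₁ : ℝ) : Prop :=
  (0 ≤ β₁ ∧ β₁ ≤ 1 ∧ |β₁ - β| ≤ δ) ∧ (0 ≤ β₁' ∧ β₁' ≤ 1 ∧ |β₁' - β'| ≤ δ) ∧ |κ₁ - κ| ≤ δ

lemma abs_loc_perturb {δ β β' κ β₁ β₁' κ₁ x y x' y' : ℝ} (h0 : 0 ≤ β) (h1 : β ≤ 1) (h0' : 0 ≤ β')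
    (h1' : β' ≤ 1) (hκ0 : 0 ≤ κ) (hκ : κ ≤ 2) (h : Near δ β β' κ β₁ β₁' κ₁)
    (hx : x ∈ Iv) (hx' : x' ∈ Iv) (hy : y ∈ Iv) (hy' : y' ∈ Iv) :
    |(loc β₁ β₁' κ₁ x y - loc β₁ β₁' κ₁ x' y') - (loc β β' κ x y - loc β β' κ x' y')| ≤
      3 * δ * |x - x'| + 7 * δ * |y - y'| := by
  obtain ⟨⟨a0, a1, ad⟩, ⟨b0, b1, bd⟩, kd⟩ := h
  have e1 := abs_psi_perturb h0 h1 a0 a1 ad hx hx'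
  have e2 := abs_psi_perturb h0' h1' b0 b1 bd hy hy'
  have e3 := (psi_diff_bounds b0 b1 hy hy').2
  have e : (loc β₁ β₁' κ₁ x y - loc β₁ β₁' κ₁ x' y') - (loc β β' κ x y - loc β β' κ x' y') =
      ((psi β₁ x - psi β₁ x') - (psi β x - psi β x')) +
      ((κ₁ - κ) * (psi β₁' y - psi β₁' y') +
        κ * ((psi β₁' y - psi β₁' y') - (psi β' y - psi β' y'))) := by
    unfold loc; ring
  rw [e]
  refine (abs_add_le _ _).trans (add_le_add e1 ((abs_add_le _ _).trans ?_))
  rw [abs_mul, abs_mul, abs_of_nonneg hκ0]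
  have f1 := mul_le_mul kd e3 (abs_nonneg _) (le_trans (abs_nonneg _) kd)
  have f2 := mul_le_mul hκ e2 (abs_nonneg _) (by norm_num)
  linarith

lemma abs_loc_sub_le {β β' κ x y x' y' : ℝ} (h0 : 0 ≤ β) (h1 : β ≤ 1) (h0' : 0 ≤ β')
    (h1' : β' ≤ 1) (hκ0 : 0 ≤ κ) (hx : x ∈ Iv) (hx' : x' ∈ Iv) (hy : y ∈ Iv) (hy' : y' ∈ Iv) :
    |loc β β' κ x y - loc β β' κ x' y'| ≤ |x - x'| + κ * |y - y'| := by
  have e : loc β β' κ x y - loc β β' κ x' y' =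
      (psi β x - psi β x') + κ * (psi β' y - psi β' y') := by unfold loc; ring
  rw [e]
  refine (abs_add_le _ _).trans (add_le_add (psi_diff_bounds h0 h1 hx hx').2 ?_)
  rw [abs_mul, abs_of_nonneg hκ0]
  have h := psi_diff_bounds h0' h1' hy hy'
  exact mul_le_mul_of_nonneg_left h.2 hκ0

/-- The local coordinate of a pair of words. -/
noncomputable def ploc (β β' κ : ℝ) (z : Word × Word) : ℝ := loc β β' κ (pt z.1) (pt z.2)

namespace Weight

variable (W : Weight)

open Classical in
/-- The admissible pairs of words of continuant about `θ` extending a given pair. -/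
noncomputable def pairs (θ : ℕ) (w v : Word) : Finset (Word × Word) :=
  (leaves θ θ w ×ˢ leaves θ θ v).filter fun z => 0 < W.u z.1 ∧ 0 < W.u z.2

/-- The conditional probability of a pair. -/
noncomputable def prob (w v : Word) (z : Word × Word) : ℝ :=
  W.mass z.1 * W.mass z.2 / (W.mass w * W.mass v)

/-- The collision probability at scale `40 / θ ^ 2`. -/
noncomputable def col (β β' κ : ℝ) (θ : ℕ) (w v : Word) : ℝ :=
  ∑ z ∈ W.pairs θ w v, ∑ z' ∈ W.pairs θ w v,
    if |ploc β β' κ z - ploc β β' κ z'| ≤ 2 * (20 * (1 / (θ : ℝ) ^ 2))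
    then W.prob w v z * W.prob w v z' else 0

lemma u_eq_zero_of_not_pos {w : Word} (h : ¬ 0 < W.u w) : W.u w = 0 :=
  le_antisymm (not_lt.1 h) (W.nonneg w)

lemma sum_prob {w v : Word} (hw : 0 < W.u w) (hv : 0 < W.u v) (θ : ℕ) :
    ∑ z ∈ W.pairs θ w v, W.prob w v z = 1 := by
  classical
  unfold pairs
  rw [Finset.sum_filter_of_ne]
  · rw [Finset.sum_product]
    simp only [prob, ← Finset.sum_div, ← Finset.mul_sum, ← Finset.sum_mul, W.sum_mass]
    exact div_self (mul_pos (W.mass_pos hw) (W.mass_pos hv)).ne'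
  · intro z _ h
    constructor <;> by_contra hc <;> apply h <;>
      simp [prob, mass, W.u_eq_zero_of_not_pos hc]

lemma prob_pos {w v : Word} (hw : 0 < W.u w) (hv : 0 < W.u v) {θ : ℕ} {z : Word × Word}
    (hz : z ∈ W.pairs θ w v) : 0 < W.prob w v z := by
  classical
  have h := (Finset.mem_filter.1 hz).2
  exact div_pos (mul_pos (W.mass_pos h.1) (W.mass_pos h.2)) (mul_pos (W.mass_pos hw) (W.mass_pos hv))

lemma col_pos (β β' κ : ℝ) {w v : Word} (hw : 0 < W.u w) (hv : 0 < W.u v) (θ : ℕ) :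
    0 < W.col β β' κ θ w v := by
  have hne : (W.pairs θ w v).Nonempty := by
    rw [Finset.nonempty_iff_ne_empty]; intro h
    have := W.sum_prob hw hv θ
    rw [h] at this; simp at this
  refine Finset.sum_pos (fun z hz => ?_) hne
  have hz0 := W.prob_pos hw hv hz
  have h0 : ∀ z' ∈ W.pairs θ w v, 0 ≤ (if |ploc β β' κ z - ploc β β' κ z'| ≤
      2 * (20 * (1 / (θ : ℝ) ^ 2)) then W.prob w v z * W.prob w v z' else 0) := fun z' hz' => by
    split_ifs
    exacts [(mul_pos hz0 (W.prob_pos hw hv hz')).le, le_rfl]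
  refine Finset.sum_pos' h0 ⟨z, hz, ?_⟩
  rw [sub_self, abs_zero, if_pos (by positivity)]
  exact mul_pos hz0 hz0

/-- The constant of the collision estimate. -/
noncomputable def cc : ℝ := 66768 * W.hi * W.en / W.lo ^ 2

lemma cc_pos : 0 < W.cc := by
  have := W.hi_pos
  have := W.en_pos
  have := W.lo_pos
  unfold cc
  positivity

lemma dens_div_mass_le {w : Word} (hw : 0 < W.u w) : W.dens w / W.mass w ≤ cont w / W.lo := by
  have h := W.lo_le w hw
  have hd := W.dens_pos hw
  have hl := W.lo_pos
  have hc := cont_pos w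
  rw [div_le_div_iff₀ (W.mass_pos hw) hl, mass]
  rw [div_le_iff₀ hc] at h
  nlinarith

lemma sum_col_le {β β' : ℝ} (h0 : 0 ≤ β) (h1 : β ≤ 1) (h0' : 0 ≤ β') (h1' : β' ≤ 1)
    {θ : ℕ} (hθ : 0 < θ) {w v : Word} (hw : 0 < W.u w) (hv : 0 < W.u v) {J : ℕ}
    (hJ : (θ : ℝ) ^ 2 ≤ (J - 1) * (cont v : ℝ) ^ 2) :
    ∑ j ∈ Finset.range J, W.col β β' (kap J j) θ w v ≤
      W.cc * J / (θ : ℝ) ^ 2 * cont w * cont v := by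
  classical
  have hθ' : (0 : ℝ) < (θ : ℝ) ^ 2 := by
    have : (0 : ℝ) < θ := by exact_mod_cast hθ
    positivity
  have hmw := W.mass_pos hw
  have hmv := W.mass_pos hv
  have hhi := W.hi_pos
  have hen := W.en_pos
  have hlo := W.lo_pos
  have hc := cont_pos v
  have hc' := cont_pos w
  have main := W.collision_le h0 h1 h0' h1' θ θ w v (by omega) (by omega)
    (r := 1 / (θ : ℝ) ^ 2) (J := J) (by field_simp; exact le_rfl) (by positivity) (by
      intro b hb b' hb'
      obtain ⟨c, rfl⟩ := mem_leaves hb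
      obtain ⟨c', rfl⟩ := mem_leaves hb'
      have := abs_pt_append_sub_le c c' v
      have h2 : 1 / (2 * (cont v : ℝ) ^ 2) ≤ (J - 1) * (1 / (θ : ℝ) ^ 2) := by
        rw [mul_one_div, div_le_div_iff₀ (by positivity) hθ']
        nlinarith
      linarith)
  have e : ∀ j, W.col β β' (kap J j) θ w v ≤ (∑ b ∈ leaves θ θ v, ∑ b' ∈ leaves θ θ v,
      ∑ a ∈ leaves θ θ w, ∑ a' ∈ leaves θ θ w,
      (if |loc β β' (kap J j) (pt a) (pt b) - loc β β' (kap J j) (pt a') (pt b')|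
        ≤ 40 * (1 / (θ : ℝ) ^ 2) then W.mass a * W.mass b * (W.mass a' * W.mass b') else 0)) /
        (W.mass w * W.mass v) ^ 2 := by
    intro j
    have n0 : ∀ z z' : Word × Word, 0 ≤ (if |ploc β β' (kap J j) z - ploc β β' (kap J j) z'| ≤
      2 * (20 * (1 / (θ : ℝ) ^ 2)) then W.prob w v z * W.prob w v z' else 0) := fun z z' => by
      have p : ∀ z, 0 ≤ W.prob w v z := fun z =>
        div_nonneg (mul_nonneg (W.mass_nonneg _) (W.mass_nonneg _)) (mul_pos hmw hmv).le
      split_ifs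
      exacts [mul_nonneg (p z) (p z'), le_rfl]
    have s1 : W.col β β' (kap J j) θ w v ≤ ∑ z ∈ leaves θ θ w ×ˢ leaves θ θ v,
        ∑ z' ∈ leaves θ θ w ×ˢ leaves θ θ v,
        (if |ploc β β' (kap J j) z - ploc β β' (kap J j) z'| ≤
      2 * (20 * (1 / (θ : ℝ) ^ 2)) then W.prob w v z * W.prob w v z' else 0) := by
      unfold col pairs
      refine (Finset.sum_le_sum_of_subset_of_nonneg (Finset.filter_subset _ _)
        fun z _ _ => Finset.sum_nonneg fun z' _ => n0 z z').trans ?_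
      exact Finset.sum_le_sum fun z _ => Finset.sum_le_sum_of_subset_of_nonneg
        (Finset.filter_subset _ _) fun z' _ _ => n0 z z'
    refine s1.trans (le_of_eq ?_)
    simp only [Finset.sum_product, Finset.sum_div]
    rw [Finset.sum_comm]
    refine Finset.sum_congr rfl fun b _ => ?_
    calc _ = ∑ a ∈ leaves θ θ w, ∑ b' ∈ leaves θ θ v, ∑ a' ∈ leaves θ θ w, _ := by
          refine Finset.sum_congr rfl fun a _ => Finset.sum_comm
      _ = ∑ b' ∈ leaves θ θ v, ∑ a ∈ leaves θ θ w, ∑ a' ∈ leaves θ θ w, _ := Finset.sum_comm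
      _ = _ := by
          refine Finset.sum_congr rfl fun b' _ => Finset.sum_congr rfl fun a _ =>
            Finset.sum_congr rfl fun a' _ => ?_
          simp only [ploc, prob]
          rw [show (2 : ℝ) * (20 * (1 / (θ : ℝ) ^ 2)) = 40 * (1 / (θ : ℝ) ^ 2) by ring]
          by_cases h : |loc β β' (kap J j) (pt a) (pt b) - loc β β' (kap J j) (pt a') (pt b')|
            ≤ 40 * (1 / (θ : ℝ) ^ 2)
          · rw [if_pos h]
            refine (ite_cond_eq_true _ _ (eq_true h)).trans ?_
            field_simp
          · rw [if_neg h, zero_div]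
            exact ite_cond_eq_false _ _ (eq_false h)
  refine (Finset.sum_le_sum fun j _ => e j).trans ?_
  rw [← Finset.sum_div]
  refine (div_le_div_of_nonneg_right main (sq_nonneg _)).trans ?_
  have k1 := W.dens_div_mass_le hw
  have k2 := W.dens_div_mass_le hv
  calc _ = 66768 * W.hi * W.en * J * (1 / (θ : ℝ) ^ 2) *
        ((W.dens w / W.mass w) * (W.dens v / W.mass v)) := by field_simp
    _ ≤ 66768 * W.hi * W.en * J * (1 / (θ : ℝ) ^ 2) * ((cont w / W.lo) * (cont v / W.lo)) := by
        apply mul_le_mul_of_nonneg_left _ (by positivity)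
        exact mul_le_mul k1 k2 (div_nonneg (W.dens_nonneg v) (W.mass_nonneg v)) (by positivity)
    _ = _ := by unfold cc; field_simp

/-- The entropy collected by the pairs of words through `n` levels. -/
noncomputable def ent (Q : ℕ) (β β' κ : ℝ) : ℕ → ℕ → Word → Word → ℝ
  | 0, _, _, _ => 0
  | n + 1, i, w, v => -Real.log (W.col β β' κ (Q ^ (i + 1)) w v) +
      ∑ z ∈ W.pairs (Q ^ (i + 1)) w v, W.prob w v z * ent Q β β' κ n (i + 1) z.1 z.2

/-- Admissible words of level `i`. -/
def Lev (Q i : ℕ) (w : Word) : Prop := 0 < W.u w ∧ Q ^ i ≤ cont w ∧ cont w ≤ 3 * Q ^ i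

lemma lev_of_mem_pairs {Q i : ℕ} (hQ : 1 ≤ Q) {w v : Word} (hw : W.Lev Q i w) (hv : W.Lev Q i v)
    {z : Word × Word} (hz : z ∈ W.pairs (Q ^ (i + 1)) w v) :
    W.Lev Q (i + 1) z.1 ∧ W.Lev Q (i + 1) z.2 ∧ (∃ c, z.1 = c ++ w) ∧ ∃ c, z.2 = c ++ v := by
  classical
  obtain ⟨hz1, hz2⟩ := Finset.mem_filter.1 hz
  obtain ⟨hz3, hz4⟩ := Finset.mem_product.1 hz1
  have hp : Q ^ i ≤ Q ^ (i + 1) := Nat.pow_le_pow_right hQ (by omega)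
  exact ⟨⟨hz2.1, cont_of_mem_leaves hz3 (by omega) (by have := hw.2.2; omega)⟩,
    ⟨hz2.2, cont_of_mem_leaves hz4 (by omega) (by have := hv.2.2; omega)⟩, mem_leaves hz3, mem_leaves hz4⟩

lemma le_sum_ent {Q : ℕ} (hQ : 1 ≤ Q) {β β' : ℝ} (h0 : 0 ≤ β) (h1 : β ≤ 1) (h0' : 0 ≤ β')
    (h1' : β' ≤ 1) (n i : ℕ) (w v : Word) (hw : W.Lev Q i w) (hv : W.Lev Q i v) :
    ((Q ^ 2 + 1 : ℕ) : ℝ) * (n * Real.log (Q ^ 2 / (9 * W.cc))) ≤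
      ∑ j ∈ Finset.range (Q ^ 2 + 1), W.ent Q β β' (kap (Q ^ 2 + 1) j) n i w v := by
  set J := Q ^ 2 + 1 with hJ
  have hcc := W.cc_pos
  have hQ0 : (0 : ℝ) < Q := by exact_mod_cast hQ
  induction n generalizing i w v with
  | zero => simp [ent]
  | succ n ih =>
    simp only [ent]
    rw [Finset.sum_add_distrib, Finset.sum_comm]
    have a1 : ((J : ℕ) : ℝ) * (n * Real.log (Q ^ 2 / (9 * W.cc))) ≤
        ∑ z ∈ W.pairs (Q ^ (i + 1)) w v, ∑ j ∈ Finset.range J,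
          W.prob w v z * W.ent Q β β' (kap J j) n (i + 1) z.1 z.2 := by
      rw [← one_mul ((J : ℝ) * _), ← W.sum_prob hw.1 hv.1 (Q ^ (i + 1)), Finset.sum_mul]
      refine Finset.sum_le_sum fun z hz => ?_
      rw [← Finset.mul_sum]
      obtain ⟨l1, l2, -, -⟩ := W.lev_of_mem_pairs hQ hw hv hz
      exact mul_le_mul_of_nonneg_left (ih (i + 1) z.1 z.2 l1 l2) (W.prob_pos hw.1 hv.1 hz).le
    set c : ℝ := 9 * W.cc / Q ^ 2 with hc
    have hc0 : 0 < c := by positivity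
    have a2 : ∀ j, Real.log (Q ^ 2 / (9 * W.cc)) + 1 - W.col β β' (kap J j) (Q ^ (i + 1)) w v / c ≤
        -Real.log (W.col β β' (kap J j) (Q ^ (i + 1)) w v) := fun j => by
      have hp := W.col_pos β β' (kap J j) hw.1 hv.1 (Q ^ (i + 1))
      have := Real.log_le_sub_one_of_pos (div_pos hp hc0)
      rw [Real.log_div hp.ne' hc0.ne'] at this
      have e : Real.log (Q ^ 2 / (9 * W.cc)) = -Real.log c := by
        rw [hc, ← Real.log_inv, inv_div]
      linarith
    have a3 := Finset.sum_le_sum fun j (_ : j ∈ Finset.range J) => a2 j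
    rw [Finset.sum_sub_distrib, ← Finset.sum_div, Finset.sum_const, Finset.card_range,
      nsmul_eq_mul] at a3
    have hvc : ((Q : ℝ) ^ i) ≤ cont v := by exact_mod_cast hv.2.1
    have a4 := W.sum_col_le h0 h1 h0' h1' (θ := Q ^ (i + 1)) (by positivity) hw.1 hv.1 (J := J) (by
      have : (J : ℝ) - 1 = Q ^ 2 := by rw [hJ]; push_cast; ring
      rw [this]
      push_cast
      calc ((Q : ℝ) ^ (i + 1)) ^ 2 = Q ^ 2 * (Q ^ i) ^ 2 := by ring
        _ ≤ _ := by gcongr)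
    have a5 : (∑ j ∈ Finset.range J, W.col β β' (kap J j) (Q ^ (i + 1)) w v) / c ≤ J := by
      rw [div_le_iff₀ hc0]
      refine a4.trans ?_
      have w3 : (cont w : ℝ) ≤ 3 * Q ^ i := by exact_mod_cast hw.2.2
      have v3 : (cont v : ℝ) ≤ 3 * Q ^ i := by exact_mod_cast hv.2.2
      calc _ ≤ W.cc * J / ((Q ^ (i + 1) : ℕ) : ℝ) ^ 2 * (3 * Q ^ i) * (3 * Q ^ i) := by gcongr
        _ = _ := by rw [hc]; push_cast; field_simp; ring
    push_cast
    rw [show ((n : ℝ) + 1) * Real.log (Q ^ 2 / (9 * W.cc)) = n * Real.log (Q ^ 2 / (9 * W.cc)) +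
      Real.log (Q ^ 2 / (9 * W.cc)) by ring, mul_add]
    have : (J : ℝ) * (Real.log (Q ^ 2 / (9 * W.cc)) + 1) =
      J * Real.log (Q ^ 2 / (9 * W.cc)) + J := by ring
    linarith

end Weight

/-- The pairs of words in `S` are separated at scale `Q ^ (-2k)`, uniformly over perturbations of
the parameters and over continuations of the words. -/
def Sep (Q k : ℕ) (δ β β' κ : ℝ) (S : Finset (Word × Word)) : Prop :=
  ∀ β₁ β₁' κ₁, Near δ β β' κ β₁ β₁' κ₁ → ∀ e ∈ S, ∀ e' ∈ S, e ≠ e' →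
    ∀ x ∈ Iv, ∀ x' ∈ Iv, ∀ y ∈ Iv, ∀ y' ∈ Iv, 1 / ((Q : ℝ) ^ k) ^ 2 ≤
      |loc β₁ β₁' κ₁ (mob e.1 x) (mob e.2 y) - loc β₁ β₁' κ₁ (mob e'.1 x') (mob e'.2 y')|

lemma abs_mob_append_sub_le (c c' w : Word) {x y θ : ℝ} (hx : x ∈ Iv) (hy : y ∈ Iv) (hθ : 0 < θ)
    (hw : θ ≤ cont w) : |mob (c ++ w) x - mob (c' ++ w) y| ≤ 1 / θ ^ 2 / 2 := by
  rw [mob_append, mob_append]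
  refine (abs_mob_sub_le w (mob_mem_Iv c hx) (mob_mem_Iv c' hy)).trans ?_
  rw [div_div, mul_comm (θ ^ 2)]
  gcongr

namespace Weight

variable (W : Weight)

lemma exists_tree {Q : ℕ} (hQ : 1 ≤ Q) {β β' κ : ℝ} (h0 : 0 ≤ β) (h1 : β ≤ 1) (h0' : 0 ≤ β')
    (h1' : β' ≤ 1) (hκ0 : 0 ≤ κ) (hκ : κ ≤ 2) (n i : ℕ) (w v : Word) (hw : W.Lev Q i w)
    (hv : W.Lev Q i v) :
    ∃ S : Finset (Word × Word), (∀ e ∈ S, W.Lev Q (i + n) e.1 ∧ W.Lev Q (i + n) e.2 ∧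
      (∃ c, e.1 = c ++ w) ∧ ∃ c, e.2 = c ++ v) ∧ S.Nonempty ∧
      W.ent Q β β' κ n i w v ≤ Real.log S.card ∧
      Sep Q (i + n) (1 / (5 * (Q : ℝ) ^ 2)) β β' κ S := by
  classical
  have hQ0 : (0 : ℝ) < Q := by exact_mod_cast hQ
  have hQ1 : (1 : ℝ) ≤ Q := by exact_mod_cast hQ
  induction n generalizing i w v with
  | zero =>
    refine ⟨{(w, v)}, ?_, ⟨_, Finset.mem_singleton_self _⟩, by simp [ent], ?_⟩
    · intro e he
      obtain rfl := Finset.mem_singleton.1 he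
      exact ⟨hw, hv, ⟨[], rfl⟩, [], rfl⟩
    · intro _ _ _ _ e he e' he' hne
      exact absurd ((Finset.mem_singleton.1 he).trans (Finset.mem_singleton.1 he').symm) hne
  | succ n ih =>
    set θ := Q ^ (i + 1) with hθ
    set ρ : ℝ := 20 * (1 / (θ : ℝ) ^ 2) with hρ
    have hθ0 : (0 : ℝ) < θ := by rw [hθ]; positivity
    obtain ⟨S₀, hS₀, hne, hsep, hlog⟩ := exists_separated (W.pairs θ w v) (W.prob w v) (ploc β β' κ)
      (fun z => W.ent Q β β' κ n (i + 1) z.1 z.2) (fun z hz => W.prob_pos hw.1 hv.1 hz)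
      (W.sum_prob hw.1 hv.1 θ) (ρ := ρ) (by positivity)
    have hT : ∀ z ∈ S₀, ∃ S : Finset (Word × Word),
        (∀ e ∈ S, W.Lev Q (i + 1 + n) e.1 ∧ W.Lev Q (i + 1 + n) e.2 ∧
        (∃ c, e.1 = c ++ z.1) ∧ ∃ c, e.2 = c ++ z.2) ∧ S.Nonempty ∧
        W.ent Q β β' κ n (i + 1) z.1 z.2 ≤ Real.log S.card ∧
        Sep Q (i + 1 + n) (1 / (5 * (Q : ℝ) ^ 2)) β β' κ S := fun z hz =>
      have l := W.lev_of_mem_pairs hQ hw hv (hS₀ hz)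
      ih (i + 1) z.1 z.2 l.1 l.2.1
    choose! T hT1 hTne hT2 hT3 using hT
    have hk : i + (n + 1) = i + 1 + n := by omega
    rw [hk]
    have cross : ∀ β₁ β₁' κ₁, Near (1 / (5 * (Q : ℝ) ^ 2)) β β' κ β₁ β₁' κ₁ →
        ∀ z ∈ S₀, ∀ z' ∈ S₀, z ≠ z' → ∀ e ∈ T z, ∀ e' ∈ T z',
        ∀ x ∈ Iv, ∀ x' ∈ Iv, ∀ y ∈ Iv, ∀ y' ∈ Iv, 1 / ((Q : ℝ) ^ (i + 1 + n)) ^ 2 ≤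
        |loc β₁ β₁' κ₁ (mob e.1 x) (mob e.2 y) - loc β₁ β₁' κ₁ (mob e'.1 x') (mob e'.2 y')| := by
      intro β₁ β₁' κ₁ hnear z hz z' hz' hne e he e' he' x hx x' hx' y hy y' hy'
      have key : ∀ z ∈ S₀, ∀ e ∈ T z, ∀ x ∈ Iv, ∀ y ∈ Iv,
          |loc β β' κ (mob e.1 x) (mob e.2 y) - ploc β β' κ z| ≤ 3 / 2 * (1 / (θ : ℝ) ^ 2) ∧
          ∃ c d, e.1 = c ++ w ∧ e.2 = d ++ v := by
        intro z hz e he x hx y hy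
        obtain ⟨l1, l2, ⟨a, ha⟩, ⟨b, hb⟩⟩ := W.lev_of_mem_pairs hQ hw hv (hS₀ hz)
        obtain ⟨-, -, ⟨c, hc⟩, ⟨d, hd⟩⟩ := hT1 z hz e he
        refine ⟨?_, c ++ a, d ++ b, by rw [hc, ha, List.append_assoc],
          by rw [hd, hb, List.append_assoc]⟩
        unfold ploc pt
        refine (abs_loc_sub_le h0 h1 h0' h1' hκ0 (mob_mem_Iv _ hx) (mob_mem_Iv _ half_mem_Iv)
          (mob_mem_Iv _ hy) (mob_mem_Iv _ half_mem_Iv)).trans ?_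
        have e1 := abs_mob_append_sub_le c [] z.1 hx half_mem_Iv hθ0 (by exact_mod_cast l1.2.1)
        have e2 := abs_mob_append_sub_le d [] z.2 hy half_mem_Iv hθ0 (by exact_mod_cast l2.2.1)
        rw [hc, hd]
        have := mul_le_mul hκ e2 (abs_nonneg _) (by norm_num)
        simp only [List.nil_append] at e1 this
        linarith
      obtain ⟨a1, c, d, hc, hd⟩ := key z hz e he x hx y hy
      obtain ⟨a2, c', d', hc', hd'⟩ := key z' hz' e' he' x' hx' y' hy'
      have a3 := hsep z hz z' hz' hne
      have a4 := abs_loc_perturb h0 h1 h0' h1' hκ0 hκ hnear (mob_mem_Iv e.1 hx)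
        (mob_mem_Iv e'.1 hx') (mob_mem_Iv e.2 hy) (mob_mem_Iv e'.2 hy')
      have hQi : (0 : ℝ) < (Q : ℝ) ^ i := by positivity
      have a5 : |mob e.1 x - mob e'.1 x'| ≤ 1 / ((Q : ℝ) ^ i) ^ 2 / 2 := by
        rw [hc, hc']
        exact abs_mob_append_sub_le c c' w hx hx' hQi (by exact_mod_cast hw.2.1)
      have a6 : |mob e.2 y - mob e'.2 y'| ≤ 1 / ((Q : ℝ) ^ i) ^ 2 / 2 := by
        rw [hd, hd']
        exact abs_mob_append_sub_le d d' v hy hy' hQi (by exact_mod_cast hv.2.1)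
      have a7 : 1 / (5 * (Q : ℝ) ^ 2) * (1 / ((Q : ℝ) ^ i) ^ 2 / 2) = 1 / (θ : ℝ) ^ 2 / 10 := by
        rw [hθ]; push_cast; field_simp; ring
      have a8 := mul_le_mul_of_nonneg_left a5 (by positivity : 0 ≤ 1 / (5 * (Q : ℝ) ^ 2))
      have a9 := mul_le_mul_of_nonneg_left a6 (by positivity : 0 ≤ 1 / (5 * (Q : ℝ) ^ 2))
      have a10 : 1 / ((Q : ℝ) ^ (i + 1 + n)) ^ 2 ≤ 1 / (θ : ℝ) ^ 2 := by
        rw [hθ]; push_cast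
        exact one_div_le_one_div_of_le (by positivity)
          (pow_le_pow_left₀ (by positivity) (pow_le_pow_right₀ hQ1 (by omega)) 2)
      have a11 : 0 < 1 / (θ : ℝ) ^ 2 := by positivity
      rw [abs_le] at a1 a2 a4
      rcases lt_abs.1 a3 with h | h
      · refine le_trans ?_ (le_abs_self _)
        linarith
      · refine le_trans ?_ (neg_le_abs _)
        linarith
    have hpos : 0 < 1 / ((Q : ℝ) ^ (i + 1 + n)) ^ 2 := by positivity
    refine ⟨S₀.biUnion T, ?_, ?_, ?_, ?_⟩
    · intro e he
      obtain ⟨z, hz, hez⟩ := Finset.mem_biUnion.1 he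
      obtain ⟨b1, b2, ⟨c, hc⟩, ⟨d, hd⟩⟩ := hT1 z hz e hez
      obtain ⟨-, -, ⟨a, ha⟩, ⟨b, hb⟩⟩ := W.lev_of_mem_pairs hQ hw hv (hS₀ hz)
      exact ⟨b1, b2, ⟨c ++ a, by rw [hc, ha, List.append_assoc]⟩,
        d ++ b, by rw [hd, hb, List.append_assoc]⟩
    · exact hne.biUnion fun z hz => hTne z hz
    · have hcard : (S₀.biUnion T).card = ∑ z ∈ S₀, (T z).card := by
        refine Finset.card_biUnion fun z hz z' hz' hne => ?_
        refine Finset.disjoint_left.2 fun e he he' => ?_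
        have := cross β β' κ ⟨⟨h0, h1, by simp⟩,
          ⟨h0', h1', by simp⟩, by simp⟩
          z hz z' hz' hne e he e he' _ half_mem_Iv _ half_mem_Iv _ half_mem_Iv _ half_mem_Iv
        rw [sub_self, abs_zero] at this
        linarith
      rw [hcard]
      refine hlog.trans ?_
      push_cast
      refine Real.log_le_log (Finset.sum_pos (fun _ _ => Real.exp_pos _) hne)
        (Finset.sum_le_sum fun z hz => ?_)
      rw [← Real.le_log_iff_exp_le (by exact_mod_cast (hTne z hz).card_pos)]
      exact hT2 z hz
    · intro β₁ β₁' κ₁ hnear e he e' he' hne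
      obtain ⟨z, hz, hez⟩ := Finset.mem_biUnion.1 he
      obtain ⟨z', hz', hez'⟩ := Finset.mem_biUnion.1 he'
      by_cases hzz : z = z'
      · subst hzz
        exact hT3 z hz β₁ β₁' κ₁ hnear e hez e' hez' hne
      · exact cross β₁ β₁' κ₁ hnear z hz z' hz' hzz e hez e' hez'

lemma exists_family (h : 0 < W.u []) {Q : ℕ} (hQ : 1 ≤ Q) {β β' : ℝ} (h0 : 0 ≤ β) (h1 : β ≤ 1)
    (h0' : 0 ≤ β') (h1' : β' ≤ 1) (k : ℕ) :
    ∃ κ, 1 ≤ κ ∧ κ ≤ 2 ∧ ∃ S : Finset (Word × Word),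
      (∀ e ∈ S, W.Lev Q k e.1 ∧ W.Lev Q k e.2) ∧ S.Nonempty ∧
      k * Real.log (Q ^ 2 / (9 * W.cc)) ≤ Real.log S.card ∧
      Sep Q k (1 / (5 * (Q : ℝ) ^ 2)) β β' κ S := by
  have hL : W.Lev Q 0 [] := ⟨h, by simp [cont]⟩
  have hs := W.le_sum_ent hQ h0 h1 h0' h1' k 0 [] [] hL hL
  have hc : ((Q ^ 2 + 1 : ℕ) : ℝ) * (k * Real.log (Q ^ 2 / (9 * W.cc))) =
    ∑ j ∈ Finset.range (Q ^ 2 + 1), (k * Real.log (Q ^ 2 / (9 * W.cc)) : ℝ) := by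
    rw [Finset.sum_const, Finset.card_range, nsmul_eq_mul]
  rw [hc] at hs
  obtain ⟨j, hj, hle⟩ := Finset.exists_le_of_sum_le (by simp) hs
  have hk := kap_bounds (Finset.mem_range.1 hj)
  obtain ⟨S, hS, hne, hlog, hsep⟩ := W.exists_tree hQ h0 h1 h0' h1' (by linarith) hk.2 k 0 [] [] hL hL
  rw [zero_add] at hS hsep
  exact ⟨_, hk.1, hk.2, S, fun e he => ⟨(hS e he).1, (hS e he).2.1⟩, hne, hle.trans hlog, hsep⟩

end Weight

open Real in
lemma one_lt_silver : 1 < 1 + √2 := by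
  have : 0 < √(2 : ℝ) := by positivity
  linarith

lemma silver_sq : (1 + √2) ^ 2 = 2 * (1 + √2) + 1 := by
  have := Real.sq_sqrt (show (0 : ℝ) ≤ 2 by norm_num)
  linarith

lemma silver_pow (n : ℕ) : ∃ c d : ℕ, (1 + √2) ^ (n + 1) = c + (d + 1) * √2 := by
  induction n with
  | zero => exact ⟨1, 0, by simp⟩
  | succ n ih =>
    obtain ⟨c, d, h⟩ := ih
    refine ⟨c + 2 * (d + 1), c + d, ?_⟩
    have := Real.mul_self_sqrt (show (0 : ℝ) ≤ 2 by norm_num)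
    rw [pow_succ, h]
    push_cast
    linear_combination ((d : ℝ) + 1) * this

lemma golden_pow_ne_silver_pow (m n : ℕ) : Real.goldenRatio ^ (m + 1) ≠ (1 + √2) ^ (n + 1) := by
  intro h
  obtain ⟨c, d, hcd⟩ := silver_pow n
  rw [hcd, ← Real.goldenRatio_mul_fib_succ_add_fib, Real.goldenRatio] at h
  have hf : 0 < (m + 1).fib := Nat.fib_pos.2 (by omega)
  have h5 := Real.mul_self_sqrt (show (0 : ℝ) ≤ 5 by norm_num)
  have h2 := Real.mul_self_sqrt (show (0 : ℝ) ≤ 2 by norm_num)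
  have h10 : √(10 : ℝ) = √5 * √2 := by
    rw [← Real.sqrt_mul (by norm_num)]; norm_num
  have hirr : Irrational √(10 : ℝ) := irrational_sqrt_ofNat_iff.2 (by
    rintro ⟨k, hk⟩
    have h1 : (OfNat.ofNat 10 : ℕ) = 10 := rfl
    have : k ≤ 3 := by nlinarith
    interval_cases k <;> omega)
  set f : ℝ := ((m + 1).fib : ℝ) / 2 with hfdef
  set a : ℝ := c - (f + m.fib) with ha
  have e : f * √5 - (d + 1) * √2 = a := by
    rw [ha, hfdef]; linear_combination h
  have e2 : √(10 : ℝ) = (5 * f ^ 2 + 2 * (d + 1) ^ 2 - a ^ 2) / (2 * f * (d + 1)) := by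
    have : (0 : ℝ) < f := by positivity
    rw [eq_div_iff (by positivity), h10, ← e]
    linear_combination f ^ 2 * h5 + ((d : ℝ) + 1) ^ 2 * h2
  refine hirr ⟨(5 * ((m + 1).fib / 2 : ℚ) ^ 2 + 2 * (d + 1) ^ 2 -
    (c - ((m + 1).fib / 2 + m.fib)) ^ 2) / (2 * ((m + 1).fib / 2) * (d + 1)), ?_⟩
  rw [e2, ha, hfdef]
  push_cast
  ring

lemma irrational_log_div : Irrational (Real.log Real.goldenRatio / Real.log (1 + √2)) := by
  have hg := Real.log_pos Real.one_lt_goldenRatio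
  have hs := Real.log_pos one_lt_silver
  rintro ⟨r, hr⟩
  have hr0 : 0 < r := by
    have : (0 : ℝ) < r := by rw [hr]; positivity
    exact_mod_cast this
  have hn : 0 < r.num := Rat.num_pos.2 hr0
  obtain ⟨n, hn'⟩ : ∃ n : ℕ, r.num = n + 1 := ⟨(r.num - 1).toNat, by omega⟩
  obtain ⟨d, hd⟩ : ∃ d : ℕ, r.den = d + 1 := ⟨r.den - 1, by have := r.den_pos; omega⟩
  have hq : (r : ℝ) = (n + 1 : ℕ) / (d + 1 : ℕ) := by
    rw [Rat.cast_def, hn', hd]; push_cast; ring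
  rw [hq, div_eq_div_iff (by positivity) hs.ne', mul_comm (Real.log _), ← Real.log_pow,
    ← Real.log_pow] at hr
  exact golden_pow_ne_silver_pow d n
    (Real.log_injOn_pos (by simp; have := Real.goldenRatio_pos; positivity)
      (by simp; positivity) hr.symm)

/-- Integral combinations of the logarithms of the golden and silver means are dense, uniformly
on bounded sets. -/
lemma exists_log_approx {η : ℝ} (hη : 0 < η) (R : ℝ) : ∃ N : ℕ, ∀ t : ℝ, |t| ≤ R →
    ∃ a b c d : ℕ, (a ≤ N ∧ b ≤ N ∧ c ≤ N ∧ d ≤ N) ∧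
    |t + 2 * ((a : ℝ) - b) * Real.log Real.goldenRatio +
      2 * ((c : ℝ) - d) * Real.log (1 + √2)| < η := by
  let U : ℕ → Set ℝ := fun N => {t | ∃ a b c d : ℕ, (a ≤ N ∧ b ≤ N ∧ c ≤ N ∧ d ≤ N) ∧
    |t + 2 * ((a : ℝ) - b) * Real.log Real.goldenRatio +
      2 * ((c : ℝ) - d) * Real.log (1 + √2)| < η}
  have hU : ∀ N, IsOpen (U N) := fun N => by
    have : U N = ⋃ a, ⋃ b, ⋃ c, ⋃ d, {t : ℝ | (a ≤ N ∧ b ≤ N ∧ c ≤ N ∧ d ≤ N) ∧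
      |t + 2 * ((a : ℝ) - b) * Real.log Real.goldenRatio +
        2 * ((c : ℝ) - d) * Real.log (1 + √2)| < η} := by
      ext t; simp [U]
    rw [this]
    refine isOpen_iUnion fun a => isOpen_iUnion fun b => isOpen_iUnion fun c => isOpen_iUnion fun d =>
      isOpen_const.inter (isOpen_Iio.preimage (f := fun t : ℝ => |t + 2 * ((a : ℝ) - b) *
        Real.log Real.goldenRatio + 2 * ((c : ℝ) - d) * Real.log (1 + √2)|) (by fun_prop))
  have hmono : Monotone U := fun m n hmn t ⟨a, b, c, d, ⟨h1, h2, h3, h4⟩, h⟩ =>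
    ⟨a, b, c, d, ⟨h1.trans hmn, h2.trans hmn, h3.trans hmn, h4.trans hmn⟩, h⟩
  have hcov : Set.Icc (-R) R ⊆ ⋃ N, U N := fun t _ => by
    have hd := dense_addSubgroupClosure_pair_iff.2 irrational_log_div
    obtain ⟨y, hy, hyt⟩ := hd.exists_dist_lt (-t / 2) (half_pos hη)
    obtain ⟨m, n, rfl⟩ := AddSubgroup.mem_closure_pair.1 hy
    refine Set.mem_iUnion.2 ⟨m.toNat + (-m).toNat + n.toNat + (-n).toNat, m.toNat, (-m).toNat,
      n.toNat, (-n).toNat, by omega, ?_⟩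
    have e1 : ((m.toNat : ℝ) - ((-m).toNat : ℝ)) = m := by
      exact_mod_cast (by omega : (m.toNat : ℤ) - ((-m).toNat : ℤ) = m)
    have e2 : ((n.toNat : ℝ) - ((-n).toNat : ℝ)) = n := by
      exact_mod_cast (by omega : (n.toNat : ℤ) - ((-n).toNat : ℤ) = n)
    rw [e1, e2]
    rw [Real.dist_eq] at hyt
    simp only [zsmul_eq_mul] at hyt
    rw [abs_lt] at hyt ⊢
    constructor <;> linarith [hyt.1, hyt.2]
  obtain ⟨N, hN⟩ := isCompact_Icc.elim_directed_cover U hU hcov hmono.directed_le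
  exact ⟨N, fun t ht => hN (abs_le.1 ht)⟩

/-- The action of appended digits on `beta`. -/
noncomputable def bmap : Word → ℝ → ℝ
  | [], s => s
  | b :: c, s => 1 / (dig b + bmap c s)

lemma beta_append (c w : Word) : beta (c ++ w) = bmap c (beta w) := by
  induction c with
  | nil => rfl
  | cons b c ih => rw [List.cons_append, beta_cons, ih]; rfl

lemma one_div_dig_add (b : Bool) {s : ℝ} (h0 : 0 ≤ s) (h1 : s ≤ 1) :
    1 / 3 ≤ 1 / (dig b + s) ∧ 1 / (dig b + s) ≤ 1 := by
  have d1 : (1 : ℝ) ≤ dig b := by exact_mod_cast one_le_dig b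
  have d2 : (dig b : ℝ) ≤ 2 := by exact_mod_cast dig_le_two b
  constructor
  · exact one_div_le_one_div_of_le (by linarith) (by linarith)
  · rw [div_le_one (by linarith)]; linarith

lemma bmap_mem (c : Word) {s : ℝ} (h0 : 0 ≤ s) (h1 : s ≤ 1) : 0 ≤ bmap c s ∧ bmap c s ≤ 1 := by
  induction c with
  | nil => exact ⟨h0, h1⟩
  | cons b c ih =>
    have := one_div_dig_add b ih.1 ih.2
    exact ⟨le_trans (by norm_num) this.1, this.2⟩

lemma abs_bmap_sub_le (c : Word) (n : ℕ) (hn : n < c.length) {s t : ℝ} (h0 : 0 ≤ s) (h1 : s ≤ 1)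
    (h0' : 0 ≤ t) (h1' : t ≤ 1) : |bmap c s - bmap c t| ≤ (9 / 16) ^ n := by
  induction n generalizing c with
  | zero =>
    have a := bmap_mem c h0 h1
    have b := bmap_mem c h0' h1'
    rw [pow_zero, abs_le]
    constructor <;> linarith
  | succ n ih =>
    obtain _ | ⟨b, _ | ⟨b', c⟩⟩ := c
    · simp at hn
    · simp at hn
    have i := ih (b' :: c) (by simp at hn ⊢; omega)
    have a1 := (one_div_dig_add b' (bmap_mem c h0 h1).1 (bmap_mem c h0 h1).2).1
    have a2 := (one_div_dig_add b' (bmap_mem c h0' h1').1 (bmap_mem c h0' h1').2).1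
    change 1 / 3 ≤ bmap (b' :: c) s at a1
    change 1 / 3 ≤ bmap (b' :: c) t at a2
    have d1 : (1 : ℝ) ≤ dig b := by exact_mod_cast one_le_dig b
    change |1 / (dig b + bmap (b' :: c) s) - 1 / (dig b + bmap (b' :: c) t)| ≤ _
    set S := bmap (b' :: c) s
    set T := bmap (b' :: c) t
    rw [div_sub_div _ _ (by positivity) (by positivity), abs_div, div_le_iff₀ (by positivity),
      abs_of_pos (by positivity : 0 < ((dig b : ℝ) + S) * (dig b + T)), pow_succ]
    have e : (1 : ℝ) * (dig b + T) - (dig b + S) * 1 = -(S - T) := by ring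
    rw [e, abs_neg]
    refine i.trans ?_
    have : 16 / 9 ≤ ((dig b : ℝ) + S) * (dig b + T) := by nlinarith
    have hp : (0 : ℝ) ≤ (9 / 16) ^ n := by positivity
    nlinarith

lemma log_cont_replicate (b : Bool) {L : ℝ} (hL : 0 < L) (h : L ^ 2 = dig b * L + 1) (n : ℕ)
    (w : Word) : Real.log (cont (List.replicate n b ++ w)) = n * Real.log L + Real.log (cont w) +
      Real.log (L + beta w) - Real.log (L + beta (List.replicate n b ++ w)) := by
  induction n with
  | zero => simp
  | succ n ih =>
    rw [List.replicate_succ, List.cons_append]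
    set v := List.replicate n b ++ w
    have hb := beta_nonneg v
    have hc := cont_pos v
    have hd : (0 : ℝ) < dig b + beta v := by
      have : (1 : ℝ) ≤ dig b := by exact_mod_cast one_le_dig b
      linarith
    have e : L + beta (b :: v) = L * (L + beta v) / (dig b + beta v) := by
      rw [beta_cons]; field_simp; linear_combination -h
    rw [e, cont_cons_eq, Real.log_mul hc.ne' hd.ne', ih, Real.log_div (by positivity) hd.ne',
      Real.log_mul hL.ne' (by positivity)]
    push_cast
    ring

lemma golden_sq' : Real.goldenRatio ^ 2 = dig false * Real.goldenRatio + 1 := by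
  rw [Real.goldenRatio_sq]; simp [dig]

lemma silver_sq' : (1 + √2) ^ 2 = dig true * (1 + √2) + 1 := by
  rw [silver_sq]; simp [dig]

/-- The limit of `beta` along runs of the digit `1`. -/
noncomputable def betaLim : ℝ := 1 / Real.goldenRatio

lemma betaLim_mem : 0 ≤ betaLim ∧ betaLim ≤ 1 := by
  have := Real.one_lt_goldenRatio
  unfold betaLim
  exact ⟨by positivity, by rw [div_le_one (by positivity)]; linarith⟩

lemma bmap_replicate_betaLim (n : ℕ) : bmap (List.replicate n false) betaLim = betaLim := by
  induction n with
  | zero => rfl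
  | succ n ih =>
    rw [List.replicate_succ, bmap, ih]
    have h := Real.goldenRatio_sq
    have := Real.goldenRatio_pos
    have : (dig false : ℝ) + betaLim = Real.goldenRatio := by
      unfold betaLim
      simp only [dig]
      push_cast
      generalize Real.goldenRatio = g at *
      field_simp
      linarith
    rw [this, betaLim]

/-- The words used to adjust the ratio of two continuants. -/
def adj (H n m : ℕ) : Word := List.replicate (2 * H) false ++
  (List.replicate (2 * (H + m)) true ++ List.replicate (2 * (H + n)) false)

lemma abs_log_add_sub_le {L s t : ℝ} (hL : 1 ≤ L) (hs : 0 ≤ s) (ht : 0 ≤ t) :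
    |Real.log (L + s) - Real.log (L + t)| ≤ |s - t| := by
  have key : ∀ s t : ℝ, 0 ≤ s → 0 ≤ t → Real.log (L + s) - Real.log (L + t) ≤ |s - t| := by
    intro s t hs ht
    rw [← Real.log_div (by positivity) (by positivity)]
    refine (Real.log_le_sub_one_of_pos (by positivity)).trans ?_
    rw [div_sub_one (by positivity), div_le_iff₀ (by positivity)]
    have := le_abs_self (s - t)
    have := abs_nonneg (s - t)
    nlinarith
  rw [abs_le]
  have := key s t hs ht
  have := key t s ht hs
  rw [abs_sub_comm] at this
  constructor <;> linarith

lemma abs_beta_append_sub_le (c : Word) {n : ℕ} (hn : n < c.length) (A B : Word) :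
    |beta (c ++ A) - beta (c ++ B)| ≤ (9 / 16) ^ n := by
  rw [beta_append, beta_append]
  exact abs_bmap_sub_le c n hn (beta_nonneg A) (beta_le_one A) (beta_nonneg B) (beta_le_one B)

lemma abs_beta_adj_sub_le {H k : ℕ} (hk : k < 2 * H) (n m : ℕ) (A : Word) :
    |beta (adj H n m ++ A) - betaLim| ≤ (9 / 16) ^ k := by
  unfold adj
  rw [List.append_assoc, beta_append, ← bmap_replicate_betaLim (2 * H)]
  refine abs_bmap_sub_le _ k (by simpa using hk) (beta_nonneg _) (beta_le_one _) betaLim_mem.1 betaLim_mem.2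

lemma log_cont_adj_sub {H k : ℕ} (hk : k < 2 * H) (a b c d : ℕ) (A B : Word) :
    |Real.log (cont (adj H a c ++ A)) - Real.log (cont (adj H b d ++ B)) -
      (Real.log (cont A) + Real.log (Real.goldenRatio + beta A) -
        (Real.log (cont B) + Real.log (Real.goldenRatio + beta B)) +
        2 * ((a : ℝ) - b) * Real.log Real.goldenRatio +
        2 * ((c : ℝ) - d) * Real.log (1 + √2))| ≤ 5 * (9 / 16) ^ k := by
  have hg := Real.one_lt_goldenRatio
  have hs := one_lt_silver
  have key : ∀ (n m : ℕ) (A : Word), Real.log (cont (adj H n m ++ A)) =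
      2 * (H + n) * Real.log Real.goldenRatio + 2 * (H + m) * Real.log (1 + √2) +
      2 * H * Real.log Real.goldenRatio + Real.log (cont A) + Real.log (Real.goldenRatio + beta A) +
      (Real.log (1 + √2 + beta (List.replicate (2 * (H + n)) false ++ A)) -
        Real.log (Real.goldenRatio + beta (List.replicate (2 * (H + n)) false ++ A))) +
      (Real.log (Real.goldenRatio + beta (List.replicate (2 * (H + m)) true ++
          (List.replicate (2 * (H + n)) false ++ A))) -
        Real.log (1 + √2 + beta (List.replicate (2 * (H + m)) true ++
          (List.replicate (2 * (H + n)) false ++ A)))) -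
      Real.log (Real.goldenRatio + beta (adj H n m ++ A)) := by
    intro n m A
    unfold adj
    simp only [List.append_assoc]
    rw [log_cont_replicate false (by positivity) golden_sq',
      log_cont_replicate true (by positivity) silver_sq',
      log_cont_replicate false (by positivity) golden_sq']
    push_cast
    ring
  have share : ∀ (b : Bool) (n m : ℕ) (A B : Word),
      |beta (List.replicate (2 * (H + n)) b ++ A) - beta (List.replicate (2 * (H + m)) b ++ B)| ≤
        (9 / 16) ^ k := by
    intro b n m A B
    rw [show 2 * (H + n) = 2 * H + 2 * n by ring, show 2 * (H + m) = 2 * H + 2 * m by ring,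
      List.replicate_add, List.replicate_add, List.append_assoc, List.append_assoc]
    exact abs_beta_append_sub_le _ (by simpa using hk) _ _
  rw [key, key]
  have s1 := share false a b A B
  have s2 := share true c d (List.replicate (2 * (H + a)) false ++ A)
    (List.replicate (2 * (H + b)) false ++ B)
  have s3 : |beta (adj H a c ++ A) - beta (adj H b d ++ B)| ≤ (9 / 16) ^ k := by
    unfold adj
    simp only [List.append_assoc]
    exact abs_beta_append_sub_le (List.replicate (2 * H) false) (by simpa using hk) _ _
  have t1 := (abs_log_add_sub_le hg.le (beta_nonneg _) (beta_nonneg _)).trans s1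
  have t2 := (abs_log_add_sub_le hs.le (beta_nonneg _) (beta_nonneg _)).trans s1
  have t3 := (abs_log_add_sub_le hg.le (beta_nonneg _) (beta_nonneg _)).trans s2
  have t4 := (abs_log_add_sub_le hs.le (beta_nonneg _) (beta_nonneg _)).trans s2
  have t5 := (abs_log_add_sub_le hg.le (beta_nonneg _) (beta_nonneg _)).trans s3
  clear s1 s2 s3 share key
  rw [abs_le] at t1 t2 t3 t4 t5 ⊢
  obtain ⟨u1, v1⟩ := t1
  obtain ⟨u2, v2⟩ := t2
  obtain ⟨u3, v3⟩ := t3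
  obtain ⟨u4, v4⟩ := t4
  obtain ⟨u5, v5⟩ := t5
  constructor <;> linarith

lemma cont_append_le_three_pow (c w : Word) : cont (c ++ w) ≤ 3 ^ c.length * cont w := by
  induction c with
  | nil => simp
  | cons b c ih =>
    rw [List.cons_append, List.length_cons, pow_succ]
    have := cont_cons_le b (c ++ w)
    nlinarith

lemma cont_le_cont_append (c w : Word) : cont w ≤ cont (c ++ w) := by
  induction c with
  | nil => exact le_rfl
  | cons b c ih => exact ih.trans (cont_le_cont_cons b _)

/-- A pair of words with parameters near `(betaLim, betaLim, κ)`. -/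
def Good (δ κ : ℝ) (A B : Word) : Prop :=
  Even A.length ∧ Even B.length ∧
    Near δ betaLim betaLim κ (beta A) (beta B) ((cont A : ℝ) ^ 2 / (cont B : ℝ) ^ 2)

namespace Weight

variable (W : Weight)

/-- Words that can be followed by any admissible word. -/
def Ret (a : Word) : Prop := ∀ c, 0 < W.u c → 0 < W.u (c ++ a)

/-- The admissible words return with bounded cost, and runs are not obstructed. -/
structure Returning : Prop where
  nil : 0 < W.u []
  one : W.Ret [false]
  two : ∃ h, ∀ m, W.Ret (List.replicate h false ++ List.replicate m true)
  ret : ∃ R, ∀ a, 0 < W.u a → ∃ r : Word, r.length ≤ R ∧ W.Ret (r ++ a)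

variable {W}

lemma Ret.append {a b : Word} (hb : W.Ret b) (ha : W.Ret a) : W.Ret (b ++ a) := fun c hc => by
  rw [← List.append_assoc]; exact ha _ (hb _ hc)

lemma ret_nil : W.Ret [] := fun c hc => by rwa [List.append_nil]

lemma Returning.replicate (hW : W.Returning) (n : ℕ) : W.Ret (List.replicate n false) := by
  induction n with
  | zero => exact ret_nil
  | succ n ih => exact Ret.append (a := List.replicate n false) hW.one ih

lemma Returning.exists_even (hW : W.Returning) : ∃ R : ℕ, ∀ A₀ a, 0 < W.u a → ∃ r : Word,
    r.length ≤ R ∧ W.Ret (r ++ a) ∧ Even (r ++ a ++ A₀).length := by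
  obtain ⟨R, hR⟩ := hW.ret
  refine ⟨R + 1, fun A₀ a ha => ?_⟩
  obtain ⟨r, hr, hra⟩ := hR a ha
  rcases Nat.even_or_odd (r ++ a ++ A₀).length with h | h
  · exact ⟨r, by omega, hra, h⟩
  · exact ⟨false :: r, by simpa using hr, Ret.append (a := r ++ a) hW.one hra, by
      simp only [List.cons_append, List.length_cons]; exact h.add_one⟩

lemma Returning.exists_adj (hW : W.Returning) : ∃ h : ℕ, ∀ H n m, h ≤ 2 * H → W.Ret (adj H n m) := by
  obtain ⟨h, hh⟩ := hW.two
  refine ⟨h, fun H n m hH => ?_⟩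
  unfold adj
  rw [← Nat.sub_add_cancel hH, List.replicate_add, List.append_assoc,
    ← List.append_assoc (List.replicate h false)]
  exact (hW.replicate _).append ((hh _).append (hW.replicate _))

lemma log_cont_append_bounds {R : ℕ} (r a : Word) (hr : r.length ≤ R) :
    0 ≤ Real.log (cont (r ++ a)) - Real.log (cont a) ∧
      Real.log (cont (r ++ a)) - Real.log (cont a) ≤ R * Real.log 3 := by
  have h1 : (cont a : ℝ) ≤ cont (r ++ a) := by exact_mod_cast cont_le_cont_append r a
  have h2 : (cont (r ++ a) : ℝ) ≤ 3 ^ R * cont a := by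
    have := (cont_append_le_three_pow r a).trans
      (Nat.mul_le_mul_right _ (Nat.pow_le_pow_right (by norm_num) hr))
    exact_mod_cast this
  have hc := cont_pos a
  have l1 := Real.log_le_log hc h1
  have l2 := Real.log_le_log (cont_pos _) h2
  rw [Real.log_mul (by positivity) hc.ne', Real.log_pow] at l2
  constructor <;> linarith

lemma Returning.adjust (hW : W.Returning) {δ : ℝ} (hδ : 0 < δ) (hδ1 : δ ≤ 1) (R : ℝ) :
    ∃ C : ℕ, ∀ κ A₀ B₀ a b, 1 ≤ κ → κ ≤ 2 → 0 < W.u a → 0 < W.u b →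
      |Real.log (cont (a ++ A₀)) - Real.log (cont (b ++ B₀))| ≤ R →
      ∃ c d, cont c ≤ C ∧ cont d ≤ C ∧ W.Ret (c ++ a) ∧ W.Ret (d ++ b) ∧
        Good δ κ (c ++ a ++ A₀) (d ++ b ++ B₀) := by
  obtain ⟨R₀, hR₀⟩ := hW.exists_even
  obtain ⟨h, hh⟩ := hW.exists_adj
  obtain ⟨N, hN⟩ := exists_log_approx (η := δ / 32) (by positivity)
    (R + R₀ * Real.log 3 + Real.log (Real.goldenRatio + 1) + Real.log 2)
  obtain ⟨k, hk⟩ := exists_pow_lt_of_lt_one (show 0 < δ / 160 by positivity)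
    (show (9 / 16 : ℝ) < 1 by norm_num)
  set H := k + h + 1 with hH
  refine ⟨3 ^ (2 * H + 2 * (H + N) + 2 * (H + N) + R₀), fun κ A₀ B₀ a b hκ1 hκ2 ha hb hab => ?_⟩
  obtain ⟨r, hr, hra, hre⟩ := hR₀ A₀ a ha
  obtain ⟨s, hs, hsb, hse⟩ := hR₀ B₀ b hb
  set A := r ++ a ++ A₀ with hA
  set B := s ++ b ++ B₀ with hB
  have lA : 0 ≤ Real.log (cont A) - Real.log (cont (a ++ A₀)) ∧
      Real.log (cont A) - Real.log (cont (a ++ A₀)) ≤ R₀ * Real.log 3 := by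
    rw [hA, List.append_assoc]; exact log_cont_append_bounds r _ hr
  have lB : 0 ≤ Real.log (cont B) - Real.log (cont (b ++ B₀)) ∧
      Real.log (cont B) - Real.log (cont (b ++ B₀)) ≤ R₀ * Real.log 3 := by
    rw [hB, List.append_assoc]; exact log_cont_append_bounds s _ hs
  have hg := Real.one_lt_goldenRatio
  have gb : ∀ w, 0 ≤ Real.log (Real.goldenRatio + beta w) ∧
      Real.log (Real.goldenRatio + beta w) ≤ Real.log (Real.goldenRatio + 1) := fun w => by
    have h0 := beta_nonneg w
    have h1 := beta_le_one w
    exact ⟨Real.log_nonneg (by linarith), Real.log_le_log (by linarith) (by linarith)⟩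
  have hκl : 0 ≤ Real.log κ := Real.log_nonneg hκ1
  have hκl' : Real.log κ ≤ Real.log 2 := Real.log_le_log (by linarith) hκ2
  obtain ⟨n, n', m, m', ⟨hn, hn', hm, hm'⟩, happ⟩ := hN
    (Real.log (cont A) + Real.log (Real.goldenRatio + beta A) -
      (Real.log (cont B) + Real.log (Real.goldenRatio + beta B)) - Real.log κ / 2) (by
    have g1 := gb A
    have g2 := gb B
    have hab' := abs_le.1 hab
    rw [abs_le]
    constructor <;> linarith [g1.1, g1.2, g2.1, g2.2, lA.1, lA.2, lB.1, lB.2, hab'.1, hab'.2])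
  have hlen : ∀ n m, n ≤ N → m ≤ N → ∀ r : Word, r.length ≤ R₀ → cont (adj H n m ++ r) ≤
      3 ^ (2 * H + 2 * (H + N) + 2 * (H + N) + R₀) := fun n m hn hm r hr => by
    have := cont_append_le_three_pow (adj H n m ++ r) []
    rw [List.append_nil, cont_nil, mul_one] at this
    refine this.trans (Nat.pow_le_pow_right (by norm_num) ?_)
    simp only [adj, List.length_append, List.length_replicate]
    omega
  have hev : ∀ n m (w : Word), Even w.length → Even (adj H n m ++ w).length := fun n m w hw => by
    simp only [adj, List.length_append, List.length_replicate]
    exact ((even_two_mul _).add ((even_two_mul _).add (even_two_mul _))).add hw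
  have hkH : k < 2 * H := by omega
  refine ⟨adj H n m ++ r, adj H n' m' ++ s, hlen n m hn hm r hr, hlen n' m' hn' hm' s hs, ?_, ?_, ?_⟩
  · rw [List.append_assoc]; exact (hh H n m (by omega)).append hra
  · rw [List.append_assoc]; exact (hh H n' m' (by omega)).append hsb
  have eA : adj H n m ++ r ++ a ++ A₀ = adj H n m ++ A := by simp only [hA, List.append_assoc]
  have eB : adj H n' m' ++ s ++ b ++ B₀ = adj H n' m' ++ B := by simp only [hB, List.append_assoc]
  rw [eA, eB]
  have hb1 := abs_beta_adj_sub_le hkH n m A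
  have hb2 := abs_beta_adj_sub_le hkH n' m' B
  refine ⟨hev _ _ _ hre, hev _ _ _ hse, ⟨beta_nonneg _, beta_le_one _, by linarith⟩,
    ⟨beta_nonneg _, beta_le_one _, by linarith⟩, ?_⟩
  have hl := log_cont_adj_sub hkH n n' m m' A B
  set qA : ℝ := (cont (adj H n m ++ A) : ℝ)
  set qB : ℝ := (cont (adj H n' m' ++ B) : ℝ)
  have hqA : 0 < qA := cont_pos _
  have hqB : 0 < qB := cont_pos _
  set x := 2 * (Real.log qA - Real.log qB) - Real.log κ with hx
  have hxs : |x| ≤ δ / 8 := by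
    have h1 := abs_le.1 hl
    have h2 := abs_lt.1 happ
    rw [hx, abs_le]
    constructor <;> linarith [h1.1, h1.2, h2.1, h2.2]
  have hexp : qA ^ 2 / qB ^ 2 = κ * Real.exp x := by
    rw [hx, Real.exp_sub, Real.exp_log (by linarith), mul_div_cancel₀ _ (by linarith),
      mul_sub, Real.exp_sub, mul_comm 2, mul_comm 2, Real.exp_mul, Real.exp_mul, Real.exp_log hqA,
      Real.exp_log hqB]
    norm_cast
  rw [hexp, show κ * Real.exp x - κ = κ * (Real.exp x - 1) by ring, abs_mul,
    abs_of_nonneg (by linarith)]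
  have h3 := Real.abs_exp_sub_one_le (x := x) (by linarith)
  have := mul_le_mul hκ2 h3 (abs_nonneg _) (by norm_num)
  linarith

end Weight

lemma exists_limit (w : ℕ → Word) (h : ∀ n, ∃ c, c ≠ [] ∧ w (n + 1) = c ++ w n) :
    ∃ x : ℕ → Bool, ∀ n, pre x (w n).length = w n := by
  have hlen : ∀ n, n ≤ (w n).length := fun n => by
    induction n with
    | zero => exact Nat.zero_le _
    | succ n ih =>
      obtain ⟨c, hc, e⟩ := h n
      rw [e, List.length_append]
      have := List.length_pos_of_ne_nil hc
      omega
  have hmono : ∀ n m, ∃ c, w (n + m) = c ++ w n := fun n m => by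
    induction m with
    | zero => exact ⟨[], rfl⟩
    | succ m ih =>
      obtain ⟨c, hc⟩ := ih
      obtain ⟨d, -, hd⟩ := h (n + m)
      exact ⟨d ++ c, by rw [← add_assoc, hd, hc, List.append_assoc]⟩
  have hmono' : ∀ n m, n ≤ m → ∃ c, w m = c ++ w n := fun n m hnm => by
    obtain ⟨k, rfl⟩ := Nat.exists_eq_add_of_le hnm
    exact hmono n k
  have hget : ∀ n m i, i < (w n).length → i < (w m).length →
      (w n).reverse.getD i false = (w m).reverse.getD i false := by
    have : ∀ n m i, n ≤ m → i < (w n).length →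
        (w n).reverse.getD i false = (w m).reverse.getD i false := fun n m i hnm hi => by
      obtain ⟨c, hc⟩ := hmono' n m hnm
      rw [hc, List.reverse_append, List.getD_append _ _ _ _ (by simpa using hi)]
    intro n m i hn hm
    rcases le_total n m with hnm | hnm
    · exact this n m i hnm hn
    · exact (this m n i hnm hm).symm
  have hpre : ∀ (x : ℕ → Bool) (v : Word), (∀ i < v.length, x i = v.reverse.getD i false) →
      pre x v.length = v := by
    intro x v
    induction v with
    | nil => intro _; rfl
    | cons b v ih =>
      intro hx
      have h1 := hx v.length (by simp)
      rw [List.reverse_cons, List.getD_append_right _ _ _ _ (by simp)] at h1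
      simp only [List.length_reverse, Nat.sub_self] at h1
      rw [List.length_cons, pre, ih fun i hi => ?_, h1]
      · rfl
      · rw [hx i (by simp; omega), List.reverse_cons, List.getD_append _ _ _ _ (by simpa using hi)]
  refine ⟨fun i => (w (i + 1)).reverse.getD i false, fun n => hpre _ _ fun i hi => ?_⟩
  exact hget _ _ _ (hlen (i + 1)) hi

lemma mob_val_eq (A c e p : Word) (x : ℕ → Bool) (n : ℕ) (h : pre x n = c ++ e ++ p) :
    ∃ y ∈ Iv, mob A (val x) = mob (p ++ A) (mob e y) := by
  refine ⟨mob c (val fun k => x (k + n)), mob_mem_Iv _ (val_mem_Iv _), ?_⟩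
  rw [val_eq_mob x n, h, mob_append, mob_append, mob_append]

lemma good_ratio {δ κ : ℝ} {A B : Word} (hδ : δ ≤ 1 / 5) (hκ1 : 1 ≤ κ) (hκ2 : κ ≤ 2)
    (h : Good δ κ A B) : (cont A : ℝ) ≤ 2 * cont B ∧ (cont B : ℝ) ≤ 2 * cont A := by
  have h1 := abs_le.1 h.2.2.2.2
  have hA := cont_pos A
  have hB := cont_pos B
  have h2 : (cont A : ℝ) ^ 2 / (cont B : ℝ) ^ 2 ≤ 11 / 5 := by linarith [h1.2]
  have h3 : 4 / 5 ≤ (cont A : ℝ) ^ 2 / (cont B : ℝ) ^ 2 := by linarith [h1.1]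
  rw [div_le_iff₀ (by positivity)] at h2
  rw [le_div_iff₀ (by positivity)] at h3
  constructor <;> nlinarith

lemma abs_log_sub_le {a b R : ℝ} (ha : 0 < a) (hb : 0 < b) (hR : 0 < R) (h1 : a ≤ R * b)
    (h2 : b ≤ R * a) : |Real.log a - Real.log b| ≤ Real.log R := by
  have l1 := Real.log_le_log ha h1
  have l2 := Real.log_le_log hb h2
  rw [Real.log_mul hR.ne' (by positivity)] at l1 l2
  rw [abs_le]
  constructor <;> linarith

lemma good_sub {δ κ : ℝ} {A B : Word} (h : Good δ κ A B) {x x' y y' : ℝ} (hx : 0 ≤ x) (hx' : 0 ≤ x')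
    (hy : 0 ≤ y) (hy' : 0 ≤ y') :
    (mob A x + mob B y) - (mob A x' + mob B y') = (loc (beta A) (beta B)
      ((cont A : ℝ) ^ 2 / (cont B : ℝ) ^ 2) x y - loc (beta A) (beta B)
      ((cont A : ℝ) ^ 2 / (cont B : ℝ) ^ 2) x' y') / (cont A : ℝ) ^ 2 := by
  have e1 := mob_sub A hx hx'
  have e2 := mob_sub B hy hy'
  rw [h.1.neg_one_pow, one_mul] at e1
  rw [h.2.1.neg_one_pow, one_mul] at e2
  have hA := cont_pos A
  have hB := cont_pos B
  calc _ = (mob A x - mob A x') + (mob B y - mob B y') := by ring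
    _ = _ := by rw [e1, e2]; unfold loc; field_simp; ring

namespace Weight

variable {W : Weight}

lemma pos_of_append (c w : Word) (h : 0 < W.u (c ++ w)) : 0 < W.u w := by
  induction c with
  | nil => exact h
  | cons b c ih => exact ih (W.of_cons _ _ h)

lemma Ret.pos {a : Word} (h : W.Ret a) (h0 : 0 < W.u []) : 0 < W.u a := h [] h0

/-- The sums of two continued fractions with prescribed beginnings and admissible tails. -/
def sums (W : Weight) (A B : Word) : Set ℝ :=
  {t | ∃ x y : ℕ → Bool, (∀ n, 0 < W.u (pre x n)) ∧ (∀ n, 0 < W.u (pre y n)) ∧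
    t = mob A (val x) + mob B (val y)}

lemma adm_of_limit (h0 : 0 < W.u []) (w : ℕ → Word) (hw : ∀ n, W.Ret (w n))
    (hl : ∀ n, n ≤ (w n).length) {x : ℕ → Bool} (hx : ∀ n, pre x (w n).length = w n) (n : ℕ) :
    0 < W.u (pre x n) := by
  have h1 := (hw n).pos h0
  rw [← hx n, ← Nat.sub_add_cancel (hl n), pre_append] at h1
  exact pos_of_append _ _ h1

open scoped NNReal ENNReal in
lemma Returning.le_dimH_sums (hW : W.Returning) (A₀ B₀ : Word) {d : ℝ≥0} (hd : 0 < d) (hd1 : d < 1) :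
    (d : ℝ≥0∞) ≤ dimH (W.sums A₀ B₀) := by
  have hd1' : (d : ℝ) < 1 := by exact_mod_cast hd1
  have hd0' : (0 : ℝ) < d := by exact_mod_cast hd
  have hcc := W.cc_pos
  set R := max (Real.log 12) |Real.log (cont A₀) - Real.log (cont B₀)| with hR
  obtain ⟨Q, hQ2, hQ⟩ : ∃ Q : ℕ, 2 ≤ Q ∧
      (|Real.log (9 * W.cc)| + 1) / (2 * (1 - d)) ≤ Real.log Q := by
    have := (Real.tendsto_log_atTop.comp tendsto_natCast_atTop_atTop).eventually_ge_atTop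
      ((|Real.log (9 * W.cc)| + 1) / (2 * (1 - d)))
    obtain ⟨Q, h1, h2⟩ := (this.and (eventually_ge_atTop 2)).exists
    exact ⟨Q, h2, h1⟩
  rw [div_le_iff₀ (by linarith)] at hQ
  have hQ1 : (2 : ℝ) ≤ Q := by exact_mod_cast hQ2
  set δ : ℝ := 1 / (5 * (Q : ℝ) ^ 2) with hδ
  have hδ0 : 0 < δ := by positivity
  have hδ5 : δ ≤ 1 / 5 := one_div_le_one_div_of_le (by norm_num) (by nlinarith)
  obtain ⟨C, hC⟩ := hW.adjust hδ0 (by linarith) R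
  obtain ⟨k, hk⟩ := exists_nat_ge (2 * (d : ℝ) * Real.log (12 * (C + 1)) + 1)
  obtain ⟨κ, hκ1, hκ2, S, hS, hSne, hSc, hSep⟩ := W.exists_family hW.nil (by omega : 1 ≤ Q)
    betaLim_mem.1 betaLim_mem.2 betaLim_mem.1 betaLim_mem.2 k
  have hk1 : (1 : ℝ) ≤ k := by
    have : 0 ≤ Real.log (12 * (C + 1)) := Real.log_nonneg (by
      have : (0 : ℝ) ≤ C := Nat.cast_nonneg C
      linarith)
    have : 0 ≤ 2 * (d : ℝ) * Real.log (12 * (C + 1)) := by positivity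
    linarith
  have hQk : (0 : ℝ) < (Q : ℝ) ^ k := by positivity
  set M := S.card with hM
  set Γ : ℝ := 12 * (C + 1) * Q ^ k with hΓ
  have hΓ0 : 0 < Γ := by positivity
  let St := {p : Word × Word // W.Ret p.1 ∧ W.Ret p.2 ∧ Good δ κ (p.1 ++ A₀) (p.2 ++ B₀)}
  have hp0 : Nonempty St := by
    obtain ⟨c, d, -, -, h1, h2, h3⟩ := hC κ A₀ B₀ [] [] hκ1 hκ2 hW.nil hW.nil (le_max_right _ _)
    exact ⟨⟨(c ++ [], d ++ []), h1, h2, h3⟩⟩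
  obtain ⟨p0⟩ := hp0
  let en := S.equivFin
  have hstep : ∀ (p : St) (j : Fin M), ∃ q : St, ∃ c d, cont c ≤ C ∧ cont d ≤ C ∧
      q.1.1 = c ++ (en.symm j).1.1 ++ p.1.1 ∧ q.1.2 = d ++ (en.symm j).1.2 ++ p.1.2 := by
    rintro ⟨⟨a, b⟩, ha, hb, hg⟩ j
    obtain ⟨l1, l2⟩ := hS _ (en.symm j).2
    set e := (en.symm j).1
    have hr := good_ratio hδ5 hκ1 hκ2 hg
    have b1 : ∀ e A : Word, W.Lev Q k e → (Q : ℝ) ^ k * cont A ≤ cont (e ++ A) ∧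
        (cont (e ++ A) : ℝ) ≤ 6 * Q ^ k * cont A := fun e A he => by
      have h1 : (cont e : ℝ) * cont A ≤ cont (e ++ A) := by
        exact_mod_cast cont_mul_le_cont_append e A
      have h2 : (cont (e ++ A) : ℝ) ≤ 2 * cont e * cont A := by
        exact_mod_cast cont_append_le e A
      have h3 : (Q : ℝ) ^ k ≤ cont e := by exact_mod_cast he.2.1
      have h4 : (cont e : ℝ) ≤ 3 * Q ^ k := by exact_mod_cast he.2.2
      have := cont_pos A
      constructor <;> nlinarith
    have c1 := b1 e.1 (a ++ A₀) l1
    have c2 := b1 e.2 (b ++ B₀) l2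
    obtain ⟨c, d, hc, hd, h1, h2, h3⟩ := hC κ A₀ B₀ (e.1 ++ a) (e.2 ++ b) hκ1 hκ2
      (ha _ l1.1) (hb _ l2.1) ((abs_log_sub_le (cont_pos _) (cont_pos _) (by norm_num) (by
        rw [List.append_assoc, List.append_assoc]; nlinarith) (by
        rw [List.append_assoc, List.append_assoc]; nlinarith)).trans (le_max_left _ _))
    refine ⟨⟨(c ++ (e.1 ++ a), d ++ (e.2 ++ b)), h1, h2, h3⟩, c, d, hc, hd, ?_, ?_⟩ <;>
      simp only [List.append_assoc]
  choose step hst using hstep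
  let st : (ℕ → Fin M) → ℕ → St := fun s n => Nat.rec p0 (fun n p => step p (s n)) n
  have st_succ : ∀ s n, st s (n + 1) = step (st s n) (s n) := fun s n => rfl
  have ene : ∀ j, (en.symm j).1.1 ≠ [] ∧ (en.symm j).1.2 ≠ [] := fun j => by
    obtain ⟨l1, l2⟩ := hS _ (en.symm j).2
    have hk0 : k ≠ 0 := by rintro rfl; norm_num at hk1
    have hQk : 1 < Q ^ k := Nat.one_lt_pow hk0 (by omega)
    constructor
    · intro h
      have := l1.2.1
      rw [h, cont_nil] at this
      omega
    · intro h
      have := l2.2.1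
      rw [h, cont_nil] at this
      omega
  have lim : ∀ s, ∃ x y : ℕ → Bool, (∀ n, pre x (st s n).1.1.length = (st s n).1.1) ∧
      (∀ n, pre y (st s n).1.2.length = (st s n).1.2) := fun s => by
    obtain ⟨x, hx⟩ := exists_limit (fun n => (st s n).1.1) fun n => by
      obtain ⟨c, d, -, -, h1, h2⟩ := hst (st s n) (s n)
      exact ⟨c ++ (en.symm (s n)).1.1, by simp [(ene (s n)).1], h1⟩
    obtain ⟨y, hy⟩ := exists_limit (fun n => (st s n).1.2) fun n => by
      obtain ⟨c, d, -, -, h1, h2⟩ := hst (st s n) (s n)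
      exact ⟨d ++ (en.symm (s n)).1.2, by simp [(ene (s n)).2], h2⟩
    exact ⟨x, y, hx, hy⟩
  choose X Y hX hY using lim
  have hgrow : ∀ s n, (cont ((st s n).1.1 ++ A₀) : ℝ) ≤ Γ ^ n * cont (p0.1.1 ++ A₀) := fun s n => by
    induction n with
    | zero => simp [st]
    | succ n ih =>
      obtain ⟨c, f, hc, -, h1, -⟩ := hst (st s n) (s n)
      have l := (hS _ (en.symm (s n)).2).1
      rw [st_succ, h1]
      simp only [List.append_assoc]
      have h2 : (cont (c ++ ((en.symm (s n)).1.1 ++ ((st s n).1.1 ++ A₀))) : ℝ) ≤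
          2 * cont c * cont ((en.symm (s n)).1.1 ++ ((st s n).1.1 ++ A₀)) := by
        exact_mod_cast cont_append_le _ _
      have h3 : (cont ((en.symm (s n)).1.1 ++ ((st s n).1.1 ++ A₀)) : ℝ) ≤
          2 * cont (en.symm (s n)).1.1 * cont ((st s n).1.1 ++ A₀) := by
        exact_mod_cast cont_append_le _ _
      have h4 : (cont (en.symm (s n)).1.1 : ℝ) ≤ 3 * Q ^ k := by exact_mod_cast l.2.2
      have h5 : (cont c : ℝ) ≤ C := by exact_mod_cast hc
      calc _ ≤ 2 * (C : ℝ) * (2 * (3 * Q ^ k) * cont ((st s n).1.1 ++ A₀)) := by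
            refine h2.trans ?_
            gcongr
            exact h3.trans (by gcongr)
        _ = 12 * C * Q ^ k * cont ((st s n).1.1 ++ A₀) := by ring
        _ ≤ Γ * cont ((st s n).1.1 ++ A₀) := by
            rw [hΓ]
            gcongr
            linarith
        _ ≤ Γ * (Γ ^ n * cont (p0.1.1 ++ A₀)) := by gcongr
        _ = _ := by ring
  have hagree : ∀ s t n, (∀ i < n, s i = t i) → st s n = st t n := fun s t n h => by
    induction n with
    | zero => rfl
    | succ n ih => rw [st_succ, st_succ, ih fun i hi => h i (by omega), h n (by omega)]
  have hlen : ∀ s n, n ≤ (st s n).1.1.length ∧ n ≤ (st s n).1.2.length := fun s n => by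
    induction n with
    | zero => simp
    | succ n ih =>
      obtain ⟨c, f, -, -, h1, h2⟩ := hst (st s n) (s n)
      have e1 := List.length_pos_of_ne_nil (ene (s n)).1
      have e2 := List.length_pos_of_ne_nil (ene (s n)).2
      rw [st_succ, h1, h2]
      simp only [List.length_append]
      omega
  have hlogM : k * (2 * d * Real.log Q + 1) ≤ Real.log M := by
    refine le_trans ?_ hSc
    rw [Real.log_div (by positivity) (by positivity), Real.log_pow]
    push_cast
    gcongr
    have := le_abs_self (Real.log (9 * W.cc))
    linarith
  have hlogQ : 0 ≤ Real.log Q := Real.log_nonneg (by linarith)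
  have hM0 : (0 : ℝ) < M := by exact_mod_cast Finset.card_pos.2 hSne
  have hM1 : 1 < M := by
    have h0 : 0 ≤ 2 * d * Real.log Q := by positivity
    have : 0 < Real.log M := by nlinarith
    exact_mod_cast (Real.log_pos_iff hM0.le).1 this
  refine (le_dimH_range hM1 (c := 1 / ((Q : ℝ) ^ k) ^ 2 / (cont (p0.1.1 ++ A₀) : ℝ) ^ 2)
    (γ := 1 / Γ ^ 2) (div_pos (by positivity) (pow_pos (cont_pos _) 2)) (by positivity) hd ?_
    (fun s => mob A₀ (val (X s)) + mob B₀ (val (Y s))) ?_).trans (dimH_mono ?_)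
  · rw [← Real.log_nonneg_iff (by positivity), Real.log_mul (by positivity) hM0.ne',
      Real.log_rpow (by positivity), one_div, Real.log_inv, Real.log_pow, hΓ,
      Real.log_mul (by positivity) (by positivity), Real.log_pow]
    push_cast
    nlinarith
  · intro s t n hst' hne
    have ep := hagree s t n hst'
    obtain ⟨c, f, -, -, h1, h2⟩ := hst (st s n) (s n)
    obtain ⟨c', f', -, -, h1', h2'⟩ := hst (st t n) (t n)
    have hXs := hX s (n + 1)
    have hYs := hY s (n + 1)
    have hXt := hX t (n + 1)
    have hYt := hY t (n + 1)
    rw [st_succ, h1] at hXs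
    rw [st_succ, h2] at hYs
    rw [st_succ, h1', ← ep] at hXt
    rw [st_succ, h2', ← ep] at hYt
    obtain ⟨x, hx, ex⟩ := mob_val_eq A₀ _ _ _ _ _ hXs
    obtain ⟨y, hy, ey⟩ := mob_val_eq B₀ _ _ _ _ _ hYs
    obtain ⟨x', hx', ex'⟩ := mob_val_eq A₀ _ _ _ _ _ hXt
    obtain ⟨y', hy', ey'⟩ := mob_val_eq B₀ _ _ _ _ _ hYt
    have hg := (st s n).2.2.2
    have pos : ∀ {z : ℝ}, z ∈ Iv → 0 ≤ z := fun h => le_trans (by norm_num) h.1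
    rw [ex, ey, ex', ey', good_sub hg (pos (mob_mem_Iv _ hx)) (pos (mob_mem_Iv _ hx'))
      (pos (mob_mem_Iv _ hy)) (pos (mob_mem_Iv _ hy')), abs_div, abs_of_pos (pow_pos (cont_pos _) 2)]
    have hsep := hSep _ _ _ hg.2.2 _ (en.symm (s n)).2 _ (en.symm (t n)).2
      (fun h => hne (en.symm.injective (Subtype.ext h))) x hx x' hx' y hy y' hy'
    calc _ = 1 / ((Q : ℝ) ^ k) ^ 2 / (Γ ^ n * cont (p0.1.1 ++ A₀)) ^ 2 := by
          have := cont_pos (p0.1.1 ++ A₀)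
          rw [one_div_pow, ← pow_mul Γ, mul_comm 2 n, pow_mul Γ]
          field_simp
      _ ≤ 1 / ((Q : ℝ) ^ k) ^ 2 / (cont ((st s n).1.1 ++ A₀) : ℝ) ^ 2 := by
          have := cont_pos ((st s n).1.1 ++ A₀)
          have := hgrow s n
          gcongr
      _ ≤ _ := div_le_div_of_nonneg_right hsep (by positivity)
  · rintro _ ⟨s, rfl⟩
    exact ⟨X s, Y s, adm_of_limit hW.nil _ (fun n => (st s n).2.1) (fun n => (hlen s n).1) (hX s),
      adm_of_limit hW.nil _ (fun n => (st s n).2.2.1) (fun n => (hlen s n).2) (hY s), rfl⟩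

end Weight

/-- Evaluation of the polynomial with the given integer coefficients, constant term first. -/
def pev : List ℤ → ℝ → ℝ
  | [], _ => 0
  | c :: p, y => c + y * pev p y

/-- Addition of coefficient lists. -/
def padd : List ℤ → List ℤ → List ℤ
  | [], q => q
  | a :: p, [] => a :: p
  | a :: p, b :: q => (a + b) :: padd p q

/-- Multiplication of a coefficient list by a scalar. -/
def psmul (c : ℤ) : List ℤ → List ℤ
  | [] => []
  | a :: p => c * a :: psmul c p

/-- Multiplication of coefficient lists. -/
def pmul : List ℤ → List ℤ → List ℤ
  | [], _ => []
  | a :: p, q => padd (psmul a q) (0 :: pmul p q)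

/-- The sum of the absolute values of the coefficients. -/
def pabs : List ℤ → ℤ
  | [] => 0
  | a :: p => (a.natAbs : ℤ) + pabs p

/-- A lower bound for the values of a polynomial on `[-1, 1]`. -/
def plow : List ℤ → ℤ
  | [] => 0
  | a :: p => a - pabs p

@[simp] lemma pev_padd (p q : List ℤ) (y : ℝ) : pev (padd p q) y = pev p y + pev q y := by
  induction p generalizing q with
  | nil => simp [padd, pev]
  | cons a p ih =>
    cases q with
    | nil => simp [padd, pev]
    | cons b q =>
      simp only [padd, pev, ih]
      push_cast
      ring

@[simp] lemma pev_psmul (c : ℤ) (p : List ℤ) (y : ℝ) : pev (psmul c p) y = c * pev p y := by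
  induction p with
  | nil => simp [psmul, pev]
  | cons a p ih =>
    simp only [psmul, pev, ih]
    push_cast
    ring

@[simp] lemma pev_pmul (p q : List ℤ) (y : ℝ) : pev (pmul p q) y = pev p y * pev q y := by
  induction p with
  | nil => simp [pmul, pev]
  | cons a p ih =>
    simp only [pmul, pev, pev_padd, pev_psmul, ih]
    push_cast
    ring

lemma abs_pev_le (p : List ℤ) {y : ℝ} (hy : |y| ≤ 1) : |pev p y| ≤ pabs p := by
  induction p with
  | nil => simp [pev, pabs]
  | cons a p ih =>
    simp only [pev, pabs]
    push_cast
    refine (abs_add_le _ _).trans (add_le_add_right ?_ _)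
    rw [abs_mul]
    exact (mul_le_of_le_one_left (abs_nonneg _) hy).trans ih

lemma plow_le (p : List ℤ) {y : ℝ} (hy : |y| ≤ 1) : plow p ≤ pev p y := by
  cases p with
  | nil => simp [pev, plow]
  | cons a p =>
    have h1 := abs_pev_le p hy
    have h2 : |y * pev p y| ≤ pabs p := by
      rw [abs_mul]
      exact (mul_le_of_le_one_left (abs_nonneg _) hy).trans h1
    simp only [pev, plow]
    push_cast
    linarith [(abs_le.1 h2).1]

/-- The affine coordinate mapping `[1/3, 3/4]` onto `[-1, 1]`. -/
noncomputable def coord (β : ℝ) : ℝ := (24 * β - 13) / 5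

lemma abs_coord_le {β : ℝ} (hβ : β ∈ Iv) : |coord β| ≤ 1 := by
  unfold coord
  rw [abs_le]
  constructor <;> linarith [hβ.1, hβ.2]

/-- Linear combination of coefficient lists. -/
def comb : List ℤ → List (List ℤ) → List ℤ
  | c :: cs, m :: ms => padd (psmul c m) (comb cs ms)
  | _, _ => []

/-- Error bound for a linear combination. -/
def cerr : List ℤ → List ℤ → ℤ
  | c :: cs, e :: es => c.natAbs * e + cerr cs es
  | _, _ => 0

/-- The polynomials `ms` approximate at `y` the geometric sequence `g, g * z, …` up to `es`. -/
def Approx (y z : ℝ) : ℝ → List (List ℤ) → List ℤ → Prop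
  | g, m :: ms, e :: es => |pev m y - g| ≤ e ∧ Approx y z (g * z) ms es
  | _, _, _ => True

lemma comb_approx {y z g : ℝ} {c : List ℤ} {ms : List (List ℤ)} {es : List ℤ}
    (hm : c.length ≤ ms.length) (he : c.length ≤ es.length) (h : Approx y z g ms es) :
    |pev (comb c ms) y - g * pev c z| ≤ cerr c es := by
  induction c generalizing g ms es with
  | nil => simp [comb, cerr, pev]
  | cons a c ih =>
    match ms, es, hm, he, h with
    | m :: ms, e :: es, hm, he, h =>
      have h1 := ih (by simpa using hm) (by simpa using he) h.2
      have e1 : pev (comb (a :: c) (m :: ms)) y - g * pev (a :: c) z =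
          a * (pev m y - g) + (pev (comb c ms) y - g * z * pev c z) := by
        simp only [comb, pev, pev_padd, pev_psmul]
        ring
      rw [e1]
      simp only [cerr]
      push_cast
      refine (abs_add_le _ _).trans (add_le_add ?_ h1)
      rw [abs_mul]
      exact mul_le_mul_of_nonneg_left h.1 (abs_nonneg _)

/-- Check that the lists `ms` approximate the quotients `num * t ^ l / (den * s ^ l)` up to the errors
`es`, where `den` and `s` are bounded below by `dmin` and `smin`. -/
def approxCheck (t s : List ℤ) (smin : ℤ) : List ℤ → List ℤ → ℤ → List (List ℤ) → List ℤ → Bool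
  | num, den, dmin, m :: ms, e :: es =>
    decide (pabs (padd (pmul den m) (psmul (-1) num)) ≤ e * dmin) &&
      approxCheck t s smin (pmul t num) (pmul s den) (smin * dmin) ms es
  | _, _, _, _, _ => true

lemma approx_of_check {t s : List ℤ} {smin : ℤ} {y : ℝ} (hy : |y| ≤ 1) (hs0 : 0 < smin)
    (hs : smin ≤ pev s y) {num den : List ℤ} {dmin : ℤ} {ms : List (List ℤ)} {es : List ℤ}
    (hd0 : 0 < dmin) (hd : dmin ≤ pev den y) (h : approxCheck t s smin num den dmin ms es = true) :
    Approx y (pev t y / pev s y) (pev num y / pev den y) ms es := by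
  have hs0' : (0 : ℝ) < smin := by exact_mod_cast hs0
  induction ms generalizing num den dmin es with
  | nil => simp [Approx]
  | cons m ms ih =>
    cases es with
    | nil => simp [Approx]
    | cons e es =>
      rw [approxCheck, Bool.and_eq_true, decide_eq_true_eq] at h
      have hd0' : (0 : ℝ) < dmin := by exact_mod_cast hd0
      have hp : 0 < pev den y := hd0'.trans_le hd
      refine ⟨?_, ?_⟩
      · have h1 := abs_pev_le (padd (pmul den m) (psmul (-1) num)) hy
        have h2 : (pabs (padd (pmul den m) (psmul (-1) num)) : ℝ) ≤ e * dmin := by exact_mod_cast h.1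
        have h3 : pev (padd (pmul den m) (psmul (-1) num)) y =
            pev den y * (pev m y - pev num y / pev den y) := by
          simp only [pev_padd, pev_pmul, pev_psmul]
          field_simp
          push_cast
          ring
        rw [h3, abs_mul, abs_of_pos hp] at h1
        have h4 : dmin * |pev m y - pev num y / pev den y| ≤ dmin * e := by
          have := mul_le_mul_of_nonneg_right hd (abs_nonneg (pev m y - pev num y / pev den y))
          linarith
        exact le_of_mul_le_mul_left h4 hd0'
      · have := ih (num := pmul t num) (den := pmul s den) (dmin := smin * dmin) (mul_pos hs0 hd0)
          (by
            rw [pev_pmul]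
            push_cast
            exact mul_le_mul hs hd hd0'.le (hs0'.le.trans hs)) h.2
        rwa [pev_pmul, pev_pmul, mul_comm (pev t y), mul_comm (pev s y), ← div_mul_div_comm] at this

/-- Scaled Taylor polynomials of `β' * coord β' ^ l`, where `β' = 1 / (dig b + β)`, in terms of
`coord β`. -/
def ker : Bool → List (List ℤ)
  | false => [[64864864865, -8765522279, 1184530038, -160071627, 21631301, -2923149, 395020, -53381, 7214,
     -975],
    [33308984660, -31792786212, 7984372741, -1577354462, 280505356, -47007392, 7582251, -1190831,
     183383, -27817],
    [17104613744, -30340616414, 19370604997, -6232962308, 1540541117, -330876099, 65122685,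
     -12075905, 2144449, -368506],
    [8783450301, -22776998434, 23685256770, -13207308991, 4765819897, -1355210267, 332831666,
     -74059336, 15352107, -3017297],
    [4510420425, -15391889900, 22245413724, -18110115607, 9535031702, -3658913844, 1141516334,
     -309230290, 75692239, -17172088],
    [2316161840, -9801680617, 18155833312, -19569236257, 13903872608, -7107949681, 2832282128,
     -942608067, 274896936, -72560904],
    [1189380404, -6007809126, 13578965583, -18263139185, 16483495860, -10762672085, 5406218019,
     -2209738136, 770963171, -238030627],
    [610762910, -3585517113, 9568363521, -15442378776, 16968084449, -13611260488, 8397004916,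
     -4168942795, 1735665135, -627660238],
    [313635008, -2098186974, 6456799034, -12164268045, 15782861320, -15084144695, 11132708195,
     -6595527513, 3247338688, -1370969858],
    [161055815, -1209407748, 4216287866, -9084889720, 13606332386, -15129935359, 13061216582,
     -9063413843, 5209685459, -2548979933]]
  | true => [[39344262295, -3224939532, 264339306, -21667156, 1775996, -145573, 11932, -978, 80, -7],
    [-27992475141, -3795912433, 810351643, -107341223, 12152474, -1271024, 126717, -12234, 1154,
     -107],
    [19915957723, 7033852259, -344125590, -68120235, 19813438, -3309622, 451999, -55350, 6323,
     -688],
    [-14169714183, -8087345370, -591283638, 170269984, -13535903, -758321, 445901, -93496, 14961,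
     -2084],
    [10081403206, 7947377990, 1492791963, -117491637, -17026122, 4819811, -550705, 16632, 7918,
     -2355],
    [-7172670478, -7214935968, -2164400086, -57133739, 41835962, -3229837, -370619, 135909,
     -20318, 1653],
    [5103178668, 6243558097, 2565759686, 291606671, -41491401, -3216977, 1215699, -117359, -4889,
     3555],
    [-3630786134, -5232095302, -2727209002, -530730499, 10876928, 10239678, -1018673, -92088,
     36037, -4441],
    [2583215053, 4284542304, 2704186854, 737155515, 44945250, -13287350, -368339, 312804, -31654,
     -1926],
    [-1837893988, -3448220685, -2554420590, -891391402, -116011287, 9384249, 2324594, -334594,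
     -16716, 9486]]

/-- Bounds for the errors of the approximations in `ker`. -/
def kerErr : Bool → List ℤ
  | false => [155, 6257, 119833, 1426903, 11867435, 73555615, 354613448, 1373326920, 4389433392,
              11863903156]
  | true => [4, 16, 111, 462, 883, 141, 1909, 569, 3916, 5705]

/-- The scaling factor of `ker`. -/
def kerScale : ℤ := 100000000000

/-- The denominator `24 * (dig b + β)` as a polynomial in `coord β`. -/
def kerDen (b : Bool) : List ℤ := [24 * dig b + 13, 5]

lemma ker_check (b : Bool) : approxCheck (padd [576] (psmul (-13) (kerDen b))) (psmul 5 (kerDen b))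
    (5 * (24 * dig b + 8)) [24 * kerScale] (kerDen b) (24 * dig b + 8) (ker b) (kerErr b) = true := by
  cases b <;> decide +kernel

lemma pev_kerDen (b : Bool) (β : ℝ) : pev (kerDen b) (coord β) = 24 * (dig b + β) := by
  simp only [kerDen, pev, coord]
  push_cast
  ring

lemma ker_approx (b : Bool) {β : ℝ} (hβ : β ∈ Iv) : Approx (coord β) (coord (1 / (dig b + β)))
    (kerScale * (1 / (dig b + β))) (ker b) (kerErr b) := by
  have hd : (0 : ℝ) ≤ dig b := Nat.cast_nonneg _
  have hβ0 : (1 : ℝ) / 3 ≤ β := hβ.1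
  have hne : (dig b : ℝ) + β ≠ 0 := by linarith
  have h := approx_of_check (abs_coord_le hβ) (by positivity)
    (by rw [pev_psmul, pev_kerDen]; push_cast; linarith) (by positivity)
    (by rw [pev_kerDen]; push_cast; linarith) (ker_check b)
  convert h using 1
  · rw [pev_psmul, pev_padd, pev_psmul, pev_kerDen]
    simp only [pev, coord]
    push_cast
    field_simp
    ring
  · rw [pev_kerDen]
    simp only [pev]
    push_cast
    field_simp
    ring

/-- A deterministic automaton given by the lists of its transitions, together with a polynomial for
each state.  Numbers beyond the end of the table are dead states. -/
abbrev Table := List (ℕ × ℕ × List ℤ)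

/-- An iterate of `List.tail`; like `fetch`, it is fast to evaluate in the kernel. -/
def dropTail {α : Type} (l : List α) : ℕ → List α
  | 0 => l
  | n + 1 => (dropTail l n).tail

/-- The entry of a list at a position, with a default value. -/
def fetch {α : Type} (d : α) (l : List α) (i : ℕ) : α := (dropTail l i).headD d

lemma fetch_eq_getD {α : Type} (d : α) (l : List α) (i : ℕ) : fetch d l i = l.getD i d := by
  have h : dropTail l i = l.drop i := by
    induction i with
    | zero => rfl
    | succ i ih => rw [dropTail, ih, List.tail_drop]
  rw [fetch, h, List.headD_eq_head?_getD, List.head?_drop, List.getD_eq_getElem?_getD]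

/-- The entry of a state. -/
def row (T : Table) (i : ℕ) : ℕ × ℕ × List ℤ := fetch (i, i, []) T i

/-- The transition function. -/
def step (T : Table) (i : ℕ) (b : Bool) : ℕ := bif b then (row T i).2.1 else (row T i).1

/-- The polynomial of a state. -/
def coef (T : Table) (i : ℕ) : List ℤ := (row T i).2.2

/-- The state reached after reading a word. -/
def run (T : Table) (s : ℕ) : Word → ℕ
  | [] => s
  | b :: w => step T (run T s w) b

lemma run_append (T : Table) (s : ℕ) (c w : Word) : run T s (c ++ w) = run T (run T s w) c := by
  induction c with
  | nil => rfl
  | cons b c ih => rw [List.cons_append, run, ih, run]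

lemma row_of_le {T : Table} {i : ℕ} (h : T.length ≤ i) : row T i = (i, i, []) := by
  rw [row, fetch_eq_getD, List.getD_eq_default _ _ h]

lemma row_mem {T : Table} {i : ℕ} (h : i < T.length) : row T i ∈ T := by
  rw [row, fetch_eq_getD, List.getD_eq_getElem _ _ h]
  exact List.getElem_mem h

lemma step_of_le {T : Table} {i : ℕ} (h : T.length ≤ i) (b : Bool) : step T i b = i := by
  cases b <;> simp [step, row_of_le h]

lemma lt_of_step_lt {T : Table} {i : ℕ} {b : Bool} (h : step T i b < T.length) : i < T.length := by
  by_contra hi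
  rw [step_of_le (not_lt.1 hi)] at h
  exact hi h

/-- The transfer operator applied to the polynomials of two states. -/
def pull (c c' : List ℤ) : List ℤ := padd (comb c (ker false)) (comb c' (ker true))

/-- Error bound for `pull`. -/
def pullErr (c c' : List ℤ) : ℤ := cerr c (kerErr false) + cerr c' (kerErr true)

/-- All polynomials are short, positive and bounded. -/
def tableValid (T : Table) : Bool :=
  T.all fun r => decide (r.2.2.length ≤ 10 ∧ 1 ≤ plow r.2.2 ∧ pabs r.2.2 ≤ 2 * 10 ^ 9)

/-- The inequality `0 ≤ sg * (L f - (1 + sg * k / 10 ^ 8) * f)` for the transfer operator `L`. -/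
def tableGrow (T : Table) (sg k : ℤ) : Bool :=
  T.all fun r => decide (0 ≤ plow (padd
    (psmul (sg * 10 ^ 8) (pull (coef T r.1) (coef T r.2.1)))
    (psmul (-sg * (10 ^ 8 + sg * k) * kerScale) r.2.2)) - 10 ^ 8 * pullErr (coef T r.1) (coef T r.2.1))

lemma coef_of_le {T : Table} {i : ℕ} (h : T.length ≤ i) : coef T i = [] := by
  rw [coef, row_of_le h]

lemma length_coef_le {T : Table} (hT : tableValid T = true) (i : ℕ) : (coef T i).length ≤ 10 := by
  rcases lt_or_ge i T.length with h | h
  · exact (of_decide_eq_true (List.all_eq_true.1 hT _ (row_mem h))).1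
  · simp [coef_of_le h]

lemma pev_coef_bounds {T : Table} (hT : tableValid T = true) {i : ℕ} (h : i < T.length) {y : ℝ}
    (hy : |y| ≤ 1) : 1 ≤ pev (coef T i) y ∧ pev (coef T i) y ≤ 2 * 10 ^ 9 := by
  obtain ⟨-, h1, h2⟩ := of_decide_eq_true (List.all_eq_true.1 hT _ (row_mem h))
  have h3 := plow_le (coef T i) hy
  have h4 := (abs_le.1 (abs_pev_le (coef T i) hy)).2
  have h1' : (1 : ℝ) ≤ plow (coef T i) := by exact_mod_cast h1
  have h5 : (pabs (coef T i) : ℝ) ≤ 2 * 10 ^ 9 := by exact_mod_cast h2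
  exact ⟨h1'.trans h3, h4.trans h5⟩

/-- The function of a state. -/
noncomputable def stateFun (T : Table) (i : ℕ) (β : ℝ) : ℝ := pev (coef T i) (coord β)

/-- The transfer operator. -/
noncomputable def transfer (T : Table) (i : ℕ) (β : ℝ) : ℝ :=
  1 / (dig false + β) * stateFun T (step T i false) (1 / (dig false + β)) +
    1 / (dig true + β) * stateFun T (step T i true) (1 / (dig true + β))

lemma stateFun_of_le {T : Table} {i : ℕ} (h : T.length ≤ i) (β : ℝ) : stateFun T i β = 0 := by
  rw [stateFun, coef_of_le h, pev]

lemma stateFun_bounds {T : Table} (hT : tableValid T = true) {i : ℕ} (h : i < T.length) {β : ℝ}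
    (hβ : β ∈ Iv) : 1 ≤ stateFun T i β ∧ stateFun T i β ≤ 2 * 10 ^ 9 :=
  pev_coef_bounds hT h (abs_coord_le hβ)

lemma abs_pull_sub_le {T : Table} (hT : tableValid T = true) (i : ℕ) {β : ℝ} (hβ : β ∈ Iv) :
    |pev (pull (coef T (step T i false)) (coef T (step T i true))) (coord β) -
      kerScale * transfer T i β| ≤
        pullErr (coef T (step T i false)) (coef T (step T i true)) := by
  have key : ∀ b, |pev (comb (coef T (step T i b)) (ker b)) (coord β) - kerScale *
      (1 / (dig b + β)) * stateFun T (step T i b) (1 / (dig b + β))| ≤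
        cerr (coef T (step T i b)) (kerErr b) := fun b =>
    comb_approx ((length_coef_le hT _).trans (by cases b <;> decide))
      ((length_coef_le hT _).trans (by cases b <;> decide)) (ker_approx b hβ)
  rw [pull, pullErr, pev_padd, transfer]
  push_cast
  refine le_trans (le_of_eq ?_) ((abs_add_le _ _).trans (add_le_add (key false) (key true)))
  congr 1
  ring

lemma transfer_of_grow {T : Table} {sg k : ℤ} (hsg : |sg| = 1) (hT : tableValid T = true)
    (hg : tableGrow T sg k = true) (i : ℕ) {β : ℝ} (hβ : β ∈ Iv) :
    0 ≤ sg * (10 ^ 8 * transfer T i β - (10 ^ 8 + sg * k) * stateFun T i β) := by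
  rcases lt_or_ge i T.length with h | h
  · have h1 := of_decide_eq_true (List.all_eq_true.1 hg _ (row_mem h))
    have h2 := plow_le (padd (psmul (sg * 10 ^ 8) (pull (coef T (row T i).1) (coef T (row T i).2.1)))
      (psmul (-sg * (10 ^ 8 + sg * k) * kerScale) (row T i).2.2)) (abs_coord_le hβ)
    have h3 := abs_pull_sub_le hT i hβ
    have h4 : |(sg : ℝ) * 10 ^ 8| = 10 ^ 8 := by
      rw [abs_mul, show |(sg : ℝ)| = 1 by exact_mod_cast hsg, one_mul, abs_of_pos (by norm_num)]
    simp only [step, cond_false, cond_true] at h3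
    set E := pullErr (coef T (row T i).1) (coef T (row T i).2.1) with hE
    have h1' : (10 : ℝ) ^ 8 * E ≤ plow (padd (psmul (sg * 10 ^ 8)
        (pull (coef T (row T i).1) (coef T (row T i).2.1)))
      (psmul (-sg * (10 ^ 8 + sg * k) * kerScale) (row T i).2.2)) := by
      exact_mod_cast sub_nonneg.1 h1
    have h5 := h1'.trans h2
    rw [pev_padd, pev_psmul, pev_psmul] at h5
    push_cast at h5
    have h6 : |(sg : ℝ) * 10 ^ 8 * (pev (pull (coef T (row T i).1) (coef T (row T i).2.1)) (coord β) -
        (kerScale : ℝ) * transfer T i β)| ≤ (10 : ℝ) ^ 8 * (E : ℝ) := by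
      rw [abs_mul, h4]
      exact mul_le_mul_of_nonneg_left h3 (by norm_num)
    have h7 := (abs_le.1 h6).2
    have h8 : (0 : ℝ) < kerScale := by norm_num [kerScale]
    have h9 : pev (row T i).2.2 (coord β) = stateFun T i β := rfl
    rw [h9] at h5
    refine nonneg_of_mul_nonneg_right ?_ h8
    linarith
  · have h1 : transfer T i β = 0 := by
      simp [transfer, step_of_le h, stateFun_of_le h]
    rw [h1, stateFun_of_le h]
    simp

/-- The word whose digits, last digit first, are the decimal digits of a number, last digit first. -/
def ofCode : ℕ → ℕ → Word
  | 0, _ => []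
  | k + 1, n => bif n == 0 then [] else (n % 10 == 2) :: ofCode k (n / 10)

/-- Coefficients with alternating signs. -/
def altern : ℤ → List ℕ → List ℤ
  | _, [] => []
  | s, a :: l => s * a :: altern (-s) l

/-- A table row given by its two transitions and the absolute values of its coefficients. -/
def ofEntries : List ℕ → ℕ × ℕ × List ℤ
  | p :: q :: l => (p, q, altern 1 l)
  | _ => (0, 0, [])

set_option maxRecDepth 20000 in
/-- Transition table of an automaton rejecting `badU`. -/
def tableU : Table := List.map ofEntries [
  [1, 2, 1000000000, 87302009, 7897589, 736723, 70490, 6883, 683, 69, 7, 1],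
  [3, 4, 978786299, 85767300, 7782375, 727714, 69756, 6820, 677, 68, 7, 1],
  [5, 6, 936163174, 80565026, 7182192, 660409, 62322, 6006, 589, 58, 6, 1],
  [7, 8, 969705218, 84865087, 7691455, 718447, 68803, 6722, 667, 67, 7, 1],
  [9, 10, 899506506, 76648685, 6762796, 615420, 57489, 5487, 533, 52, 5, 1],
  [11, 12, 881069713, 78998860, 7302382, 692711, 67122, 6616, 661, 67, 7, 1],
  [13, 14, 929815084, 80121591, 7150329, 658043, 62139, 5992, 587, 58, 6, 1],
  [15, 16, 957021756, 83869489, 7610690, 711697, 68224, 6671, 663, 67, 7, 1],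
  [9, 17, 896662555, 76466566, 6751132, 614673, 57441, 5484, 532, 52, 5, 1],
  [18, 19, 823174734, 75024978, 7025884, 673144, 65709, 6511, 653, 66, 7, 1],
  [20, 21, 928910952, 80036726, 7142350, 657291, 62069, 5985, 587, 58, 6, 1],
  [22, 23, 941651134, 81843152, 7364644, 683009, 64953, 6303, 622, 62, 6, 1],
  [24, 25, 710290402, 56731446, 4663911, 394002, 34108, 3015, 271, 25, 2, 0],
  [26, 27, 879096429, 78795388, 7281304, 690519, 66893, 6592, 658, 66, 7, 1],
  [28, 29, 917757434, 78839137, 7013523, 643417, 60573, 5824, 569, 56, 6, 1],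
  [30, 31, 946367667, 82723049, 7486756, 698257, 66763, 6512, 645, 65, 7, 1],
  [32, 17, 882271674, 74908625, 6582471, 596413, 55465, 5270, 509, 50, 5, 0],
  [33, 21, 922232853, 79322238, 7065825, 649087, 61188, 5890, 577, 57, 6, 1],
  [34, 23, 931471576, 80733788, 7243745, 669834, 63517, 6147, 604, 60, 6, 1],
  [35, 25, 588088600, 44882647, 3514990, 282592, 23304, 1967, 170, 15, 1, 0],
  [36, 37, 877647893, 78646793, 7265978, 688931, 66728, 6574, 657, 66, 7, 1],
  [28, 38, 917729467, 78837290, 7013401, 643409, 60573, 5824, 569, 56, 6, 1],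
  [39, 40, 913816492, 81091440, 7431593, 700101, 67468, 6621, 659, 66, 7, 1],
  [9, 41, 894419451, 76322692, 6741902, 614080, 57403, 5481, 532, 52, 5, 1],
  [42, 392, 520440833, 52694443, 5353679, 545787, 55829, 5730, 590, 61, 6, 1],
  [43, 44, 928884965, 80034355, 7142126, 657270, 62066, 5985, 587, 58, 6, 1],
  [45, 46, 938549303, 81601928, 7345283, 681410, 64818, 6291, 620, 62, 6, 1],
  [24, 47, 710197220, 56725332, 4663509, 393976, 34106, 3015, 271, 25, 2, 0],
  [48, 49, 860087585, 77471343, 7187412, 683717, 66388, 6553, 655, 66, 7, 1],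
  [50, 29, 917394228, 78805046, 7010322, 643116, 60545, 5821, 569, 56, 6, 1],
  [51, 52, 930068544, 81680279, 7419964, 693971, 66487, 6494, 644, 65, 7, 1],
  [32, 53, 881257603, 74843899, 6578340, 596150, 55448, 5268, 509, 50, 5, 0],
  [18, 54, 800236373, 73510036, 6925831, 666537, 65272, 6482, 651, 66, 7, 1],
  [55, 56, 866986043, 77907350, 7213817, 685175, 66451, 6553, 655, 66, 7, 1],
  [57, 58, 897605511, 80050442, 7364730, 695805, 67192, 6603, 658, 66, 7, 1],
  [59, 392, 322839856, 33889432, 3563516, 375319, 39591, 4183, 442, 47, 5, 1],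
  [60, 61, 936287843, 81424217, 7330842, 680200, 64714, 6282, 620, 62, 6, 1],
  [24, 62, 710104009, 56719217, 4663108, 393950, 34104, 3015, 271, 25, 2, 0],
  [63, 29, 917327987, 78798703, 7009714, 643058, 60539, 5820, 569, 56, 6, 1],
  [64, 65, 945919624, 82689829, 7484272, 698070, 66749, 6511, 645, 65, 7, 1],
  [66, 67, 781478265, 64120304, 5427684, 472797, 42231, 3853, 358, 34, 3, 0],
  [68, 69, 916963302, 78761559, 7006027, 642697, 60504, 5817, 569, 56, 6, 1],
  [70, 23, 837007998, 70512777, 6137824, 550172, 50569, 4746, 453, 44, 4, 0],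
  [36, 71, 877624113, 78645098, 7265857, 688922, 66727, 6574, 657, 66, 7, 1],
  [28, 72, 917702562, 78835512, 7013284, 643401, 60572, 5824, 569, 56, 6, 1],
  [73, 40, 911285307, 80815228, 7401451, 696812, 67109, 6582, 655, 66, 7, 1],
  [74, 41, 890790120, 75929765, 6699362, 609475, 56905, 5427, 526, 52, 5, 1],
  [75, 44, 928664689, 80012705, 7139998, 657060, 62046, 5983, 587, 58, 6, 1],
  [76, 46, 933822408, 81086735, 7289132, 675290, 64151, 6219, 613, 61, 6, 1],
  [77, 47, 672114216, 52997029, 4298511, 358243, 30608, 2673, 238, 21, 2, 0],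
  [78, 49, 859497936, 77410415, 7181098, 683060, 66319, 6546, 655, 66, 7, 1],
  [79, 80, 929989389, 81674124, 7419478, 693932, 66484, 6494, 644, 65, 7, 1],
  [81, 53, 843129950, 70725842, 6133560, 548110, 50259, 4708, 449, 43, 4, 0],
  [82, 83, 919853764, 79064935, 7037972, 646070, 60861, 5855, 573, 57, 6, 1],
  [84, 25, 533762816, 39675528, 3015888, 234753, 18719, 1528, 127, 11, 1, 0],
  [85, 61, 933834520, 81156824, 7301699, 677024, 64367, 6244, 616, 61, 6, 1],
  [86, 62, 688456491, 54599506, 4455547, 373626, 32114, 2820, 252, 23, 2, 0],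
  [64, 87, 945907016, 82688930, 7484208, 698065, 66749, 6511, 645, 65, 7, 1],
  [88, 67, 743405343, 60079292, 4998776, 427274, 37399, 3340, 303, 28, 3, 0],
  [89, 23, 516749253, 38523655, 2936352, 229127, 18309, 1497, 125, 11, 1, 0],
  [90, 91, 909388635, 80612130, 7379566, 694443, 66852, 6554, 652, 66, 7, 1],
  [92, 41, 888220690, 75651592, 6669247, 606214, 56552, 5389, 522, 51, 5, 1],
  [93, 44, 928444345, 79991049, 7137870, 656851, 62025, 5981, 586, 58, 6, 1],
  [94, 49, 859390659, 77399869, 7180061, 682958, 66309, 6545, 655, 66, 7, 1],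
  [95, 52, 929980916, 81670985, 7418978, 693866, 66476, 6493, 644, 65, 7, 1],
  [32, 96, 880301439, 74782719, 6574425, 595899, 55432, 5267, 509, 50, 5, 0],
  [18, 97, 639338387, 62382664, 6155673, 613190, 61574, 6226, 633, 65, 7, 1],
  [98, 21, 922217973, 79320658, 7065657, 649069, 61186, 5890, 577, 57, 6, 1],
  [99, 100, 858639048, 77322749, 7172086, 682129, 66223, 6536, 654, 66, 7, 1],
  [101, 38, 917626999, 78827898, 7012540, 643330, 60565, 5823, 569, 56, 6, 1],
  [57, 102, 747024079, 70083074, 6704938, 652128, 64300, 6412, 645, 65, 7, 1],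
  [24, 103, 710046390, 56715436, 4662860, 393933, 34103, 3015, 271, 25, 2, 0],
  [104, 29, 917264263, 78792600, 7009130, 643002, 60534, 5820, 569, 56, 6, 1],
  [64, 105, 941889437, 82432503, 7467841, 697021, 66682, 6507, 645, 65, 7, 1],
  [18, 106, 817389796, 74642995, 7000661, 671479, 65599, 6504, 652, 66, 7, 1],
  [107, 71, 877268529, 78612488, 7262866, 688648, 66702, 6572, 656, 66, 7, 1],
  [73, 108, 903757829, 80332087, 7370442, 694821, 66981, 6574, 654, 66, 7, 1],
  [109, 392, 458934342, 46991994, 4824988, 496771, 51284, 5308, 551, 57, 6, 1],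
  [110, 111, 932876604, 81012150, 7283046, 674778, 64106, 6215, 612, 61, 6, 1],
  [112, 80, 929952072, 81670165, 7419058, 693887, 66479, 6494, 644, 65, 7, 1],
  [81, 113, 842993594, 70717144, 6133006, 548075, 50257, 4708, 449, 43, 4, 0],
  [18, 114, 739443437, 69456118, 6655499, 648510, 64070, 6402, 646, 66, 7, 1],
  [55, 115, 863217334, 77659816, 7197559, 684107, 66381, 6549, 655, 66, 7, 1],
  [116, 38, 917695534, 78834180, 7013116, 643383, 60570, 5823, 569, 56, 6, 1],
  [117, 392, 234869706, 25261929, 2717388, 292336, 31453, 3384, 364, 39, 4, 0],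
  [90, 118, 905481775, 80361380, 7363473, 693411, 66785, 6550, 652, 66, 7, 1],
  [119, 392, 485479597, 49454904, 5053500, 517972, 53252, 5491, 568, 59, 6, 1],
  [32, 120, 880270889, 74780714, 6574293, 595891, 55431, 5267, 509, 50, 5, 0],
  [18, 392, 578489210, 58035278, 5845071, 590999, 59989, 6112, 625, 64, 7, 1],
  [121, 392, 231079419, 24848078, 2672201, 287402, 30914, 3326, 358, 38, 4, 0],
  [64, 122, 939033941, 82250175, 7456200, 696277, 66634, 6504, 645, 65, 7, 1],
  [66, 123, 781227720, 64104323, 5426664, 472732, 42227, 3853, 358, 34, 3, 0],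
  [18, 124, 813294270, 74372549, 6982802, 670300, 65521, 6499, 652, 66, 7, 1],
  [125, 71, 876912835, 78579868, 7259875, 688374, 66677, 6570, 656, 66, 7, 1],
  [126, 111, 932703434, 80996278, 7281591, 674644, 64094, 6214, 612, 61, 6, 1],
  [79, 127, 929849328, 81664092, 7418759, 693880, 66480, 6494, 644, 65, 7, 1],
  [128, 83, 917609024, 78824116, 7012114, 643292, 60563, 5823, 569, 56, 6, 1],
  [392, 129, 147523992, 9564821, 620262, 40231, 2610, 169, 11, 1, 0, 0],
  [55, 130, 866962263, 77905654, 7213696, 685167, 66450, 6553, 655, 66, 7, 1],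
  [131, 61, 931560948, 80909024, 7274691, 674080, 64046, 6210, 612, 61, 6, 1],
  [132, 62, 672021005, 52990914, 4298110, 358217, 30606, 2672, 238, 21, 2, 0],
  [133, 49, 859920761, 77453136, 7185425, 683500, 66364, 6551, 655, 66, 7, 1],
  [392, 67, 386549545, 26175228, 1775589, 120659, 8214, 560, 38, 3, 0, 0],
  [134, 44, 928308137, 79977661, 7136554, 656722, 62013, 5979, 586, 58, 6, 1],
  [135, 49, 859287459, 77389724, 7179064, 682860, 66300, 6544, 654, 66, 7, 1],
  [136, 96, 870845459, 73761063, 6464042, 583973, 54143, 5128, 494, 48, 5, 0],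
  [137, 25, 574388693, 43568491, 3388930, 270500, 22144, 1856, 159, 14, 1, 0],
  [138, 61, 935708969, 81361124, 7323966, 679451, 64632, 6273, 619, 62, 6, 1],
  [139, 67, 763791576, 62241935, 5228196, 451611, 39981, 3614, 332, 31, 3, 0],
  [140, 23, 737007938, 59879593, 5007175, 429947, 37786, 3386, 308, 28, 3, 0],
  [141, 142, 902957341, 80246908, 7361302, 693835, 66874, 6562, 653, 66, 7, 1],
  [143, 41, 889726354, 75814599, 6686894, 608125, 56759, 5411, 525, 52, 5, 1],
  [112, 144, 929892424, 81665893, 7418752, 693865, 66478, 6493, 644, 65, 7, 1],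
  [145, 83, 919533920, 79030264, 7034214, 645663, 60817, 5850, 572, 57, 6, 1],
  [392, 25, 389388893, 26357024, 1787230, 121405, 8262, 563, 38, 3, 0, 0],
  [146, 62, 679544760, 53727215, 4370167, 365268, 31296, 2740, 244, 22, 2, 0],
  [147, 49, 860032341, 77465314, 7186754, 683645, 66380, 6552, 655, 66, 7, 1],
  [392, 23, 374703364, 25418477, 1727241, 117570, 8016, 548, 37, 3, 0, 0],
  [148, 123, 772048156, 63129352, 5323112, 461734, 41059, 3728, 344, 32, 3, 0],
  [149, 23, 780162616, 64460482, 5493438, 481564, 43265, 3968, 370, 35, 3, 0],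
  [150, 83, 917536805, 78817018, 7011417, 643223, 60556, 5822, 569, 56, 6, 1],
  [392, 87, 368668904, 25034161, 1702771, 116013, 7917, 541, 37, 3, 0, 0],
  [151, 96, 864145593, 73037252, 6385846, 575525, 53231, 5030, 483, 47, 5, 0],
  [152, 21, 921630284, 79256951, 7058751, 648321, 61105, 5881, 576, 57, 6, 1],
  [153, 25, 564689507, 42638299, 3299721, 261944, 21323, 1777, 151, 13, 1, 0],
  [154, 61, 935129916, 81298012, 7317087, 678701, 64550, 6264, 618, 62, 6, 1],
  [155, 142, 902675411, 80216143, 7357945, 693469, 66834, 6558, 653, 66, 7, 1],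
  [81, 156, 842653759, 70695468, 6131623, 547987, 50251, 4708, 449, 43, 4, 0],
  [157, 158, 859634852, 77414072, 7180461, 682897, 66293, 6542, 654, 66, 7, 1],
  [159, 392, 347592979, 35647063, 3664509, 377602, 39000, 4037, 419, 44, 5, 0],
  [86, 160, 688398872, 54595726, 4455299, 373609, 32113, 2820, 252, 23, 2, 0],
  [90, 161, 901861157, 80128989, 7348556, 692453, 66724, 6546, 651, 66, 7, 1],
  [162, 392, 458934342, 46991994, 4824988, 496771, 51284, 5308, 551, 57, 6, 1],
  [76, 163, 933556794, 81069786, 7288050, 675221, 64146, 6218, 613, 61, 6, 1],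
  [164, 71, 876692958, 78559704, 7258026, 688204, 66661, 6568, 656, 66, 7, 1],
  [165, 111, 932536846, 80981008, 7280191, 674516, 64082, 6213, 612, 61, 6, 1],
  [18, 166, 785159901, 72506066, 6858974, 662084, 64976, 6463, 650, 66, 7, 1],
  [167, 392, 300657614, 31718290, 3351009, 354519, 37555, 3983, 423, 45, 5, 1],
  [90, 168, 908466792, 80552965, 7375769, 694200, 66836, 6553, 652, 66, 7, 1],
  [18, 169, 611073317, 60367855, 6012052, 602952, 60844, 6174, 630, 64, 7, 1],
  [57, 392, 587240290, 58746017, 5900508, 595046, 60249, 6125, 625, 64, 7, 1],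
  [64, 170, 940707130, 82357011, 7463021, 696713, 66662, 6505, 645, 65, 7, 1],
  [139, 171, 763651011, 62232969, 5227624, 451575, 39979, 3614, 332, 31, 3, 0],
  [18, 172, 815694213, 74531028, 6993267, 670991, 65566, 6502, 652, 66, 7, 1],
  [81, 173, 842848868, 70707913, 6132417, 548037, 50255, 4708, 449, 43, 4, 0],
  [55, 174, 862707610, 77626335, 7195360, 683963, 66371, 6548, 655, 66, 7, 1],
  [175, 392, 471086247, 48119773, 4929653, 506484, 52186, 5392, 559, 58, 6, 1],
  [76, 176, 933734449, 81081122, 7288774, 675267, 64149, 6219, 613, 61, 6, 1],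
  [18, 177, 624668701, 61337294, 6081179, 607881, 61196, 6199, 631, 65, 7, 1],
  [57, 178, 656210243, 63671525, 6252266, 620167, 62043, 6253, 634, 65, 7, 1],
  [179, 158, 859518271, 77403381, 7179480, 682807, 66285, 6542, 654, 66, 7, 1],
  [18, 180, 774477607, 71794449, 6811569, 658927, 64765, 6449, 649, 66, 7, 1],
  [55, 181, 866025684, 77844138, 7209656, 684901, 66433, 6552, 655, 66, 7, 1],
  [182, 392, 284952743, 30180300, 3200393, 339769, 36111, 3842, 409, 44, 5, 0],
  [90, 183, 907544663, 80493781, 7371970, 693956, 66820, 6552, 652, 66, 7, 1],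
  [64, 184, 940258237, 82328349, 7461191, 696596, 66655, 6505, 645, 65, 7, 1],
  [185, 83, 918736791, 78943854, 7024847, 644648, 60707, 5838, 571, 57, 6, 1],
  [186, 61, 933182068, 81085712, 7293948, 676179, 64275, 6234, 614, 61, 6, 1],
  [187, 62, 672021005, 52990914, 4298110, 358217, 30606, 2672, 238, 21, 2, 0],
  [188, 71, 558086407, 45098263, 3737983, 317321, 27525, 2433, 218, 20, 2, 0],
  [189, 44, 928308137, 79977661, 7136554, 656722, 62013, 5979, 586, 58, 6, 1],
  [190, 123, 763541030, 62225954, 5227177, 451546, 39977, 3614, 332, 31, 3, 0],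
  [191, 23, 737007938, 59879593, 5007175, 429947, 37786, 3386, 308, 28, 3, 0],
  [192, 41, 890167019, 75862307, 6692059, 608684, 56819, 5418, 525, 52, 5, 1],
  [193, 61, 934771968, 81258998, 7312835, 678238, 64500, 6259, 617, 62, 6, 1],
  [194, 142, 902404197, 80186547, 7354716, 693117, 66796, 6554, 652, 66, 7, 1],
  [195, 25, 497972672, 36355277, 2707868, 206178, 16068, 1282, 105, 9, 1, 0],
  [196, 23, 480922510, 35200008, 2628017, 200523, 15656, 1251, 102, 9, 1, 0],
  [197, 123, 779061759, 63874270, 5402230, 470137, 41952, 3823, 354, 33, 3, 0],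
  [392, 198, 79046430, 5059540, 323849, 20729, 1327, 85, 5, 0, 0, 0],
  [199, 96, 868071408, 73461369, 6431664, 580475, 53765, 5087, 490, 48, 5, 0],
  [200, 21, 921888259, 79284916, 7061783, 648649, 61141, 5885, 576, 57, 6, 1],
  [201, 25, 570373152, 43183376, 3351995, 266958, 21804, 1824, 156, 14, 1, 0],
  [202, 83, 919194447, 78993465, 7030225, 645231, 60770, 5845, 572, 57, 6, 1],
  [203, 62, 678339420, 53609254, 4358622, 364139, 31186, 2729, 243, 22, 2, 0],
  [204, 23, 756762676, 61975254, 5229491, 453531, 40288, 3652, 336, 31, 3, 0],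
  [205, 41, 890583778, 75907426, 6696944, 609213, 56876, 5424, 526, 52, 5, 1],
  [392, 206, 111987297, 7222183, 465832, 30050, 1939, 125, 8, 1, 0, 0],
  [392, 207, 167190183, 10869355, 706783, 45968, 2990, 195, 13, 1, 0, 0],
  [208, 61, 932992279, 81065027, 7291693, 675933, 64248, 6232, 614, 61, 6, 1],
  [209, 25, 472611216, 34006015, 2490254, 186020, 14200, 1109, 89, 7, 1, 0],
  [210, 160, 686184182, 54378945, 4434080, 371532, 31910, 2800, 250, 23, 2, 0],
  [211, 23, 455559153, 32850571, 2410386, 180364, 13788, 1078, 86, 7, 1, 0],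
  [212, 123, 776895125, 63644147, 5377788, 467541, 41676, 3794, 351, 33, 3, 0],
  [213, 96, 867018167, 73347584, 6419372, 579147, 53622, 5072, 488, 48, 5, 0],
  [55, 214, 861437252, 77542892, 7189879, 683603, 66348, 6547, 654, 66, 7, 1],
  [90, 215, 904442757, 80294690, 7359192, 693136, 66768, 6549, 652, 66, 7, 1],
  [216, 392, 458934342, 46991994, 4824988, 496771, 51284, 5308, 551, 57, 6, 1],
  [217, 392, 424832424, 43312194, 4427524, 453801, 46635, 4805, 496, 51, 5, 1],
  [218, 71, 876692958, 78559704, 7258026, 688204, 66661, 6568, 656, 66, 7, 1],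
  [18, 219, 611073317, 60367855, 6012052, 602952, 60844, 6174, 630, 64, 7, 1],
  [57, 392, 587240290, 58746017, 5900508, 595046, 60249, 6125, 625, 64, 7, 1],
  [18, 220, 816396608, 74577410, 6996330, 671193, 65580, 6503, 652, 66, 7, 1],
  [90, 221, 906974639, 80457195, 7369622, 693805, 66811, 6551, 652, 66, 7, 1],
  [64, 222, 939826405, 82300775, 7459430, 696483, 66648, 6505, 645, 65, 7, 1],
  [223, 392, 176684730, 19083793, 2061387, 222681, 24057, 2599, 281, 30, 3, 0],
  [224, 392, 172834944, 18663623, 2015529, 217676, 23510, 2539, 274, 30, 3, 0],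
  [18, 225, 635877015, 62136021, 6138098, 611938, 61485, 6219, 633, 65, 7, 1],
  [226, 392, 185589762, 19890500, 2131918, 228522, 24497, 2626, 282, 30, 3, 0],
  [18, 227, 780736948, 72211435, 6839348, 660777, 64889, 6457, 649, 66, 7, 1],
  [55, 228, 866436809, 77871141, 7211430, 685018, 66440, 6553, 655, 66, 7, 1],
  [229, 392, 294155688, 31081586, 3288660, 348414, 36957, 3925, 417, 44, 5, 1],
  [55, 230, 862166603, 77590799, 7193026, 683810, 66361, 6548, 655, 66, 7, 1],
  [231, 392, 469139461, 47939107, 4912887, 504928, 52042, 5379, 557, 58, 6, 1],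
  [57, 232, 618815036, 61006299, 6062310, 606629, 61079, 6184, 629, 64, 7, 1],
  [18, 233, 817060899, 74621276, 6999227, 671384, 65592, 6503, 652, 66, 7, 1],
  [234, 392, 263474182, 27526567, 2880587, 301925, 31694, 3332, 351, 37, 4, 0],
  [235, 392, 394226429, 40042569, 4077785, 416346, 42619, 4374, 450, 46, 5, 0],
  [90, 236, 904140523, 80275291, 7357947, 693056, 66763, 6548, 652, 66, 7, 1],
  [237, 392, 135446578, 14689954, 1593232, 172800, 18742, 2033, 220, 24, 3, 0],
  [238, 392, 481902656, 49123123, 5022726, 515118, 52987, 5466, 566, 59, 6, 1],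
  [239, 392, 131593700, 14269454, 1547339, 167791, 18195, 1973, 214, 23, 3, 0],
  [18, 240, 632414562, 61889293, 6120517, 610685, 61396, 6213, 632, 65, 7, 1],
  [18, 241, 779057656, 72099565, 6831895, 660281, 64856, 6455, 649, 66, 7, 1],
  [242, 62, 675335412, 53315267, 4329851, 361323, 30910, 2702, 241, 22, 2, 0],
  [243, 123, 769606848, 62870097, 5295580, 458810, 40749, 3695, 341, 32, 3, 0],
  [244, 23, 737007938, 59879593, 5007175, 429947, 37786, 3386, 308, 28, 3, 0],
  [245, 91, 682625922, 56235128, 4758773, 412651, 36550, 3295, 301, 28, 3, 0],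
  [246, 61, 934771968, 81258998, 7312835, 678238, 64500, 6259, 617, 62, 6, 1],
  [392, 247, 79046430, 5059540, 323849, 20729, 1327, 85, 5, 0, 0, 0],
  [248, 25, 572036591, 43342910, 3367296, 268425, 21945, 1837, 157, 14, 1, 0],
  [249, 123, 775555796, 63501895, 5362679, 465936, 41505, 3776, 349, 33, 3, 0],
  [250, 96, 866004957, 73238124, 6407546, 577870, 53484, 5057, 486, 47, 5, 0],
  [392, 251, 281715525, 18784965, 1254021, 83811, 5608, 376, 25, 2, 0, 0],
  [392, 252, 275585976, 18393867, 1229067, 82219, 5506, 369, 25, 2, 0, 0],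
  [392, 253, 139139145, 9011837, 583793, 37826, 2451, 159, 10, 1, 0, 0],
  [392, 71, 296226775, 20382919, 1404203, 96852, 6688, 462, 32, 2, 0, 0],
  [254, 25, 487471994, 35382440, 2617740, 197828, 15294, 1210, 98, 8, 1, 0],
  [255, 160, 687156353, 54474104, 4443395, 372444, 31999, 2809, 251, 23, 2, 0],
  [256, 23, 470421832, 34227172, 2537888, 192173, 14882, 1179, 96, 8, 1, 0],
  [257, 62, 677060105, 53484053, 4346370, 362939, 31068, 2718, 242, 22, 2, 0],
  [258, 23, 753597865, 61639479, 5193866, 449752, 39887, 3609, 332, 31, 3, 0],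
  [392, 259, 76597391, 4903330, 313885, 20093, 1286, 82, 5, 0, 0, 0],
  [260, 25, 573609787, 43493789, 3381766, 269813, 22078, 1850, 158, 14, 1, 0],
  [261, 71, 421991921, 31995701, 2476511, 195869, 15831, 1307, 110, 9, 1, 0],
  [262, 130, 633752161, 52824853, 4516077, 394988, 35233, 3195, 294, 27, 3, 0],
  [263, 123, 768896710, 62794684, 5287572, 457960, 40658, 3686, 340, 32, 3, 0],
  [392, 264, 215841697, 14147411, 927534, 60826, 3990, 262, 17, 1, 0, 0],
  [265, 23, 774347381, 63842793, 5427828, 474595, 42525, 3889, 362, 34, 3, 0],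
  [392, 266, 209707210, 13755966, 902556, 59233, 3888, 255, 17, 1, 0, 0],
  [392, 267, 130751584, 8458801, 547328, 35421, 2293, 148, 10, 1, 0, 0],
  [268, 25, 483485075, 35013145, 2583533, 194660, 15001, 1183, 95, 8, 1, 0],
  [269, 392, 464287579, 47488836, 4871100, 501050, 51682, 5345, 554, 58, 6, 1],
  [18, 270, 620767215, 61059112, 6061344, 606467, 61095, 6192, 631, 65, 7, 1],
  [57, 392, 587240290, 58746017, 5900508, 595046, 60249, 6125, 625, 64, 7, 1],
  [64, 392, 577238112, 57654769, 5781436, 582052, 58831, 5970, 608, 62, 6, 1],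
  [90, 271, 906974639, 80457195, 7369622, 693805, 66811, 6551, 652, 66, 7, 1],
  [272, 392, 185589762, 19890500, 2131918, 228522, 24497, 2626, 282, 30, 3, 0],
  [273, 392, 296849114, 31345343, 3314489, 350943, 37205, 3949, 420, 45, 5, 1],
  [18, 274, 630274208, 61736773, 6109648, 609910, 61340, 6209, 632, 65, 7, 1],
  [18, 275, 777442188, 71991946, 6824726, 659803, 64824, 6452, 649, 66, 7, 1],
  [9, 276, 669084329, 61570274, 5775815, 550797, 53257, 5209, 514, 51, 5, 1],
  [32, 277, 654705364, 60013181, 5607215, 532542, 51281, 4995, 491, 49, 5, 0],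
  [278, 392, 327742791, 33734002, 3480138, 359833, 37287, 3872, 403, 42, 4, 0],
  [279, 392, 159610758, 17265227, 1867690, 202050, 21859, 2365, 256, 28, 3, 0],
  [280, 392, 483472807, 49268763, 5036235, 516371, 53103, 5477, 567, 59, 6, 1],
  [281, 392, 155760972, 16845058, 1821832, 197045, 21313, 2305, 249, 27, 3, 0],
  [282, 392, 467073194, 47747352, 4895091, 503277, 51888, 5364, 556, 58, 6, 1],
  [57, 283, 613756678, 60644355, 6036412, 604776, 60946, 6174, 629, 64, 7, 1],
  [284, 392, 179845212, 19267766, 2064411, 221204, 23704, 2540, 272, 29, 3, 0],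
  [285, 392, 299396418, 31594788, 3338916, 353335, 37439, 3972, 422, 45, 5, 1],
  [286, 392, 204573739, 21956256, 2356701, 252981, 27159, 2916, 313, 34, 4, 0],
  [85, 392, 561773549, 55906957, 5585216, 560140, 56395, 5700, 578, 59, 6, 1],
  [18, 287, 619632333, 60978192, 6055574, 606056, 61066, 6189, 631, 65, 7, 1],
  [9, 392, 510106677, 50290932, 4975517, 494011, 49228, 4923, 494, 50, 5, 1],
  [57, 288, 646917122, 63009485, 6205102, 616807, 61804, 6236, 633, 65, 7, 1],
  [32, 392, 495715796, 48732990, 4806856, 475752, 47251, 4709, 471, 47, 5, 0],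
  [289, 392, 307887468, 31818758, 3295394, 342013, 35568, 3706, 387, 40, 4, 0],
  [290, 392, 153127923, 16574416, 1794077, 194206, 21023, 2276, 246, 27, 3, 0],
  [291, 23, 745710373, 60802675, 5105087, 440333, 38887, 3503, 321, 30, 3, 0],
  [392, 292, 102534421, 6601299, 425051, 27372, 1763, 114, 7, 0, 0, 0],
  [293, 123, 775555796, 63501895, 5362679, 465936, 41505, 3776, 349, 33, 3, 0],
  [392, 71, 296226775, 20382919, 1404203, 96852, 6688, 462, 32, 2, 0, 0],
  [294, 23, 474771739, 34630159, 2575222, 195632, 15203, 1209, 98, 8, 1, 0],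
  [392, 295, 125566693, 8116969, 524792, 33935, 2195, 142, 9, 1, 0, 0],
  [296, 25, 479649677, 34657898, 2550629, 191612, 14718, 1157, 93, 8, 1, 0],
  [392, 69, 384593864, 26050131, 1767584, 120147, 8181, 558, 38, 3, 0, 0],
  [392, 83, 384622710, 26052058, 1767713, 120156, 8182, 558, 38, 3, 0, 0],
  [297, 71, 525964471, 41992166, 3437632, 288278, 24716, 2161, 192, 17, 2, 0],
  [392, 298, 254440287, 16862203, 1118476, 74256, 4934, 328, 22, 1, 0, 0],
  [299, 23, 776900063, 64113935, 5456628, 477654, 42850, 3924, 365, 34, 3, 0],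
  [392, 300, 248310738, 16471106, 1093522, 72664, 4833, 322, 21, 1, 0, 0],
  [301, 23, 750238822, 61283102, 5156056, 445740, 39461, 3564, 327, 30, 3, 0],
  [392, 302, 64327979, 4115641, 263316, 16847, 1078, 69, 4, 0, 0, 0],
  [392, 130, 287071924, 19781679, 1364717, 94259, 6518, 451, 31, 2, 0, 0],
  [303, 23, 478885663, 35011299, 2610533, 198903, 15506, 1237, 101, 8, 1, 0],
  [392, 91, 326465051, 22337189, 1530466, 105007, 7215, 496, 34, 2, 0, 0],
  [392, 304, 99784709, 6420716, 413191, 26593, 1712, 110, 7, 0, 0, 0],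
  [392, 305, 144680041, 9382701, 608599, 39484, 2562, 166, 11, 1, 0, 0],
  [306, 71, 493837726, 38892755, 3138618, 259431, 21933, 1892, 166, 15, 1, 0],
  [392, 307, 244084764, 16133491, 1067197, 70648, 4681, 310, 21, 1, 0, 0],
  [57, 308, 601149939, 59742180, 5971849, 600156, 60615, 6151, 627, 64, 7, 1],
  [309, 392, 241121237, 25338719, 2666446, 280965, 29643, 3131, 331, 35, 4, 0],
  [18, 310, 630274208, 61736773, 6109648, 609910, 61340, 6209, 632, 65, 7, 1],
  [311, 392, 162833887, 17598446, 1902081, 205593, 22224, 2402, 260, 28, 3, 0],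
  [312, 392, 295613973, 30634390, 3181105, 330984, 34504, 3604, 377, 40, 4, 0],
  [313, 392, 146891440, 15909804, 1723250, 186658, 20219, 2190, 237, 26, 3, 0],
  [314, 392, 372873565, 38331731, 3950127, 408041, 42249, 4385, 456, 48, 5, 1],
  [9, 315, 603232129, 56934242, 5449436, 527820, 51639, 5095, 506, 51, 5, 1],
  [57, 316, 650996476, 63300105, 6225807, 618282, 61909, 6243, 633, 65, 7, 1],
  [32, 317, 588853164, 55377148, 5280835, 509565, 49663, 4881, 483, 48, 5, 0],
  [57, 318, 608387865, 60260176, 6008921, 602809, 60805, 6164, 628, 64, 7, 1],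
  [319, 392, 151014869, 16208417, 1739766, 186754, 20048, 2152, 231, 25, 3, 0],
  [320, 392, 169523066, 18310896, 1977962, 213675, 23084, 2494, 269, 29, 3, 0],
  [321, 392, 234619311, 24702016, 2604097, 274860, 29045, 3073, 325, 34, 4, 0],
  [322, 392, 340914880, 34932575, 3587984, 369397, 38119, 3943, 409, 42, 4, 0],
  [323, 392, 320892110, 33318823, 3466700, 361421, 37753, 3951, 414, 44, 5, 0],
  [9, 324, 578243857, 55156810, 5323006, 518827, 51000, 5050, 503, 50, 5, 1],
  [392, 325, 33748181, 2154102, 137494, 8776, 560, 36, 2, 0, 0, 0],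
  [326, 71, 385889468, 28646466, 2165801, 167045, 13157, 1059, 87, 7, 1, 0],
  [392, 327, 125566693, 8116969, 524792, 33935, 2195, 142, 9, 1, 0, 0],
  [392, 328, 259609451, 17267423, 1149645, 76620, 5112, 341, 23, 2, 0, 0],
  [329, 71, 473979663, 36978935, 2954174, 241655, 20220, 1727, 150, 13, 1, 0],
  [392, 330, 234122862, 15432685, 1017896, 67180, 4437, 293, 19, 1, 0, 0],
  [331, 91, 598488994, 47984467, 3949692, 333311, 28770, 2532, 227, 21, 2, 0],
  [392, 332, 225668392, 14774508, 967551, 63380, 4153, 272, 18, 1, 0, 0],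
  [392, 333, 154561288, 10035182, 651683, 42329, 2750, 179, 12, 1, 0, 0],
  [392, 334, 225697238, 14776435, 967680, 63389, 4153, 272, 18, 1, 0, 0],
  [392, 335, 51305321, 3279885, 209680, 13405, 857, 55, 4, 0, 0, 0],
  [392, 336, 240993138, 16486845, 1129121, 77413, 5313, 365, 25, 2, 0, 0],
  [392, 337, 270295287, 18020802, 1202761, 80364, 5376, 360, 24, 2, 0, 0],
  [338, 71, 375388790, 27673629, 2075673, 158695, 12384, 987, 80, 7, 1, 0],
  [339, 130, 547424557, 44358819, 3685822, 313566, 27248, 2412, 217, 20, 2, 0],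
  [340, 91, 514378288, 39864754, 3165846, 257641, 21465, 1827, 159, 14, 1, 0],
  [392, 341, 165169784, 10740248, 698532, 45441, 2957, 192, 13, 1, 0, 0],
  [342, 392, 79175882, 8563589, 926232, 100181, 10836, 1172, 127, 14, 1, 0],
  [343, 392, 145881058, 15724257, 1694986, 182720, 19698, 2124, 229, 25, 3, 0],
  [344, 392, 295613973, 30634390, 3181105, 330984, 34504, 3604, 377, 40, 4, 0],
  [32, 345, 616130383, 57300050, 5416389, 519121, 50337, 4929, 487, 48, 5, 0],
  [346, 392, 288757432, 30211494, 3166230, 332366, 34943, 3679, 388, 41, 4, 0],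
  [9, 347, 554207601, 53444167, 5200976, 510132, 50380, 5006, 500, 50, 5, 1],
  [348, 392, 441379879, 45116655, 4624294, 475258, 48975, 5060, 524, 54, 6, 1],
  [101, 392, 533159556, 52786079, 5245502, 523219, 52387, 5265, 531, 54, 5, 1],
  [349, 392, 364315829, 37177101, 3803270, 390047, 40100, 4133, 427, 44, 5, 0],
  [116, 392, 533228091, 52792360, 5246078, 523271, 52392, 5266, 531, 54, 5, 1],
  [350, 392, 120417462, 12957794, 1394425, 150066, 16151, 1738, 187, 20, 2, 0],
  [86, 351, 576655587, 47389552, 3990518, 343628, 30179, 2695, 244, 22, 2, 0],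
  [32, 352, 641930702, 59115230, 5544096, 528106, 50969, 4973, 490, 49, 5, 0],
  [353, 392, 128807086, 13905691, 1501289, 162089, 17501, 1890, 204, 22, 2, 0],
  [354, 392, 422379102, 43044800, 4398380, 450625, 46289, 4767, 492, 51, 5, 1],
  [355, 392, 305298479, 32015344, 3362942, 353817, 37283, 3934, 416, 44, 5, 0],
  [356, 392, 389484935, 39531666, 4022718, 410409, 41979, 4305, 443, 46, 5, 0],
  [392, 357, 126218401, 8368021, 554801, 36785, 2439, 162, 11, 1, 0, 0],
  [392, 358, 232665733, 15645602, 1053089, 70951, 4785, 323, 22, 1, 0, 0],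
  [359, 71, 473979663, 36978935, 2954174, 241655, 20220, 1727, 150, 13, 1, 0],
  [392, 360, 291554224, 19412804, 1294084, 86368, 5771, 386, 26, 2, 0, 0],
  [361, 91, 462398816, 34882314, 2688259, 211862, 17077, 1407, 118, 10, 1, 0],
  [392, 362, 106945039, 6899204, 445141, 28725, 1854, 120, 8, 0, 0, 0],
  [363, 52, 708975527, 57922592, 4866818, 419568, 36993, 3324, 303, 28, 3, 0],
  [364, 130, 585314674, 48068246, 4048974, 349118, 30728, 2752, 250, 23, 2, 0],
  [392, 365, 192097705, 13005959, 881315, 59771, 4057, 276, 19, 1, 0, 0],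
  [366, 44, 665410783, 52507788, 4261539, 355345, 30372, 2653, 236, 21, 2, 0],
  [392, 367, 353807438, 23846173, 1609807, 108852, 7372, 500, 34, 2, 0, 0],
  [392, 368, 205390496, 13722840, 917545, 61396, 4111, 276, 18, 1, 0, 0],
  [369, 118, 678719061, 55984378, 4742680, 411618, 36484, 3291, 301, 28, 3, 0],
  [370, 52, 488738038, 36568745, 2796201, 218768, 17518, 1435, 120, 10, 1, 0],
  [371, 49, 626189566, 52315463, 4481599, 392644, 35073, 3184, 293, 27, 3, 0],
  [86, 392, 299253991, 28254711, 2669120, 252273, 23856, 2257, 214, 20, 2, 0],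
  [66, 372, 553924187, 49225686, 4452483, 408930, 38047, 3579, 340, 32, 3, 0],
  [373, 392, 288757432, 30211494, 3166230, 332366, 34943, 3679, 388, 41, 4, 0],
  [116, 374, 692165110, 64068806, 6046169, 580042, 56420, 5551, 551, 55, 6, 1],
  [375, 392, 221128177, 23761416, 2553541, 274445, 29499, 3171, 341, 37, 4, 0],
  [376, 392, 251633215, 26260825, 2745131, 287413, 30138, 3165, 333, 35, 4, 0],
  [79, 392, 577219687, 57652521, 5781171, 582022, 58828, 5969, 608, 62, 6, 1],
  [377, 392, 483574054, 48718335, 4924388, 499392, 50810, 5186, 531, 55, 6, 1],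
  [86, 378, 458244854, 39534997, 3469485, 309064, 27886, 2543, 234, 22, 2, 0],
  [379, 392, 455632192, 46649396, 4789346, 493053, 50896, 5268, 547, 57, 6, 1],
  [116, 380, 842940875, 74048381, 6706727, 623767, 59314, 5743, 564, 56, 6, 1],
  [66, 381, 488071987, 44589653, 4126103, 385953, 36430, 3465, 332, 32, 3, 0],
  [64, 392, 577238112, 57654769, 5781436, 582052, 58831, 5970, 608, 62, 6, 1],
  [382, 392, 221093017, 23757687, 2553146, 274403, 29495, 3171, 341, 37, 4, 0],
  [76, 392, 560666147, 55766978, 5568189, 558122, 56160, 5673, 575, 59, 6, 1],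
  [392, 21, 384636992, 26053012, 1767777, 120160, 8182, 558, 38, 3, 0, 0],
  [383, 91, 462398816, 34882314, 2688259, 211862, 17077, 1407, 118, 10, 1, 0],
  [392, 29, 384495411, 26043667, 1767160, 120119, 8179, 558, 38, 3, 0, 0],
  [392, 52, 352825902, 24025628, 1638595, 111931, 7658, 525, 36, 2, 0, 0],
  [384, 49, 403085065, 30679784, 2383278, 189121, 15331, 1269, 107, 9, 1, 0],
  [385, 118, 778212670, 66563839, 5867630, 531239, 49203, 4644, 445, 43, 4, 0],
  [392, 44, 384625884, 26052220, 1767720, 120156, 8182, 558, 38, 3, 0, 0],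
  [386, 61, 731714104, 59467961, 4974141, 427219, 37555, 3366, 307, 28, 3, 0],
  [387, 29, 741805097, 59999568, 4996112, 427362, 37432, 3345, 304, 28, 3, 0],
  [392, 388, 225711519, 14777389, 967744, 63393, 4154, 272, 18, 1, 0, 0],
  [392, 80, 352769703, 24021602, 1638307, 111910, 7656, 525, 36, 2, 0, 0],
  [389, 392, 221128177, 23761416, 2553541, 274445, 29499, 3171, 341, 37, 4, 0],
  [390, 392, 199911448, 21447915, 2301276, 246938, 26500, 2844, 305, 33, 4, 0],
  [64, 391, 736212414, 68933863, 6581716, 638837, 62861, 6256, 628, 64, 6, 1],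
  [90, 392, 582923584, 58274941, 5849100, 589436, 59637, 6058, 618, 63, 6, 1],
  [94, 392, 579206896, 58070273, 5845013, 590646, 59919, 6102, 624, 64, 7, 1],
  [28, 392, 533262023, 52795470, 5246363, 523297, 52394, 5266, 531, 54, 5, 1],
  [392, 52, 352825902, 24025628, 1638595, 111931, 7658, 525, 36, 2, 0, 0],
  [392, 108, 319040834, 21861444, 1499986, 103055, 7090, 488, 34, 2, 0, 0],
  [392, 96, 384585643, 26049728, 1767569, 120147, 8181, 558, 38, 3, 0, 0]]

set_option maxRecDepth 20000 in
/-- The longest relevant suffix remembered by each state of `tableU`. -/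
def nameU : List Word := List.map (ofCode 30) [
  0, 1, 2, 11, 12, 21, 22, 111, 112, 121, 122, 211, 212, 221, 222, 1111, 1112, 1122, 1211, 1212,
  1221, 1222, 2111, 2112, 2121, 2122, 2211, 2212, 2221, 2222, 11111, 11112, 11121, 11221, 12111,
  12121, 12211, 12212, 12222, 21111, 21112, 21122, 21211, 21221, 21222, 22111, 22112, 22122, 22211,
  22212, 22221, 111111, 111112, 111122, 111212, 112211, 112212, 121111, 121112, 121211, 122111,
  122112, 122122, 122221, 211111, 211112, 211121, 211122, 211221, 211222, 212111, 212212, 212222,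
  221111, 221121, 221221, 222111, 222121, 222211, 1111111, 1111112, 1111121, 1111221, 1111222,
  1112121, 1122111, 1122121, 1211112, 1211121, 1212111, 1221111, 1221112, 1221121, 1221221,
  1222211, 2111111, 2111122, 2111212, 2111221, 2112211, 2112212, 2112221, 2121112, 2122122,
  2122221, 2211112, 2211212, 2212211, 2221112, 2221211, 2222111, 2222112, 11111111, 11111122,
  11111212, 11112212, 11112221, 11121211, 11221112, 11221211, 12111122, 12121111, 12211112,
  12211122, 12211212, 12212211, 12222111, 21111112, 21111221, 21112122, 21112212, 21122111,
  21122121, 21122211, 21221221, 21222211, 22111121, 22112121, 22122111, 22211121, 22212111,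
  22221111, 22221112, 22221121, 111111112, 111111221, 111122121, 111122211, 112211121, 112212111,
  121111221, 122111121, 122111221, 122112121, 122122111, 122221111, 211111122, 211112211,
  211112212, 211121221, 211122122, 211221112, 211221211, 211222112, 212212211, 212222111,
  221111212, 221121211, 221221112, 222111212, 222211112, 222211122, 222211212, 1111111122,
  1111112212, 1111221211, 1111222112, 1122111212, 1122121112, 1211112211, 1221111212, 1221112212,
  1221121211, 1221221112, 1222211112, 2111111221, 2111122111, 2111122121, 2111212211, 2111221221,
  2112211121, 2112212111, 2112221121, 2122122111, 2122221111, 2211112121, 2211212111, 2212211121,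
  2221112122, 2222111121, 2222111221, 2222112121, 11111111221, 11111122121, 11112212111,
  11112221121, 11221112122, 11221211122, 12111122111, 12211112121, 12211122121, 12211212111,
  12212211121, 12222111121, 21111112212, 21111221112, 21111221211, 21112122111, 21112212211,
  21122111212, 21122211212, 21221221112, 21222211112, 22111121211, 22112121111, 22122111212,
  22211121221, 22221111212, 22221112212, 22221121211, 111111112212, 111111221211, 111122121112,
  111122211212, 112211121221, 112212111221, 121111221112, 122111121211, 122111221211, 122112121111,
  122122111212, 122221111212, 211111122121, 211112211121, 211112212111, 211121221111, 211122122111,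
  211221112122, 211222112121, 212212211121, 212222111121, 221111212112, 221121211112, 221221112122,
  222211112121, 222211122121, 222211212111, 1111111122121, 1111112212111, 1111221211122,
  1111222112121, 1122111212211, 1122121112211, 1211112211121, 1221111212112, 1221112212111,
  1221121211112, 1221221112122, 1222211112121, 2111111221211, 2111122111212, 2111221221112,
  2112211121221, 2112221121211, 2122122111212, 2122221111212, 2211112121122, 2211212111122,
  2212211121221, 2222111121211, 2222111221211, 2222112121111, 11111111221211, 11111122121112,
  11112212111221, 11112221121211, 11221112122111, 12111122111212, 12211122121112, 12212211121221,
  12222111121211, 21111112212111, 21111221112122, 21112212211121, 21122211212111, 21221221112122,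
  21222211112121, 22122111212211, 22221111212112, 22221112212111, 22221121211112, 111111112212111,
  111111221211122, 111122211212111, 121111221112122, 122111221211122, 122122111212211,
  122221111212112, 211111122121112, 211112211121221, 211122122111212, 211222112121111,
  212212211121221, 212222111121211, 221221112122111, 222211112121122, 222211122121112,
  222211212111122, 1111111122121112, 1111112212111221, 1111222112121111, 1211112211121221,
  1221112212111221, 1221221112122111, 1222211112121122, 2111111221211122, 2111122111212211,
  2111221221112122, 2112221121211112, 2122122111212211, 2122221111212112, 2212211121221111,
  2222111121211222, 2222111221211122, 2222112121111222, 11111111221211122, 11111122121112212,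
  11112221121211112, 12111122111212211, 12211122121112211, 12212211121221111, 12222111121211222,
  21111112212111221, 21111221112122111, 21112212211121221, 21122211212111122, 21221221112122111,
  21222211112121122, 22122111212211111, 22221112212111221, 111111112212111221, 111111221211122122,
  111122211212111122, 121111221112122111, 122111221211122111, 122122111212211111,
  122221111212112221, 211111122121112212, 211112211121221112, 211122122111212211,
  211222112121111222, 212212211121221111, 212222111121211222, 221221112122111111,
  222211122121112211, 1111111122121112212, 1111112212111221221, 1111222112121111222,
  1211112211121221112, 1221112212111221111, 1221221112122111111, 1222211112121122211,
  2111122111212211122, 2111221221112122111, 2112221121211112222, 2122122111212211111,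
  2122221111212112221, 2222111221211122111, 11111111221211122122, 11111122121112212211,
  11112221121211112222, 12111122111212211122, 12212211121221111111, 21112212211121221111,
  21222211112121122211, 22221112212111221111, 111111221211122122111, 111122211212111122221,
  121111221112122111222, 211122122111212211111, 212222111121211222111, 222211122121112211112]

/-- Words that force a large Markov value. -/
def badU : List Word := List.map (ofCode 30) [
  21212, 12111212, 12121112, 21112121, 21211121, 211121222, 111212111, 111112121, 222121112,
  121211111, 21122121112, 21112122112, 222111212211, 112212111222, 2111212211112, 2111122121112,
  12211112121122, 22111121211221, 11221211122112, 12211212111122, 22112121111221, 21122111212211,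
  112211121221111, 111122121112211, 22221111212112222, 22221121211112222, 2212211121221111112,
  2111111221211122122, 21221221112122111111, 11111122121112212212, 12211122121112211112,
  21111221112122111221, 12222111121211222112, 21122211212111122221, 122122111212211111111,
  111111112212111221221, 1111112212111221221112, 2111221221112122111111, 2222111221211122111121,
  2122221111212112221111, 1211112211121221112222, 1111222112121111222212]

set_option maxRecDepth 20000 in
/-- Transition table of an automaton rejecting `badL`. -/
def tableL : Table := List.map ofEntries [
  [0, 1, 983057277, 86334974, 7842903, 733536, 70279, 6865, 681, 68, 7, 1],
  [2, 3, 891038248, 74750695, 6483050, 579373, 53128, 4977, 474, 46, 4, 0],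
  [4, 5, 781726666, 73427851, 7036087, 685595, 67734, 6768, 683, 69, 7, 1],
  [6, 7, 971741191, 83509072, 7432090, 682112, 64244, 6179, 604, 60, 6, 1],
  [8, 9, 984738433, 85350554, 7657974, 708137, 67149, 6498, 639, 64, 6, 1],
  [406, 10, 411651549, 27863942, 1889412, 128346, 8734, 595, 41, 3, 0, 0],
  [11, 12, 911449717, 82026280, 7604236, 722903, 70155, 6922, 692, 70, 7, 1],
  [13, 14, 970163181, 83341408, 7414082, 680167, 64033, 6156, 602, 60, 6, 1],
  [15, 16, 948934261, 84628146, 7785893, 735596, 71034, 6981, 696, 70, 7, 1],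
  [17, 18, 945570914, 80687451, 7127450, 649197, 60686, 5795, 563, 55, 6, 1],
  [19, 20, 981992883, 84610232, 7550470, 694848, 65615, 6327, 620, 62, 6, 1],
  [21, 22, 987226922, 85796872, 7719155, 715730, 68047, 6601, 651, 65, 7, 1],
  [23, 24, 715744082, 56540265, 4594762, 383683, 32844, 2873, 256, 23, 2, 0],
  [25, 26, 909204805, 81894432, 7597664, 722733, 70176, 6927, 693, 70, 7, 1],
  [27, 28, 969773460, 83303708, 7410458, 679820, 64000, 6153, 602, 60, 6, 1],
  [29, 30, 1000000000, 87417376, 7912162, 737980, 70565, 6883, 682, 68, 7, 1],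
  [31, 32, 785914072, 63514655, 5284605, 451705, 39538, 3531, 321, 29, 3, 0],
  [4, 33, 870245982, 79315157, 7427652, 711638, 69466, 6883, 690, 70, 7, 1],
  [34, 35, 969414022, 83266349, 7406705, 679451, 63964, 6150, 601, 60, 6, 1],
  [36, 37, 927802395, 83141668, 7681289, 728312, 70542, 6950, 694, 70, 7, 1],
  [38, 39, 970170609, 83342817, 7414259, 680187, 64035, 6157, 602, 60, 6, 1],
  [40, 41, 957245296, 84955284, 7784403, 733049, 70603, 6924, 689, 69, 7, 1],
  [42, 18, 939017821, 79977990, 7050642, 640881, 59786, 5697, 552, 54, 5, 1],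
  [43, 406, 493780289, 50477550, 5174995, 532055, 54855, 5671, 588, 61, 6, 1],
  [44, 20, 981462134, 84558067, 7545343, 694344, 65565, 6322, 620, 62, 6, 1],
  [45, 46, 987121187, 85716847, 7705492, 713873, 67817, 6574, 648, 65, 7, 1],
  [47, 48, 710542890, 56027198, 4544285, 378726, 32358, 2825, 251, 23, 2, 0],
  [49, 50, 908524719, 81825420, 7590628, 722013, 70101, 6919, 692, 70, 7, 1],
  [51, 28, 969843503, 83310416, 7411100, 679882, 64006, 6154, 602, 60, 6, 1],
  [52, 53, 983149165, 86340160, 7843120, 733534, 70277, 6864, 681, 68, 7, 1],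
  [54, 55, 930632622, 79058527, 6950335, 629972, 58601, 5569, 538, 53, 5, 1],
  [56, 406, 611567059, 61353739, 6179295, 624792, 63419, 6462, 661, 68, 7, 1],
  [57, 58, 974953378, 83856650, 7469726, 686189, 64686, 6227, 610, 60, 6, 1],
  [59, 10, 621713635, 47448927, 3715971, 298751, 24636, 2080, 179, 16, 1, 0],
  [60, 61, 907731817, 81743713, 7582156, 721130, 70009, 6910, 691, 70, 7, 1],
  [62, 28, 970149366, 83339385, 7413847, 680142, 64031, 6156, 602, 60, 6, 1],
  [63, 22, 989820443, 86079546, 7749965, 719088, 68413, 6641, 655, 65, 7, 1],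
  [64, 65, 750644065, 59958227, 4929468, 416457, 36053, 3187, 287, 26, 2, 0],
  [66, 26, 909263205, 81900805, 7598360, 722809, 70184, 6928, 693, 70, 7, 1],
  [67, 28, 969706095, 83297257, 7409840, 679761, 63994, 6153, 602, 60, 6, 1],
  [68, 69, 992708965, 86951449, 7882374, 736074, 70443, 6875, 682, 68, 7, 1],
  [70, 71, 816194523, 66739100, 5627485, 488135, 43407, 3942, 364, 34, 3, 0],
  [4, 72, 859800728, 78625433, 7382108, 708631, 69268, 6870, 689, 70, 7, 1],
  [73, 9, 793137587, 64787195, 5450866, 471226, 41717, 3768, 346, 32, 3, 0],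
  [74, 37, 926945623, 83063095, 7674083, 727652, 70482, 6945, 694, 70, 7, 1],
  [75, 76, 955422880, 84924327, 7791772, 734540, 70810, 6950, 692, 70, 7, 1],
  [77, 18, 941516014, 80248451, 7079922, 644051, 60129, 5734, 556, 55, 5, 1],
  [78, 406, 485176105, 49679006, 5100883, 525177, 54217, 5612, 582, 61, 6, 1],
  [79, 20, 981760015, 84587344, 7548220, 694627, 65593, 6325, 620, 62, 6, 1],
  [80, 81, 986053683, 85629535, 7698151, 713242, 67761, 6569, 647, 65, 7, 1],
  [47, 82, 710505255, 56024729, 4544123, 378715, 32357, 2825, 251, 23, 2, 0],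
  [83, 50, 908638152, 81836571, 7591724, 722121, 70112, 6920, 692, 70, 7, 1],
  [84, 85, 983009073, 86332969, 7842917, 733554, 70282, 6865, 681, 68, 7, 1],
  [2, 86, 891335439, 74769651, 6484259, 579450, 53133, 4977, 474, 46, 4, 0],
  [4, 87, 845996191, 77713602, 7321879, 704652, 69005, 6853, 688, 70, 7, 1],
  [88, 7, 970065122, 83330041, 7412944, 680063, 64024, 6156, 602, 60, 6, 1],
  [89, 9, 984733302, 85350078, 7657930, 708133, 67149, 6498, 639, 64, 6, 1],
  [11, 90, 916544807, 82360935, 7626217, 724347, 70250, 6928, 692, 70, 7, 1],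
  [38, 14, 970199052, 83344696, 7414383, 680195, 64036, 6157, 602, 60, 6, 1],
  [91, 406, 341301197, 35827380, 3767294, 396781, 41855, 4422, 468, 50, 5, 1],
  [92, 22, 984823357, 85534904, 7690603, 712618, 67708, 6565, 647, 65, 6, 1],
  [47, 93, 710444354, 56020733, 4543861, 378698, 32356, 2825, 251, 23, 2, 0],
  [94, 26, 909134167, 81886722, 7596823, 722642, 70165, 6926, 693, 70, 7, 1],
  [40, 95, 961375420, 85220364, 7801416, 734141, 70673, 6929, 689, 69, 7, 1],
  [96, 406, 550199615, 55707527, 5659806, 576996, 59021, 6057, 624, 64, 7, 1],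
  [97, 20, 981383101, 84550299, 7544579, 694269, 65558, 6321, 620, 62, 6, 1],
  [45, 98, 987214170, 85722781, 7705870, 713898, 67818, 6574, 648, 65, 7, 1],
  [99, 50, 908415621, 81814695, 7589573, 721909, 70091, 6918, 692, 70, 7, 1],
  [100, 53, 983130568, 86338434, 7842960, 733519, 70275, 6864, 681, 68, 7, 1],
  [101, 55, 913552710, 77213224, 6750970, 608433, 56274, 5317, 511, 50, 5, 0],
  [56, 102, 660386861, 64844547, 6428902, 642640, 64695, 6553, 667, 68, 7, 1],
  [103, 58, 974332092, 83789301, 7462426, 685398, 64600, 6218, 609, 60, 6, 1],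
  [104, 10, 596976984, 45076286, 3488397, 276923, 22543, 1879, 160, 14, 1, 0],
  [105, 106, 643170542, 63705367, 6352463, 637272, 64282, 6517, 664, 68, 7, 1],
  [107, 22, 988425658, 85927525, 7733395, 717282, 68216, 6620, 653, 65, 7, 1],
  [68, 108, 995727889, 87144211, 7894682, 736860, 70493, 6879, 682, 68, 7, 1],
  [109, 32, 807465856, 65800944, 5527143, 477434, 42267, 3820, 351, 33, 3, 0],
  [4, 110, 863782709, 78888381, 7399472, 709777, 69343, 6875, 690, 70, 7, 1],
  [111, 9, 779150233, 63303441, 5293472, 454530, 39946, 3580, 326, 30, 3, 0],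
  [112, 37, 927426483, 83107194, 7678127, 728022, 70516, 6948, 694, 70, 7, 1],
  [113, 114, 954314472, 84804321, 7778744, 733124, 70656, 6933, 690, 69, 7, 1],
  [115, 18, 940609563, 80150316, 7069298, 642901, 60004, 5721, 555, 55, 5, 1],
  [116, 20, 981671049, 84578600, 7547361, 694543, 65585, 6324, 620, 62, 6, 1],
  [117, 81, 986236790, 85646318, 7699690, 713383, 67774, 6570, 647, 65, 7, 1],
  [118, 119, 983115737, 86338403, 7843068, 733539, 70278, 6864, 681, 68, 7, 1],
  [2, 120, 890831985, 74737538, 6482210, 579319, 53125, 4977, 474, 46, 4, 0],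
  [121, 7, 972438296, 83584639, 7440282, 683000, 64340, 6190, 605, 60, 6, 1],
  [122, 10, 564281914, 41944104, 3188334, 248177, 19789, 1615, 135, 11, 1, 0],
  [123, 124, 908773213, 81839448, 7590953, 721938, 70083, 6916, 692, 70, 7, 1],
  [105, 16, 948925920, 84627261, 7785799, 735586, 71033, 6981, 696, 70, 7, 1],
  [125, 24, 727792297, 57719517, 4710184, 394981, 33950, 2981, 267, 24, 2, 0],
  [126, 9, 546299405, 40726587, 3104261, 242229, 19356, 1583, 132, 11, 1, 0],
  [40, 127, 953417665, 84709606, 7768634, 732037, 70538, 6920, 689, 69, 7, 1],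
  [128, 20, 981527083, 84564451, 7545970, 694406, 65572, 6323, 620, 62, 6, 1],
  [45, 129, 987008718, 85709671, 7705034, 713844, 67815, 6574, 648, 65, 7, 1],
  [130, 71, 825898674, 67769788, 5736955, 499762, 44642, 4073, 378, 36, 3, 0],
  [131, 9, 884868474, 74544648, 6488774, 581629, 53461, 5017, 479, 46, 5, 0],
  [132, 37, 926818042, 83051395, 7673010, 727553, 70473, 6944, 694, 70, 7, 1],
  [133, 18, 941734141, 80272066, 7082479, 644328, 60159, 5737, 557, 55, 5, 1],
  [134, 81, 985877574, 85613393, 7696672, 713106, 67749, 6568, 647, 65, 7, 1],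
  [135, 85, 982978841, 86329762, 7842577, 733518, 70278, 6865, 681, 68, 7, 1],
  [4, 136, 818764086, 75899888, 7201082, 696607, 68469, 6817, 686, 70, 7, 1],
  [406, 137, 118390227, 7635115, 492466, 31769, 2050, 132, 9, 1, 0, 0],
  [11, 138, 915554685, 82295903, 7621945, 724067, 70232, 6927, 692, 70, 7, 1],
  [139, 406, 301248330, 31906221, 3383414, 359200, 38176, 4062, 433, 46, 5, 1],
  [29, 140, 999986671, 87416425, 7912094, 737975, 70565, 6883, 682, 68, 7, 1],
  [406, 141, 54238734, 3467414, 221668, 14171, 906, 58, 4, 0, 0, 0],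
  [40, 142, 959154256, 85077805, 7792267, 733553, 70636, 6926, 689, 69, 7, 1],
  [143, 55, 920636030, 77978461, 6833641, 617364, 57239, 5421, 522, 51, 5, 1],
  [56, 144, 646014130, 63819679, 6355822, 637429, 64324, 6527, 666, 68, 7, 1],
  [145, 10, 606407275, 45980688, 3575132, 285241, 23341, 1956, 167, 15, 1, 0],
  [105, 406, 620813852, 62104635, 6237851, 629066, 63694, 6475, 661, 68, 7, 1],
  [146, 22, 989208476, 86012846, 7742695, 718296, 68327, 6632, 654, 65, 7, 1],
  [68, 147, 994003249, 87034091, 7887651, 736411, 70465, 6877, 682, 68, 7, 1],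
  [109, 148, 807404619, 65797038, 5526894, 477418, 42266, 3820, 351, 33, 3, 0],
  [4, 149, 862337876, 78792973, 7393171, 709361, 69316, 6873, 690, 70, 7, 1],
  [150, 37, 927282868, 83094023, 7676919, 727912, 70506, 6947, 694, 70, 7, 1],
  [151, 114, 954612581, 84836851, 7782294, 733511, 70698, 6937, 690, 69, 7, 1],
  [0, 152, 983022086, 86332453, 7842723, 733523, 70278, 6865, 681, 68, 7, 1],
  [2, 153, 891233510, 74763149, 6483844, 579424, 53131, 4977, 474, 46, 4, 0],
  [154, 7, 971257372, 83456626, 7426405, 681496, 64177, 6172, 604, 60, 6, 1],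
  [11, 155, 912560670, 82099252, 7609029, 723218, 70176, 6923, 692, 70, 7, 1],
  [156, 406, 248301535, 26706617, 2872790, 309054, 33251, 3578, 385, 41, 4, 0],
  [157, 22, 986537158, 85721693, 7710961, 714837, 67950, 6591, 650, 65, 7, 1],
  [47, 24, 710416879, 56018931, 4543742, 378691, 32356, 2825, 251, 23, 2, 0],
  [158, 406, 513239476, 52282769, 5342464, 547591, 56297, 5805, 600, 62, 6, 1],
  [159, 406, 244291154, 26268744, 2824982, 303834, 32682, 3516, 378, 41, 4, 0],
  [109, 71, 807200988, 65784049, 5526065, 477365, 42263, 3820, 351, 33, 3, 0],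
  [160, 37, 927050469, 83072711, 7674965, 727732, 70489, 6945, 694, 70, 7, 1],
  [161, 18, 941252173, 80219887, 7076830, 643716, 60093, 5730, 556, 55, 5, 1],
  [56, 162, 675894887, 65949658, 6507653, 648252, 65095, 6582, 669, 68, 7, 1],
  [105, 163, 789734447, 74089972, 7088280, 689412, 67976, 6779, 682, 69, 7, 1],
  [164, 22, 988217963, 85904887, 7730928, 717013, 68187, 6617, 652, 65, 7, 1],
  [4, 165, 864130391, 78911340, 7400988, 709877, 69350, 6876, 690, 70, 7, 1],
  [166, 114, 954027757, 84773034, 7775330, 732751, 70615, 6928, 690, 69, 7, 1],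
  [118, 167, 983067417, 86334942, 7842821, 733521, 70277, 6864, 681, 68, 7, 1],
  [168, 10, 499632560, 35950306, 2632635, 196656, 15012, 1172, 94, 8, 1, 0],
  [169, 406, 278538589, 29100426, 3045287, 319188, 33506, 3522, 371, 39, 4, 0],
  [170, 24, 725450994, 57490343, 4687752, 392785, 33735, 2960, 264, 24, 2, 0],
  [171, 9, 481611442, 34729207, 2548229, 190678, 14577, 1140, 91, 7, 1, 0],
  [54, 172, 930600325, 79056408, 6950196, 629963, 58601, 5569, 538, 53, 5, 1],
  [173, 406, 127302468, 13698671, 1474153, 158646, 17074, 1838, 198, 21, 2, 0],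
  [174, 71, 820679827, 67215482, 5678081, 493509, 43977, 4002, 371, 35, 3, 0],
  [4, 175, 830057768, 76652233, 7251200, 699946, 68691, 6832, 687, 70, 7, 1],
  [406, 176, 83565874, 5348817, 342365, 21914, 1403, 90, 6, 0, 0, 0],
  [177, 406, 316517821, 33401583, 3529857, 373541, 39580, 4199, 446, 47, 5, 1],
  [40, 178, 960400876, 85157816, 7797402, 733883, 70657, 6928, 689, 69, 7, 1],
  [179, 55, 916589497, 77541297, 6786412, 612262, 56688, 5362, 516, 50, 5, 0],
  [180, 58, 974809738, 83841079, 7468038, 686006, 64666, 6225, 609, 60, 6, 1],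
  [181, 10, 602985568, 45652525, 3543660, 282222, 23051, 1928, 165, 14, 1, 0],
  [182, 22, 988974677, 85987364, 7739917, 717993, 68294, 6628, 654, 65, 7, 1],
  [68, 183, 994477902, 87064398, 7889586, 736534, 70472, 6877, 682, 68, 7, 1],
  [2, 184, 890952863, 74745248, 6482702, 579351, 53127, 4977, 474, 46, 4, 0],
  [185, 7, 972199207, 83558721, 7437472, 682696, 64307, 6186, 605, 60, 6, 1],
  [11, 186, 910678670, 81975634, 7600909, 722685, 70141, 6921, 692, 70, 7, 1],
  [187, 24, 718371147, 56797363, 4619923, 386146, 33085, 2897, 258, 23, 2, 0],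
  [406, 9, 396132259, 26872141, 1826022, 124294, 8475, 579, 40, 3, 0, 0],
  [40, 188, 956146860, 84884780, 7779878, 732758, 70585, 6923, 689, 69, 7, 1],
  [189, 9, 824772935, 68146312, 5807546, 509099, 45739, 4195, 391, 37, 4, 0],
  [406, 140, 389747369, 26465469, 1800125, 122645, 8370, 572, 39, 3, 0, 0],
  [190, 22, 988596342, 85946128, 7735423, 717503, 68241, 6623, 653, 65, 7, 1],
  [4, 191, 863362161, 78860610, 7397638, 709656, 69335, 6875, 690, 70, 7, 1],
  [406, 192, 155957783, 10111630, 655722, 42531, 2759, 179, 12, 1, 0, 0],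
  [406, 32, 408653553, 27671989, 1877121, 127559, 8683, 592, 40, 3, 0, 0],
  [40, 193, 958823506, 85056577, 7790904, 733466, 70630, 6926, 689, 69, 7, 1],
  [194, 10, 607230668, 46059656, 3582706, 285967, 23410, 1962, 168, 15, 1, 0],
  [68, 195, 993546736, 87004942, 7885790, 736292, 70457, 6876, 682, 68, 7, 1],
  [2, 196, 891116269, 74755671, 6483367, 579393, 53129, 4977, 474, 46, 4, 0],
  [197, 406, 143191542, 15529939, 1684335, 182681, 19814, 2149, 233, 25, 3, 0],
  [198, 37, 446119966, 33825110, 2618110, 207069, 16737, 1381, 116, 10, 1, 0],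
  [199, 406, 509458041, 51932020, 5309931, 544573, 56017, 5779, 598, 62, 6, 1],
  [200, 406, 139118393, 15085399, 1635818, 177386, 19236, 2086, 226, 25, 3, 0],
  [201, 7, 969988775, 83322537, 7412207, 679990, 64017, 6155, 602, 60, 6, 1],
  [406, 202, 203081210, 13749596, 931705, 63189, 4289, 291, 20, 1, 0, 0],
  [56, 203, 667554758, 65355363, 6465305, 645235, 64880, 6566, 668, 68, 7, 1],
  [204, 10, 526445560, 38434026, 2862704, 217968, 16986, 1355, 111, 9, 1, 0],
  [205, 406, 196200870, 21027741, 2253811, 241588, 25898, 2776, 298, 32, 3, 0],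
  [206, 9, 506271654, 37013476, 2759820, 210278, 16392, 1308, 107, 9, 1, 0],
  [207, 71, 823608887, 67526583, 5711124, 497019, 44350, 4042, 375, 35, 3, 0],
  [4, 208, 823605960, 76222446, 7222570, 698038, 68564, 6824, 686, 70, 7, 1],
  [11, 209, 916315893, 82345900, 7625229, 724282, 70246, 6928, 692, 70, 7, 1],
  [210, 406, 310977421, 32859035, 3476727, 368338, 39071, 4149, 441, 47, 5, 1],
  [40, 211, 960028557, 85133920, 7795868, 733785, 70650, 6927, 689, 69, 7, 1],
  [212, 55, 917703180, 77661612, 6799410, 613666, 56840, 5378, 518, 51, 5, 0],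
  [213, 7, 971540910, 83487362, 7429737, 681857, 64216, 6176, 604, 60, 6, 1],
  [11, 214, 912179641, 82074224, 7607385, 723110, 70169, 6923, 692, 70, 7, 1],
  [215, 24, 713920791, 56361829, 4577299, 381974, 32677, 2857, 254, 23, 2, 0],
  [216, 406, 498023355, 50871317, 5211538, 535446, 55170, 5700, 591, 61, 6, 1],
  [217, 71, 813613605, 66465019, 5598379, 485044, 43078, 3907, 360, 34, 3, 0],
  [105, 218, 693728246, 67311836, 6609727, 655624, 65591, 6610, 670, 68, 7, 1],
  [40, 219, 959426067, 85095251, 7793386, 733625, 70640, 6927, 689, 69, 7, 1],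
  [220, 10, 605411317, 45885169, 3565972, 284362, 23256, 1948, 167, 15, 1, 0],
  [221, 406, 367464673, 37684998, 3874010, 399189, 41229, 4268, 443, 46, 5, 1],
  [222, 71, 819902695, 67132942, 5669315, 492578, 43879, 3992, 369, 35, 3, 0],
  [223, 406, 317851051, 33532138, 3542641, 374793, 39703, 4211, 447, 48, 5, 1],
  [224, 55, 915518378, 77425580, 6773911, 610911, 56542, 5346, 514, 50, 5, 0],
  [225, 7, 971924201, 83528911, 7434241, 682345, 64269, 6182, 605, 60, 6, 1],
  [406, 226, 228183843, 14956382, 980572, 64305, 4218, 277, 18, 1, 0, 0],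
  [227, 406, 216271133, 23211700, 2491456, 267447, 28712, 3083, 331, 36, 4, 0],
  [228, 9, 818625240, 67493309, 5738184, 501731, 44956, 4112, 382, 36, 3, 0],
  [406, 229, 221698642, 14542558, 954165, 62620, 4111, 270, 18, 1, 0, 0],
  [230, 124, 908649967, 81828146, 7589916, 721843, 70075, 6916, 691, 70, 7, 1],
  [125, 231, 484445993, 41795511, 3667863, 326736, 29480, 2688, 247, 23, 2, 0],
  [406, 232, 135754456, 8779400, 567873, 36738, 2377, 154, 10, 1, 0, 0],
  [233, 406, 186789951, 20175259, 2179284, 235417, 25433, 2748, 297, 32, 3, 0],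
  [406, 37, 313163715, 21548323, 1484489, 102390, 7070, 489, 34, 2, 0, 0],
  [234, 406, 179216406, 19357915, 2091062, 225893, 24404, 2637, 285, 31, 3, 0],
  [56, 235, 672235629, 65688915, 6489074, 646928, 65001, 6575, 669, 68, 7, 1],
  [236, 10, 511128044, 37015011, 2731247, 205790, 15858, 1251, 101, 8, 1, 0],
  [237, 24, 727250994, 57666532, 4704998, 394473, 33900, 2976, 266, 24, 2, 0],
  [238, 9, 497323849, 36184511, 2683021, 203163, 15733, 1247, 101, 8, 1, 0],
  [239, 71, 822734085, 67433668, 5701255, 495971, 44239, 4030, 373, 35, 3, 0],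
  [4, 240, 825381622, 76340736, 7230450, 698563, 68599, 6826, 686, 70, 7, 1],
  [11, 241, 911130534, 82005314, 7602859, 722813, 70149, 6921, 692, 70, 7, 1],
  [242, 24, 717470130, 56709184, 4611293, 385301, 33002, 2889, 257, 23, 2, 0],
  [243, 406, 490835423, 50204255, 5149632, 529701, 54637, 5651, 586, 61, 6, 1],
  [244, 9, 800035367, 65519018, 5528510, 479463, 42591, 3860, 356, 33, 3, 0],
  [56, 245, 656262260, 64550457, 6407933, 641145, 64589, 6546, 667, 68, 7, 1],
  [406, 246, 176752000, 11490984, 747204, 48597, 3161, 206, 13, 1, 0, 0],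
  [247, 71, 821318474, 67283314, 5685286, 494274, 44059, 4011, 371, 35, 3, 0],
  [248, 406, 314905175, 33243664, 3514393, 372027, 39432, 4185, 445, 47, 5, 1],
  [249, 37, 589992157, 47676474, 3951674, 335462, 29098, 2572, 231, 21, 2, 0],
  [56, 250, 666312837, 65266865, 6458999, 644785, 64848, 6564, 668, 68, 7, 1],
  [251, 9, 508424839, 37212964, 2778302, 211990, 16551, 1323, 108, 9, 1, 0],
  [4, 252, 821898161, 76108676, 7214991, 697534, 68531, 6821, 686, 70, 7, 1],
  [11, 253, 911741374, 82045437, 7605494, 722986, 70161, 6922, 692, 70, 7, 1],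
  [17, 406, 539275604, 53166655, 5260024, 522260, 52042, 5205, 522, 53, 5, 1],
  [406, 95, 345132284, 23614431, 1617979, 111012, 7627, 525, 36, 2, 0, 0],
  [105, 254, 683903828, 66611947, 6559867, 652072, 65338, 6592, 669, 68, 7, 1],
  [54, 406, 524061977, 51519644, 5081721, 502957, 49953, 4979, 498, 50, 5, 1],
  [255, 22, 986336521, 85699826, 7708578, 714578, 67922, 6588, 649, 65, 7, 1],
  [406, 20, 406616006, 27541696, 1868786, 127026, 8649, 590, 40, 3, 0, 0],
  [256, 406, 319637431, 33073165, 3429305, 356308, 37094, 3869, 404, 42, 4, 0],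
  [406, 257, 297827980, 19859368, 1325745, 88605, 5929, 397, 27, 2, 0, 0],
  [406, 258, 285750930, 19051242, 1271535, 84960, 5683, 381, 26, 2, 0, 0],
  [406, 259, 147093570, 9527032, 617167, 39988, 2591, 168, 11, 1, 0, 0],
  [260, 406, 161883685, 17522131, 1896661, 205311, 22225, 2406, 260, 28, 3, 0],
  [261, 406, 512365218, 52201677, 5334943, 546893, 56232, 5799, 600, 62, 6, 1],
  [262, 406, 164667368, 17808256, 1926004, 208312, 22532, 2437, 264, 29, 3, 0],
  [56, 263, 670837626, 65589296, 6481975, 646423, 64965, 6572, 669, 68, 7, 1],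
  [264, 10, 515343763, 37405498, 2767416, 209140, 16169, 1280, 104, 9, 1, 0],
  [265, 24, 714989313, 56466400, 4587533, 382976, 32775, 2866, 255, 23, 2, 0],
  [266, 406, 496568090, 50736265, 5199005, 534283, 55062, 5690, 590, 61, 6, 1],
  [267, 9, 788350248, 64279301, 5396983, 465509, 41111, 3703, 339, 31, 3, 0],
  [105, 268, 654195369, 64494255, 6408912, 641312, 64571, 6537, 665, 68, 7, 1],
  [406, 269, 108396762, 6978724, 449353, 28937, 1864, 120, 8, 0, 0, 0],
  [270, 406, 416772903, 42332722, 4311011, 440159, 45057, 4624, 476, 49, 5, 1],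
  [56, 271, 668575367, 65428091, 6470488, 645604, 64906, 6568, 668, 68, 7, 1],
  [272, 9, 503667211, 36772183, 2737465, 208207, 16200, 1290, 105, 9, 1, 0],
  [273, 406, 449117565, 45788128, 4680626, 479743, 49301, 5080, 525, 54, 6, 1],
  [406, 274, 132745969, 8581057, 554797, 35876, 2320, 150, 10, 1, 0, 0],
  [275, 406, 182717447, 19730788, 2130775, 230123, 24855, 2685, 290, 31, 3, 0],
  [276, 10, 507073433, 36639459, 2696462, 202568, 15560, 1223, 98, 8, 1, 0],
  [277, 24, 716433761, 56607760, 4601367, 384330, 32907, 2879, 257, 23, 2, 0],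
  [406, 278, 152954920, 9919335, 643407, 41742, 2709, 176, 11, 1, 0, 0],
  [40, 279, 955827349, 84864273, 7778561, 732674, 70579, 6923, 689, 69, 7, 1],
  [280, 37, 512602356, 40203631, 3230087, 265784, 22370, 1922, 168, 15, 1, 0],
  [17, 281, 707352477, 65091578, 6106128, 582296, 56303, 5507, 544, 54, 5, 1],
  [54, 282, 678637009, 62495508, 5861114, 558303, 53883, 5258, 518, 51, 5, 1],
  [283, 406, 346479633, 35662565, 3679098, 380405, 39419, 4093, 426, 44, 5, 0],
  [406, 284, 258041512, 17056002, 1128219, 74687, 4948, 328, 22, 1, 0, 0],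
  [285, 9, 823351604, 67995338, 5791509, 507395, 45558, 4176, 389, 37, 4, 0],
  [406, 286, 262509250, 17412930, 1156050, 76819, 5109, 340, 23, 2, 0, 0],
  [406, 287, 143707005, 9303733, 602444, 39017, 2527, 164, 11, 1, 0, 0],
  [288, 406, 168738559, 18252587, 1974498, 213605, 23109, 2500, 271, 29, 3, 0],
  [289, 406, 492561233, 50364417, 5164496, 531080, 54765, 5663, 587, 61, 6, 1],
  [290, 9, 797669601, 65268018, 5501879, 476638, 42291, 3829, 352, 33, 3, 0],
  [105, 291, 635518821, 63157756, 6313272, 634468, 64081, 6502, 663, 68, 7, 1],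
  [406, 292, 80980492, 5183912, 331847, 21243, 1360, 87, 6, 0, 0, 0],
  [293, 406, 254907320, 26787459, 2818900, 297029, 31337, 3310, 350, 37, 4, 0],
  [294, 90, 669997740, 55845799, 4774325, 417574, 37247, 3377, 310, 29, 3, 0],
  [406, 295, 138226825, 8942401, 578620, 37446, 2424, 157, 10, 1, 0, 0],
  [296, 406, 174981620, 18906879, 2043024, 220777, 23859, 2579, 279, 30, 3, 0],
  [297, 95, 721647870, 59449640, 5030783, 436237, 38639, 3484, 319, 29, 3, 0],
  [298, 406, 312515857, 32385927, 3362986, 349908, 36477, 3810, 399, 42, 4, 0],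
  [406, 299, 291343809, 19445616, 1299344, 86920, 5821, 390, 26, 2, 0, 0],
  [300, 406, 155290750, 16819533, 1821786, 197331, 21375, 2315, 251, 27, 3, 0],
  [301, 406, 494894214, 50580926, 5184589, 532945, 54938, 5679, 589, 61, 6, 1],
  [302, 406, 360413425, 36930580, 3793207, 390526, 40300, 4168, 432, 45, 5, 0],
  [303, 71, 812862871, 66385296, 5589913, 484145, 42983, 3897, 359, 34, 3, 0],
  [304, 406, 323913773, 33742283, 3521683, 368239, 38573, 4047, 425, 45, 5, 0],
  [406, 35, 406606598, 27541174, 1868758, 127024, 8649, 590, 40, 3, 0, 0],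
  [406, 305, 374037260, 25209643, 1701852, 115076, 7794, 529, 36, 2, 0, 0],
  [306, 37, 556033766, 44392798, 3634152, 304758, 26129, 2285, 203, 18, 2, 0],
  [17, 307, 611308091, 58310708, 5627378, 548494, 53916, 5339, 532, 53, 5, 1],
  [105, 308, 691456867, 67150029, 6598200, 654803, 65532, 6606, 670, 68, 7, 1],
  [54, 309, 622524337, 58543672, 5582799, 538703, 52503, 5161, 511, 51, 5, 1],
  [310, 406, 338462779, 34889332, 3604519, 373212, 38725, 4027, 420, 44, 5, 0],
  [406, 311, 268991325, 17826534, 1182441, 78503, 5217, 347, 23, 2, 0, 0],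
  [312, 9, 791155821, 64576946, 5428561, 468859, 41466, 3741, 343, 32, 3, 0],
  [105, 313, 650414134, 64223697, 6389553, 639927, 64471, 6530, 665, 68, 7, 1],
  [406, 314, 35677841, 2277270, 145355, 9278, 592, 38, 2, 0, 0, 0],
  [315, 406, 190136519, 20370320, 2182541, 233862, 25060, 2686, 288, 31, 3, 0],
  [316, 37, 407952860, 30284337, 2289631, 176596, 13910, 1119, 92, 8, 1, 0],
  [21, 406, 593888098, 59102978, 5904508, 592162, 59619, 6026, 611, 62, 6, 1],
  [317, 406, 325489958, 33637902, 3483799, 361566, 37602, 3918, 409, 43, 4, 0],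
  [406, 318, 278985931, 18574281, 1237907, 82589, 5516, 369, 25, 2, 0, 0],
  [68, 406, 610227788, 60949830, 6111859, 615319, 62194, 6311, 643, 66, 7, 1],
  [319, 37, 501079947, 39093245, 3123082, 255472, 21376, 1826, 159, 14, 1, 0],
  [54, 320, 692141333, 63444748, 5927838, 562994, 54213, 5281, 519, 51, 5, 1],
  [406, 321, 247510223, 16315141, 1076101, 71021, 4690, 310, 20, 1, 0, 0],
  [322, 9, 794948449, 64979317, 5471250, 473388, 41947, 3792, 348, 32, 3, 0],
  [323, 90, 578734568, 46895741, 3896602, 331496, 28806, 2549, 229, 21, 2, 0],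
  [56, 324, 655062501, 64464911, 6401833, 640710, 64558, 6543, 667, 68, 7, 1],
  [325, 95, 518997832, 39766220, 3118781, 250496, 20594, 1730, 148, 13, 1, 0],
  [13, 326, 891138616, 78282251, 7090192, 659431, 62706, 6071, 596, 59, 6, 1],
  [327, 406, 394188120, 40522923, 4175935, 431367, 44664, 4635, 482, 50, 5, 1],
  [406, 328, 174612396, 11354258, 738467, 48039, 3126, 203, 13, 1, 0, 0],
  [406, 329, 171250232, 11127556, 723197, 47011, 3057, 199, 13, 1, 0, 0],
  [406, 330, 238601266, 15621264, 1023006, 67013, 4391, 288, 19, 1, 0, 0],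
  [331, 37, 543062006, 43141049, 3513361, 293102, 25005, 2176, 193, 17, 2, 0],
  [17, 332, 637730421, 60190146, 5761064, 558003, 54592, 5387, 535, 54, 5, 1],
  [105, 333, 640003038, 63478681, 6336240, 636111, 64198, 6511, 663, 68, 7, 1],
  [406, 334, 71808868, 4595046, 294039, 18816, 1204, 77, 5, 0, 0, 0],
  [335, 406, 83703058, 9053244, 979192, 105909, 11455, 1239, 134, 14, 2, 0],
  [406, 90, 303499245, 20913691, 1442815, 99653, 6891, 477, 33, 2, 0, 0],
  [336, 406, 154221861, 16623297, 1791898, 193167, 20825, 2245, 242, 26, 3, 0],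
  [337, 37, 522071575, 41116312, 3318055, 274263, 23187, 2001, 176, 16, 1, 0],
  [54, 338, 662303191, 61346502, 5780287, 552618, 53483, 5230, 516, 51, 5, 1],
  [339, 406, 305267814, 31938910, 3347267, 351370, 36941, 3890, 410, 43, 5, 0],
  [406, 7, 406612650, 27541524, 1868778, 127025, 8649, 590, 40, 3, 0, 0],
  [17, 340, 585897996, 56500176, 5498374, 539302, 53261, 5292, 529, 53, 5, 1],
  [105, 341, 646064874, 63912480, 6367284, 638333, 64357, 6522, 664, 68, 7, 1],
  [342, 406, 446524044, 45505454, 4649817, 476385, 48935, 5040, 520, 54, 6, 1],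
  [406, 343, 105489855, 6787818, 436815, 28113, 1810, 116, 7, 0, 0, 0],
  [344, 406, 282612196, 29915965, 3170487, 336382, 35727, 3798, 404, 43, 5, 0],
  [345, 28, 784224805, 63430769, 5281838, 451804, 39573, 3536, 321, 30, 3, 0],
  [346, 95, 632700632, 50727268, 4175445, 352361, 30414, 2677, 240, 22, 2, 0],
  [347, 406, 411751643, 41791688, 4252698, 433872, 44379, 4551, 468, 48, 5, 1],
  [348, 406, 403742157, 41084637, 4191469, 428709, 43960, 4519, 466, 48, 5, 1],
  [13, 406, 563715191, 55810735, 5546019, 553189, 55387, 5567, 562, 57, 6, 1],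
  [349, 406, 373200278, 38500220, 3980997, 412579, 42853, 4461, 465, 49, 5, 1],
  [406, 350, 238583004, 15620045, 1022925, 67007, 4391, 288, 19, 1, 0, 0],
  [406, 351, 46555313, 2974694, 190071, 12145, 776, 50, 3, 0, 0, 0],
  [352, 406, 168584734, 18084031, 1940004, 208133, 22331, 2396, 257, 28, 3, 0],
  [406, 353, 133435474, 8846498, 586524, 38888, 2578, 171, 11, 1, 0, 0],
  [406, 354, 245968605, 16540153, 1113301, 75008, 5059, 341, 23, 2, 0, 0],
  [355, 406, 339236864, 35223617, 3664889, 382083, 39911, 4177, 438, 46, 5, 1],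
  [406, 356, 334627279, 22400828, 1501663, 100808, 6777, 456, 31, 2, 0, 0],
  [357, 95, 488837786, 36876797, 2841966, 223976, 18053, 1487, 125, 11, 1, 0],
  [406, 358, 113059671, 7293669, 470592, 30367, 1960, 127, 8, 1, 0, 0],
  [406, 359, 61259289, 3917943, 250580, 16026, 1025, 66, 4, 0, 0, 0],
  [297, 41, 717517746, 59184560, 5013769, 435145, 38569, 3479, 318, 29, 3, 0],
  [360, 406, 248033689, 26114356, 2752986, 290575, 30705, 3248, 344, 36, 4, 0],
  [361, 53, 451850416, 32648890, 2398809, 179611, 13730, 1073, 86, 7, 1, 0],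
  [49, 406, 612336894, 61391757, 6179328, 624429, 63346, 6451, 659, 68, 7, 1],
  [362, 406, 466602142, 47694875, 4888560, 502418, 51774, 5349, 554, 58, 6, 1],
  [363, 26, 661988895, 55306299, 4737805, 415091, 37078, 3366, 310, 29, 3, 0],
  [364, 90, 648895057, 53772330, 4570593, 397556, 35281, 3184, 291, 27, 3, 0],
  [365, 95, 598737709, 47443153, 3857880, 321653, 27444, 2390, 212, 19, 2, 0],
  [62, 406, 563671803, 55806759, 5545655, 553156, 55384, 5566, 562, 57, 6, 1],
  [366, 406, 109253650, 11776273, 1269396, 136837, 14751, 1590, 171, 18, 2, 0],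
  [406, 367, 269052173, 18447752, 1266287, 87016, 5986, 412, 28, 2, 0, 0],
  [125, 406, 316365267, 29870305, 2821739, 266698, 25220, 2386, 226, 21, 2, 0],
  [130, 368, 585595582, 52040241, 4707061, 432311, 40223, 3783, 359, 34, 3, 0],
  [369, 95, 543784475, 42143656, 3346816, 272368, 22692, 1932, 168, 15, 1, 0],
  [13, 370, 795664915, 71994681, 6676112, 632161, 60910, 5953, 589, 59, 6, 1],
  [371, 406, 233770849, 25119942, 2699537, 290136, 31186, 3352, 360, 39, 4, 0],
  [372, 406, 266020593, 27762312, 2902086, 303846, 31861, 3346, 352, 37, 4, 0],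
  [373, 406, 143797335, 15451446, 1660406, 178438, 19177, 2061, 222, 24, 3, 0],
  [374, 37, 396851870, 29255884, 2194350, 167768, 13092, 1043, 85, 7, 1, 0],
  [375, 406, 128329047, 13908056, 1507345, 163367, 17706, 1919, 208, 23, 2, 0],
  [376, 53, 749489537, 61232262, 5144884, 443538, 39106, 3514, 321, 30, 3, 0],
  [45, 406, 592717440, 58955002, 5886508, 590028, 59370, 5997, 608, 62, 6, 1],
  [377, 406, 559821435, 55976247, 5617527, 565822, 57201, 5804, 591, 60, 6, 1],
  [378, 406, 411665365, 42428966, 4383801, 454035, 47136, 4905, 511, 53, 6, 1],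
  [406, 379, 174248666, 11717052, 788422, 53088, 3577, 241, 16, 1, 0, 0],
  [125, 380, 644226423, 52370700, 4367819, 373067, 32547, 2891, 261, 24, 2, 0],
  [406, 58, 406627748, 27542533, 1868845, 127030, 8650, 590, 40, 3, 0, 0],
  [381, 406, 322746006, 33845046, 3555142, 374039, 39414, 4159, 440, 47, 5, 1],
  [382, 28, 558292047, 41538012, 3160261, 246189, 19644, 1604, 134, 11, 1, 0],
  [406, 53, 372998374, 25399262, 1732279, 118330, 8096, 555, 38, 3, 0, 0],
  [383, 26, 426132066, 32433954, 2519546, 199935, 16208, 1341, 113, 10, 1, 0],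
  [406, 384, 229439659, 15624491, 1065068, 72675, 4964, 339, 23, 2, 0, 0],
  [385, 406, 136171782, 14700765, 1587127, 171357, 18502, 1998, 216, 23, 3, 0],
  [406, 386, 204519629, 13445569, 884116, 58147, 3825, 252, 17, 1, 0, 0],
  [135, 406, 610187964, 60945362, 6111362, 615264, 62188, 6310, 643, 66, 7, 1],
  [387, 41, 901791738, 78922286, 7128046, 661640, 62834, 6079, 597, 59, 6, 1],
  [388, 53, 660530427, 52508728, 4289432, 359650, 30880, 2707, 241, 22, 2, 0],
  [125, 389, 414833864, 36894777, 3322848, 302446, 27770, 2568, 239, 22, 2, 0],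
  [390, 20, 785261264, 63530326, 5291532, 452756, 39667, 3546, 322, 30, 3, 0],
  [391, 53, 516669113, 38658402, 2955967, 231266, 18519, 1517, 127, 11, 1, 0],
  [392, 406, 246973225, 26561647, 2856968, 307327, 33063, 3557, 383, 41, 4, 0],
  [393, 406, 211342344, 22674302, 2432863, 261058, 28015, 3007, 323, 35, 4, 0],
  [125, 394, 548261953, 46050968, 3951631, 345658, 30742, 2773, 253, 23, 2, 0],
  [406, 395, 217134045, 14507467, 970007, 64906, 4346, 291, 20, 1, 0, 0],
  [2, 406, 483753923, 47166087, 4611506, 452170, 44467, 4386, 434, 43, 4, 0],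
  [68, 396, 904378253, 81237614, 7512714, 712155, 68895, 6775, 675, 68, 7, 1],
  [397, 406, 466543145, 47688627, 4887898, 502348, 51766, 5348, 554, 58, 6, 1],
  [406, 398, 238616363, 15622273, 1023074, 67017, 4391, 288, 19, 1, 0, 0],
  [74, 406, 613781908, 61514772, 6189594, 625262, 63411, 6456, 660, 68, 7, 1],
  [399, 406, 233714335, 25113947, 2698901, 290069, 31179, 3352, 360, 39, 4, 0],
  [406, 81, 394017347, 26737190, 1817410, 123745, 8440, 577, 39, 3, 0, 0],
  [406, 76, 337283693, 23111492, 1585757, 108948, 7495, 516, 36, 2, 0, 0],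
  [400, 20, 558168733, 41523091, 3158656, 246026, 19628, 1603, 134, 11, 1, 0],
  [130, 389, 515978586, 47139165, 4362022, 408020, 38513, 3663, 351, 34, 3, 0],
  [401, 55, 705562457, 55708790, 4523929, 377425, 32275, 2820, 251, 23, 2, 0],
  [402, 167, 749395216, 61225464, 5144394, 443503, 39103, 3513, 321, 30, 3, 0],
  [38, 406, 563751062, 55814023, 5546320, 553217, 55390, 5567, 562, 57, 6, 1],
  [406, 167, 372908044, 25392792, 1731816, 118297, 8093, 555, 38, 3, 0, 0],
  [403, 406, 246547066, 26515136, 2851892, 306773, 33003, 3551, 382, 41, 4, 0],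
  [404, 406, 485179282, 49679317, 5100914, 525180, 54217, 5612, 582, 61, 6, 1],
  [0, 406, 610181390, 60944485, 6111253, 615251, 62186, 6310, 643, 66, 7, 1],
  [406, 22, 393338825, 26693893, 1814648, 123568, 8429, 576, 39, 3, 0, 0],
  [405, 9, 779155363, 63303916, 5293517, 454534, 39946, 3580, 326, 30, 3, 0],
  [15, 406, 620822192, 62105521, 6237945, 629076, 63695, 6475, 661, 68, 7, 1]]

/-- Words whose absence forces a small Markov value. -/
def badL : List Word := List.map (ofCode 30) [
  21212, 21211121, 12111212, 21112121, 12121112, 111212111, 222121112, 111112121, 121211111,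
  211121222, 21112122112, 21122121112, 112212111222, 222111212211, 2111212211112, 2111122121112,
  22112121111221, 12211212111122, 12211112121122, 11221211122112, 22111121211221, 21122111212211,
  111122121112211, 112211121221111, 22221121211112222, 22221111212112222, 2111111221211122122,
  2212211121221111112, 21221221112122111111, 12211122121112211112, 21111221112122111221,
  11111122121112212212, 211222112121111222212, 212222111121211222112, 111111112212111221221,
  122122111212211111111, 1111222112121111222212, 2122221111212112221111, 1112222111121211222112,
  2112221121211112222111, 22221112212111221111212, 22221221112122111111112,
  21211112211121221112222, 21111111122121112212222, 111221221112122111111122,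
  221111111221211122122111, 2222111221211122111121112, 2111211112211121221112222]

lemma tableU_valid : tableValid tableU = true := by decide +kernel

lemma tableU_grow : tableGrow tableU (-1) 5 = true := by decide +kernel

lemma tableL_valid : tableValid tableL = true := by decide +kernel

lemma tableL_grow : tableGrow tableL 1 5 = true := by decide +kernel

/-- In a table, every state is accompanied by a word that has just been read, and dead states are
entered only after reading one of the words in `bad`. -/
def soundCheck (T : Table) (names bad : List Word) : Bool :=
  (List.range T.length).all fun i => [false, true].all fun b =>
    bif Nat.blt (step T i b) T.length then (fetch [] names (step T i b)).isPrefixOf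
      (b :: fetch [] names i)
    else bad.any fun c => c.isPrefixOf (b :: fetch [] names i)

lemma isPrefix_of_isPrefixOf {u w : Word} (h : u.isPrefixOf w = true) : u <+: w := by
  simpa using h

lemma run_lt_of_sound {T : Table} {names bad : List Word} (h0 : 0 < T.length)
    (hn : fetch [] names 0 = []) (h : soundCheck T names bad = true) (w : Word)
    (hw : ∀ c ∈ bad, ¬ c <:+: w) :
    run T 0 w < T.length ∧ fetch [] names (run T 0 w) <+: w := by
  induction w with
  | nil => exact ⟨h0, by rw [run, hn]⟩
  | cons b w ih =>
    obtain ⟨h1, h2⟩ := ih fun c hc hcw => hw c hc (hcw.trans (List.suffix_cons b w).isInfix)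
    have h3 := List.all_eq_true.1 (List.all_eq_true.1 h _ (List.mem_range.2 h1)) b (by simp)
    have h4 : b :: fetch [] names (run T 0 w) <+: b :: w := (List.prefix_cons_inj b).2 h2
    rw [run]
    cases h5 : Nat.blt (step T (run T 0 w) b) T.length
    · rw [h5, cond_false] at h3
      obtain ⟨c, hc, hc1⟩ := List.any_eq_true.1 h3
      exact absurd ((isPrefix_of_isPrefixOf hc1).trans h4).isInfix (hw c hc)
    · rw [h5, cond_true] at h3
      exact ⟨by simpa using h5, (isPrefix_of_isPrefixOf h3).trans h4⟩

/-- Add an element to a list representing a finite set. -/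
def addNew (i : ℕ) (S : List ℕ) : List ℕ := bif S.any (Nat.beq i) then S else i :: S

/-- The image of a set of states. -/
def image (T : Table) (b : Bool) (S : List ℕ) : List ℕ :=
  S.foldr (fun i S => addNew (step T i b) S) []

/-- The remainders of the words that begin with a given letter. -/
def tails (b : Bool) : List Word → List Word
  | [] => []
  | [] :: ws => tails b ws
  | (c :: w) :: ws => bif c == b then w :: tails b ws else tails b ws

/-- All the words, read in order, lead from each of the states to dead states. -/
def deadCheck (T : Table) : ℕ → List ℕ → List Word → Bool
  | 0, _, _ => false
  | k + 1, S, ws => ws.isEmpty || (S.all (Nat.ble T.length) ||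
      [false, true].all fun b => deadCheck T k (image T b S) (tails b ws)) &&
      (S.all (Nat.ble T.length) || !ws.any List.isEmpty)

lemma mem_addNew {i j : ℕ} {S : List ℕ} : j ∈ addNew i S ↔ j = i ∨ j ∈ S := by
  unfold addNew
  cases h : S.any (Nat.beq i)
  · simp
  · obtain ⟨k, hk, hk'⟩ := List.any_eq_true.1 h
    have : i = k := Nat.eq_of_beq_eq_true hk'
    subst this
    simp only [cond_true, iff_or_self]
    rintro rfl
    exact hk

lemma mem_image {T : Table} {b : Bool} {S : List ℕ} {i : ℕ} (h : i ∈ S) :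
    step T i b ∈ image T b S := by
  induction S with
  | nil => simp at h
  | cons j S ih =>
    rw [image, List.foldr_cons, mem_addNew]
    rcases List.mem_cons.1 h with rfl | h
    · exact Or.inl rfl
    · exact Or.inr (ih h)

lemma mem_tails {b : Bool} {w : Word} {ws : List Word} (h : b :: w ∈ ws) : w ∈ tails b ws := by
  induction ws with
  | nil => simp at h
  | cons v ws ih =>
    rcases List.mem_cons.1 h with rfl | h1
    · simp [tails]
    · rcases v with _ | ⟨c, v⟩
      · exact ih h1
      · rw [tails]
        cases c == b
        · exact ih h1
        · exact List.mem_cons_of_mem _ (ih h1)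

lemma length_le_run {T : Table} {i : ℕ} (h : T.length ≤ i) (w : Word) : T.length ≤ run T i w := by
  induction w with
  | nil => exact h
  | cons b w ih => rwa [run, step_of_le ih]

lemma run_of_deadCheck {T : Table} {k : ℕ} {S : List ℕ} {ws : List Word}
    (h : deadCheck T k S ws = true) {w : Word} (hw : w ∈ ws) {i : ℕ} (hi : i ∈ S) :
    T.length ≤ run T i w.reverse := by
  induction k generalizing S ws w i with
  | zero => simp [deadCheck] at h
  | succ k ih =>
    rw [deadCheck, Bool.or_eq_true, Bool.and_eq_true, Bool.or_eq_true, Bool.or_eq_true] at h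
    rcases h with h | ⟨h1, h2⟩
    · rw [List.isEmpty_iff.1 h] at hw
      simp at hw
    by_cases hS : S.all (Nat.ble T.length) = true
    · exact length_le_run (Nat.le_of_ble_eq_true (List.all_eq_true.1 hS i hi)) _
    · have h1 := h1.resolve_left hS
      have h2 := h2.resolve_left hS
      rcases w with _ | ⟨b, w⟩
      · have : ws.any List.isEmpty = true := List.any_eq_true.2 ⟨[], hw, rfl⟩
        simp [this] at h2
      · rw [List.reverse_cons, run_append]
        exact ih (List.all_eq_true.1 h1 b (by simp)) (mem_tails hw) (mem_image hi)

lemma length_tableU : tableU.length = 392 := by decide +kernel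

lemma length_tableL : tableL.length = 406 := by decide +kernel

lemma tableU_sound : soundCheck tableU nameU badU = true := by decide +kernel

lemma tableL_dead : deadCheck tableL 31 (List.range 406) (badL.map List.reverse) = true := by
  decide +kernel

lemma badL_reverse : (badL.all fun c => badL.contains c.reverse) = true := by decide +kernel

/-- A run of ones. -/
def ones (n : ℕ) : Word := List.replicate n false

lemma tableL_one : step tableL 0 false = 0 := by decide +kernel

lemma tableL_two : ((List.range 6).all (fun m => run tableL 0 (ones 40 ++ List.replicate m true) == 0)
    && step tableL 28 true == 28 && run tableL 0 (List.replicate 6 true) == 28 &&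
    run tableL 28 (ones 40) == 0) = true := by decide +kernel

/-- Words leading every state of `tableL` back to the initial state. -/
def returns : List Word := [0, 211122, 12, 212, 2].map fun n => ones 40 ++ ofCode 30 n

lemma tableL_returns : ((List.range 406).all fun i => returns.any fun r => run tableL i r == 0) =
    true := by decide +kernel

/-- The weight of a word defined by a table. -/
noncomputable def tableWeight (T : Table) (w : Word) : ℝ :=
  stateFun T (run T 0 w) (beta (w ++ ones 2)) / cont (w ++ ones 2)

lemma beta_append_ones_mem (w : Word) : beta (w ++ ones 2) ∈ Iv := by
  induction w with
  | nil => norm_num [ones, List.replicate, beta, cont, cont', dig, Iv]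
  | cons b w ih => rw [List.cons_append, beta_cons]; exact one_div_mem_Iv b ih

lemma tableWeight_cons (T : Table) (w : Word) :
    tableWeight T (true :: w) + tableWeight T (false :: w) =
      transfer T (run T 0 w) (beta (w ++ ones 2)) / cont (w ++ ones 2) := by
  have h := cont_pos (w ++ ones 2)
  have hβ : 0 ≤ beta (w ++ ones 2) := beta_nonneg _
  have hd : ∀ b, (0 : ℝ) < dig b + beta (w ++ ones 2) := fun b => by
    have : (0 : ℝ) < dig b := by exact_mod_cast one_le_dig b
    positivity
  have h1 := hd true
  have h2 := hd false
  simp only [tableWeight, List.cons_append, cont_cons_eq, beta_cons, run, transfer]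
  field_simp
  ring

lemma tableWeight_grow {T : Table} {sg k : ℤ} (hsg : |sg| = 1) (hT : tableValid T = true)
    (hg : tableGrow T sg k = true) (w : Word) :
    0 ≤ sg * (10 ^ 8 * (tableWeight T (true :: w) + tableWeight T (false :: w)) -
      (10 ^ 8 + sg * k) * tableWeight T w) := by
  have h := div_nonneg (transfer_of_grow hsg hT hg (run T 0 w) (beta_append_ones_mem w))
    (cont_pos (w ++ ones 2)).le
  rw [tableWeight_cons, tableWeight]
  refine h.trans (le_of_eq ?_)
  ring

lemma tableWeight_of_le {T : Table} {w : Word} (h : T.length ≤ run T 0 w) : tableWeight T w = 0 := by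
  rw [tableWeight, stateFun_of_le h, zero_div]

lemma cont_append_ones (w : Word) : (cont w : ℝ) ≤ cont (w ++ ones 2) ∧
    (cont (w ++ ones 2) : ℝ) ≤ 4 * cont w := by
  have h1 := cont_mul_le_cont_append w (ones 2)
  have h2 := cont_append_le w (ones 2)
  have h3 : cont (ones 2) = 2 := rfl
  rw [h3] at h1 h2
  constructor
  · exact_mod_cast le_trans (by omega) h1
  · exact_mod_cast h2.trans (by omega)

lemma le_tableWeight {T : Table} (hT : tableValid T = true) {w : Word} (h : run T 0 w < T.length) :
    1 / 4 / cont w ≤ tableWeight T w := by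
  have h1 := (stateFun_bounds hT h (beta_append_ones_mem w)).1
  have h2 := (cont_append_ones w).2
  rw [tableWeight, div_div]
  exact div_le_div₀ (by linarith) h1 (cont_pos _) h2

lemma tableWeight_nonneg {T : Table} (hT : tableValid T = true) (w : Word) : 0 ≤ tableWeight T w := by
  rcases lt_or_ge (run T 0 w) T.length with h | h
  · exact le_trans (by positivity) (le_tableWeight hT h)
  · rw [tableWeight_of_le h]

lemma tableWeight_pos_iff {T : Table} (hT : tableValid T = true) (w : Word) :
    0 < tableWeight T w ↔ run T 0 w < T.length := by
  refine ⟨fun h => ?_, fun h => lt_of_lt_of_le ?_ (le_tableWeight hT h)⟩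
  · by_contra h1
    rw [tableWeight_of_le (not_lt.1 h1)] at h
    exact lt_irrefl _ h
  · have := cont_pos w
    positivity

lemma tableWeight_le {T : Table} (hT : tableValid T = true) (w : Word) :
    tableWeight T w ≤ 2 * 10 ^ 9 / cont w := by
  have h0 := cont_pos w
  rcases lt_or_ge (run T 0 w) T.length with h | h
  · exact div_le_div₀ (by norm_num) (stateFun_bounds hT h (beta_append_ones_mem w)).2 h0
      (cont_append_ones w).1
  · rw [tableWeight_of_le h]
    positivity

/-- The weight associated with `tableL`. -/
noncomputable def weightL : Weight where
  u := tableWeight tableL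
  ε := 5 / 10 ^ 8
  lo := 1 / 4
  hi := 2 * 10 ^ 9
  ε_pos := by norm_num
  lo_pos := by norm_num
  hi_pos := by norm_num
  nonneg := tableWeight_nonneg tableL_valid
  grow w := by
    have h := tableWeight_grow (by norm_num) tableL_valid tableL_grow w
    push_cast at h
    linarith
  le_hi := tableWeight_le tableL_valid
  lo_le w h := le_tableWeight tableL_valid ((tableWeight_pos_iff tableL_valid w).1 h)
  of_cons b w h := by
    rw [tableWeight_pos_iff tableL_valid] at h ⊢
    exact lt_of_step_lt h

lemma weightL_pos_iff (w : Word) : 0 < weightL.u w ↔ run tableL 0 w < 406 := by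
  rw [← length_tableL]
  exact tableWeight_pos_iff tableL_valid w

lemma weightL_ret {a : Word} (h : run tableL 0 a = 0) : weightL.Ret a := fun c hc => by
  rw [weightL_pos_iff] at hc ⊢
  rwa [run_append, h]

lemma weightL_returning : weightL.Returning where
  nil := (weightL_pos_iff []).2 (by norm_num [run])
  one := weightL_ret tableL_one
  two := by
    have h := tableL_two
    simp only [Bool.and_eq_true, beq_iff_eq] at h
    obtain ⟨⟨⟨h1, h2⟩, h3⟩, h4⟩ := h
    refine ⟨40, fun m => weightL_ret ?_⟩
    rcases lt_or_ge m 6 with hm | hm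
    · exact beq_iff_eq.1 (List.all_eq_true.1 h1 m (List.mem_range.2 hm))
    · have h5 : ∀ n, run tableL 0 (List.replicate (n + 6) true) = 28 := by
        intro n
        induction n with
        | zero => exact h3
        | succ n ih => rw [Nat.add_right_comm, List.replicate_succ, run, ih, h2]
      rw [run_append, ← Nat.sub_add_cancel hm, h5]
      exact h4
  ret := by
    refine ⟨60, fun a ha => ?_⟩
    have h := List.all_eq_true.1 tableL_returns _ (List.mem_range.2 ((weightL_pos_iff a).1 ha))
    obtain ⟨r, hr, hr0⟩ := List.any_eq_true.1 h
    have h2 : ∀ r ∈ returns, r.length ≤ 60 := by decide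
    exact ⟨r, h2 r hr, weightL_ret (by rw [run_append]; simpa using hr0)⟩

/-- The real number represented by a pair. -/
noncomputable def frac (a : ℕ × ℕ) : ℝ := a.1 / a.2

/-- The pair representing `1 / (dig b + x)`. -/
def recip (b : Bool) (a : ℕ × ℕ) : ℕ × ℕ := (a.2, dig b * a.2 + a.1)

/-- End points of the image of an interval under `mob w`. -/
def box : Word → ℕ × ℕ → ℕ × ℕ → (ℕ × ℕ) × (ℕ × ℕ)
  | [], a, b => (a, b)
  | d :: w, a, b => box w (recip d b) (recip d a)

lemma frac_recip (b : Bool) {a : ℕ × ℕ} (ha : 0 < a.2) :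
    frac (recip b a) = 1 / (dig b + frac a) ∧ 0 < (recip b a).2 := by
  have h : (0 : ℝ) < a.2 := by exact_mod_cast ha
  have hd := one_le_dig b
  constructor
  · have hd' : (0 : ℝ) < dig b := by exact_mod_cast hd
    simp only [frac, recip]
    push_cast
    field_simp
  · simp only [recip]
    positivity

lemma mob_mem_box (w : Word) {a b : ℕ × ℕ} (ha : 0 < a.2) (hb : 0 < b.2) {x : ℝ}
    (hx : x ∈ Set.Icc (frac a) (frac b)) :
    mob w x ∈ Set.Icc (frac (box w a b).1) (frac (box w a b).2) ∧
      0 < (box w a b).1.2 ∧ 0 < (box w a b).2.2 := by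
  induction w generalizing a b x with
  | nil => exact ⟨hx, ha, hb⟩
  | cons d w ih =>
    obtain ⟨ha1, ha2⟩ := frac_recip d ha
    obtain ⟨hb1, hb2⟩ := frac_recip d hb
    have h0 : 0 ≤ frac a := by unfold frac; positivity
    have hd : (0 : ℝ) < dig d := by exact_mod_cast one_le_dig d
    refine ih hb2 ha2 ⟨?_, ?_⟩
    · rw [hb1]
      exact one_div_le_one_div_of_le (by linarith [hx.1]) (by linarith [hx.2])
    · rw [ha1]
      exact one_div_le_one_div_of_le (by linarith) (by linarith [hx.1])

/-- The sum of two fractions is at most `p / q`. -/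
def sumLe (a b : ℕ × ℕ) (p q : ℕ) : Bool := Nat.ble (q * (a.1 * b.2 + b.1 * a.2)) (p * (a.2 * b.2))

/-- The sum of two fractions is larger than `p / q`. -/
def ltSum (p q : ℕ) (a b : ℕ × ℕ) : Bool := Nat.blt (p * (a.2 * b.2)) (q * (a.1 * b.2 + b.1 * a.2))

lemma frac_add (a b : ℕ × ℕ) (ha : 0 < a.2) (hb : 0 < b.2) :
    frac a + frac b = ((a.1 * b.2 + b.1 * a.2 : ℕ) : ℝ) / (a.2 * b.2 : ℕ) := by
  have h : (0 : ℝ) < a.2 := by exact_mod_cast ha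
  have h' : (0 : ℝ) < b.2 := by exact_mod_cast hb
  unfold frac
  push_cast
  field_simp

lemma frac_add_le {a b : ℕ × ℕ} (ha : 0 < a.2) (hb : 0 < b.2) {p q : ℕ} (hq : 0 < q)
    (h : sumLe a b p q = true) : frac a + frac b ≤ p / q := by
  rw [frac_add a b ha hb, div_le_div_iff₀ (by positivity) (by positivity)]
  have := Nat.le_of_ble_eq_true h
  rw [mul_comm q] at this
  exact_mod_cast this

lemma lt_frac_add {a b : ℕ × ℕ} (ha : 0 < a.2) (hb : 0 < b.2) {p q : ℕ} (hq : 0 < q)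
    (h : ltSum p q a b = true) : (p : ℝ) / q < frac a + frac b := by
  rw [frac_add a b ha hb, div_lt_div_iff₀ (by positivity) (by positivity)]
  have : p * (a.2 * b.2) < q * (a.1 * b.2 + b.1 * a.2) := by simpa [ltSum] using h
  rw [mul_comm q] at this
  exact_mod_cast this

/-- The sum of the values of two continued fractions with given beginnings is at most `p / q`. -/
def valLe (v w : Word) (p q : ℕ) : Bool :=
  sumLe (box v (1, 3) (3, 4)).2 (box w (1, 3) (3, 4)).2 p q

lemma mem_Iv_iff {x : ℝ} : x ∈ Iv ↔ x ∈ Set.Icc (frac (1, 3)) (frac (3, 4)) := by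
  norm_num [Iv, frac]

lemma mob_add_mob_le {v w : Word} {p q : ℕ} (hq : 0 < q) (h : valLe v w p q = true) {ξ η : ℝ}
    (hξ : ξ ∈ Iv) (hη : η ∈ Iv) : mob v ξ + mob w η ≤ p / q := by
  obtain ⟨h1, -, h2⟩ := mob_mem_box v (by norm_num) (by norm_num) (mem_Iv_iff.1 hξ)
  obtain ⟨h3, -, h4⟩ := mob_mem_box w (by norm_num) (by norm_num) (mem_Iv_iff.1 hη)
  exact (add_le_add h1.2 h3.2).trans (frac_add_le h2 h4 hq h)

lemma lt_mob_add_mob {v w : Word} {a b : ℕ × ℕ} (ha : 0 < a.2) (hb : 0 < b.2) {p q : ℕ}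
    (hq : 0 < q) (h : ltSum p q (box v a b).1 (box w a b).1 = true) {ξ η : ℝ}
    (hξ : ξ ∈ Set.Icc (frac a) (frac b)) (hη : η ∈ Set.Icc (frac a) (frac b)) :
    (p : ℝ) / q < mob v ξ + mob w η := by
  obtain ⟨h1, h2, -⟩ := mob_mem_box v ha hb hξ
  obtain ⟨h3, h4, -⟩ := mob_mem_box w ha hb hη
  exact (lt_frac_add h2 h4 hq h).trans_le (add_le_add h1.1 h3.1)

/-- Words of `badL` just completed in a window centred at a digit two. -/
def hit (l r : Word) : Bool := badL.any fun c => c.isPrefixOf (r ++ true :: l.reverse)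

/-- Extending a window on alternating sides, either a word of `badL` or a small value occurs. -/
def treeCheck : ℕ → Word → Word → Bool
  | 0, _, _ => false
  | k + 1, l, r => hit l r || valLe l r 133438486 100000000 ||
      [false, true].all fun b => treeCheck k r (b :: l)

lemma treeCheck_start : treeCheck 29 [] [] = true := by decide +kernel

lemma val_add_val_le_of_treeCheck {N k i j : ℕ} (hN : i + j + k = N) {x y : ℕ → Bool}
    (hx : ∀ i j, i ≤ N → j ≤ N → ∀ c ∈ badL, ¬ c <:+: pre y j ++ true :: (pre x i).reverse)
    (hy : ∀ i j, i ≤ N → j ≤ N → ∀ c ∈ badL, ¬ c <:+: pre x j ++ true :: (pre y i).reverse)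
    (h : treeCheck k (pre x i) (pre y j) = true) : val x + val y ≤ 133438486 / 100000000 := by
  induction k generalizing x y i j with
  | zero => simp [treeCheck] at h
  | succ k ih =>
    rw [treeCheck, Bool.or_eq_true, Bool.or_eq_true] at h
    rcases h with (h | h) | h
    · obtain ⟨c, hc, hc1⟩ := List.any_eq_true.1 h
      exact absurd (isPrefix_of_isPrefixOf hc1).isInfix (hx i j (by omega) (by omega) c hc)
    · rw [val_eq_mob x i, val_eq_mob y j]
      exact_mod_cast mob_add_mob_le (by norm_num) h (val_mem_Iv _) (val_mem_Iv _)
    · rw [add_comm]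
      exact ih (i := j) (j := i + 1) (by omega) hy hx
        (List.all_eq_true.1 h (x i) (by cases x i <;> simp))

/-- The part of a sequence to the right of a position. -/
def right (a : ℤ → Bool) (p : ℤ) (k : ℕ) : Bool := a (p + (k + 1))

/-- The part of a sequence to the left of a position. -/
def left (a : ℤ → Bool) (p : ℤ) (k : ℕ) : Bool := a (p - (k + 1))

lemma lambda0_shiftZ (a : ℤ → Bool) (p : ℤ) :
    lambda0 (shiftZ p fun i => dig (a i)) = dig (a p) + (val (left a p) + val (right a p)) := by
  rw [lambda0, cfVal_eq (a := fun n : ℕ => shiftZ p (fun i => dig (a i)) n) fun i => one_le_dig _,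
    add_assoc, add_comm (val _)]
  congr 1
  · simp [shiftZ]
  congr 1
  · have h : (fun k : ℕ => shiftZ p (fun i => dig (a i)) ↑(k + 1)) = fun k => dig (right a p k) := by
      ext k
      simp only [shiftZ, right]
      congr 2
      push_cast
      ring
    rw [h]
    rfl
  · simp only [val, shiftZ, left]
    congr 1
    ext k
    congr 2
    ring

lemma pre_congr {x y : ℕ → Bool} {n : ℕ} (h : ∀ k < n, x k = y k) : pre x n = pre y n := by
  induction n with
  | zero => rfl
  | succ n ih => rw [pre, pre, h n n.lt_succ_self, ih fun k hk => h k (hk.trans n.lt_succ_self)]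

lemma pre_eq_reverse_append {S y : ℕ → Bool} {q i : ℕ} (hi : i ≤ q)
    (h : ∀ k < i, y k = S (q - (k + 1))) : pre S q = (pre y i).reverse ++ pre S (q - i) := by
  induction i with
  | zero => simp [pre]
  | succ i ih =>
    rw [ih (by omega) fun k hk => h k (by omega), pre, List.reverse_cons, List.append_assoc,
      List.singleton_append, h i i.lt_succ_self, show q - i = q - (i + 1) + 1 by omega, pre]

/-- Words read around a position of a sequence are factors of its prefixes. -/
lemma infix_of_window {S y z : ℕ → Bool} {q i j : ℕ} (hi : i ≤ q) (hS : S q = true)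
    (hy : ∀ k < i, y k = S (q - (k + 1))) (hz : ∀ k, z k = S (k + (q + 1))) :
    pre z j ++ true :: (pre y i).reverse <:+: pre S (j + (q + 1)) := by
  refine ⟨[], pre S (q - i), ?_⟩
  rw [pre_append, pre, hS, pre_eq_reverse_append hi hy, pre_congr (y := z) fun k _ => (hz k).symm]
  simp

/-- A sequence beginning with a given word and a run of ones. -/
def stream (c : List Bool) (x : ℕ → Bool) (n : ℕ) : Bool :=
  if n < 51 then c.getD n false else x (n - 51)

/-- The sequence with a digit two in the centre and with given right and left parts. -/
def glue (c d : List Bool) (x y : ℕ → Bool) (p : ℤ) : Bool :=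
  if p = 0 then true else if 0 < p then stream c x (p - 1).toNat else stream d y (-p - 1).toNat

lemma glue_neg (c d : List Bool) (x y : ℕ → Bool) (p : ℤ) :
    glue c d x y (-p) = glue d c y x p := by
  unfold glue
  split_ifs <;> first | rfl | omega | simp

lemma right_glue_neg (c d : List Bool) (x y : ℕ → Bool) (p : ℤ) :
    right (glue c d x y) (-p) = left (glue d c y x) p := by
  ext k
  rw [right, left, ← glue_neg]
  congr 1
  ring

lemma left_glue_neg (c d : List Bool) (x y : ℕ → Bool) (p : ℤ) :
    left (glue c d x y) (-p) = right (glue d c y x) p := by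
  rw [← right_glue_neg, neg_neg]

lemma right_glue_zero (c d : List Bool) (x y : ℕ → Bool) : right (glue c d x y) 0 = stream c x := by
  ext k
  rw [right, glue, if_neg (by omega), if_pos (by omega)]
  congr 1
  omega

lemma left_glue_zero (c d : List Bool) (x y : ℕ → Bool) : left (glue c d x y) 0 = stream d y := by
  rw [← right_glue_zero d c y x, ← right_glue_neg, neg_zero]

lemma glue_congr (c d : List Bool) (x y : ℕ → Bool) {p : ℤ} (h : |p| ≤ 51) :
    glue c d x y p = glue c d (fun _ => false) (fun _ => false) p := by
  rw [abs_le] at h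
  unfold glue stream
  split_ifs <;> first | rfl | omega

/-- Admissible sequences avoid the words in `badL`. -/
lemma not_infix_of_pos {x : ℕ → Bool} (hx : ∀ n, 0 < weightL.u (pre x n)) (n : ℕ) {c : Word}
    (hc : c ∈ badL) : ¬ c <:+: pre x n ++ ones 40 := by
  rintro ⟨s, t, h⟩
  have h1 := (weightL_pos_iff _).1 ((weightL_returning.replicate 40) _ (hx n))
  rw [show List.replicate 40 false = ones 40 from rfl, ← h, List.append_assoc, run_append] at h1
  have h2 : 406 ≤ run tableL 0 (c ++ t) := by
    rw [run_append, ← length_tableL]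
    rcases lt_or_ge (run tableL 0 t) tableL.length with h3 | h3
    · have := run_of_deadCheck tableL_dead (w := c.reverse) (List.mem_map_of_mem hc)
        (List.mem_range.2 (by rwa [length_tableL] at h3))
      rwa [List.reverse_reverse] at this
    · exact length_le_run h3 c
  rw [← length_tableL] at h1 h2
  exact absurd (length_le_run h2 s) (not_le.2 h1)

lemma badL_reverse_mem {c : Word} (h : c ∈ badL) : c.reverse ∈ badL :=
  List.contains_iff_mem.1 (List.all_eq_true.1 badL_reverse c h)

lemma not_infix_reverse {w : Word} (h : ∀ c ∈ badL, ¬ c <:+: w) : ∀ c ∈ badL, ¬ c <:+: w.reverse :=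
  fun c hc h1 => h _ (badL_reverse_mem hc) (by simpa using h1.reverse)

/-- Far to the right, the values at digits two are small. -/
lemma val_add_val_le_of_far {c d : List Bool} (hc : c.length = 11) {x y : ℕ → Bool}
    (hx : ∀ n, 0 < weightL.u (pre x n)) {p : ℤ} (hp : 12 ≤ p) (h : glue c d x y p = true) :
    val (left (glue c d x y) p) + val (right (glue c d x y) p) ≤ 133438486 / 100000000 := by
  obtain ⟨q, rfl⟩ : ∃ q : ℕ, p = q + 12 := ⟨(p - 12).toNat, by omega⟩
  set S : ℕ → Bool := fun n => glue c d x y (n + 12) with hS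
  have hS1 : ∀ n < 40, S n = false := fun n hn => by
    simp only [hS, glue, stream]
    rw [if_neg (by omega), if_pos (by omega), if_pos (by omega)]
    exact List.getD_eq_default _ _ (by omega)
  have hS2 : ∀ n, S (n + 40) = x n := fun n => by
    simp only [hS, glue, stream]
    rw [if_neg (by omega), if_pos (by omega), if_neg (by omega)]
    congr 1
    omega
  have hq : 40 ≤ q := by
    by_contra h1
    have := hS1 q (by omega)
    simp only [hS, h] at this
    exact absurd this (by decide)
  have hpre : ∀ n, pre S (n + 40) = pre x n ++ ones 40 := fun n => by
    rw [pre_append, pre_congr (y := x) fun k _ => hS2 k,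
      pre_congr (y := fun _ => false) (n := 40) hS1]
    rfl
  have key : ∀ i j, i ≤ 29 → j ≤ 29 → ∀ c' ∈ badL,
      ¬ c' <:+: pre (right (glue c d x y) (q + 12)) j ++
        true :: (pre (left (glue c d x y) (q + 12)) i).reverse := by
    intro i j hi hj c' hc' h1
    have h2 := infix_of_window (S := S) (y := left (glue c d x y) (q + 12))
      (z := right (glue c d x y) (q + 12)) (q := q) (i := i) (j := j) (by omega) h
      (fun k hk => by
        simp only [left, hS]
        congr 1
        omega)
      (fun k => by
        simp only [right, hS]
        congr 1
        push_cast
        ring)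
    rw [show j + (q + 1) = j + (q + 1) - 40 + 40 by omega, hpre] at h2
    exact not_infix_of_pos hx _ hc' (h1.trans h2)
  refine val_add_val_le_of_treeCheck (N := 29) (i := 0) (j := 0) (k := 29) rfl key ?_ treeCheck_start
  intro i j hi hj
  have := not_infix_reverse (key j i hj hi)
  simpa using this

/-- The central word on the right. -/
def coreR : List Bool := (ofCode 30 11112222111).reverse

/-- The central word on the left. -/
def coreL : List Bool := (ofCode 30 12112221122).reverse

/-- The values at the digits two in the central part are small. -/
def coreCheck (c d : List Bool) : Bool := (List.range 11).all fun n =>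
  !glue c d (fun _ => false) (fun _ => false) (n + 1) ||
    valLe (pre (left (glue c d (fun _ => false) (fun _ => false)) (n + 1)) 30)
      (pre (right (glue c d (fun _ => false) (fun _ => false)) (n + 1)) 30) 133438486 100000000

lemma coreCheck_cores : coreCheck coreR coreL = true ∧ coreCheck coreL coreR = true := by
  decide +kernel

lemma val_add_val_le_of_near {c d : List Bool} (hcd : coreCheck c d = true) (x y : ℕ → Bool)
    {p : ℤ} (hp : 0 < p) (hp' : p ≤ 11) (h : glue c d x y p = true) :
    val (left (glue c d x y) p) + val (right (glue c d x y) p) ≤ 133438486 / 100000000 := by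
  obtain ⟨n, rfl⟩ : ∃ n : ℕ, p = n + 1 := ⟨(p - 1).toNat, by omega⟩
  have h1 := List.all_eq_true.1 hcd n (List.mem_range.2 (by omega))
  rw [← glue_congr c d x y (by rw [abs_le]; constructor <;> omega), h, Bool.not_true,
    Bool.false_or] at h1
  rw [val_eq_mob (left _ _) 30, val_eq_mob (right _ _) 30,
    pre_congr (x := left (glue c d x y) (n + 1)) fun k hk =>
      glue_congr c d x y (by rw [abs_le]; constructor <;> omega),
    pre_congr (x := right (glue c d x y) (n + 1)) fun k hk =>
      glue_congr c d x y (by rw [abs_le]; constructor <;> omega)]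
  exact_mod_cast mob_add_mob_le (by norm_num) h1 (val_mem_Iv _) (val_mem_Iv _)

lemma lambda0_glue_le_of_pos {c d : List Bool} (hc : c.length = 11) (hcd : coreCheck c d = true)
    {x y : ℕ → Bool} (hx : ∀ n, 0 < weightL.u (pre x n)) {p : ℤ} (hp : 0 < p) :
    dig (glue c d x y p) + (val (left (glue c d x y) p) + val (right (glue c d x y) p)) ≤
      3.33438486 := by
  cases h : glue c d x y p
  · have h1 := (val_mem_Iv (left (glue c d x y) p)).2
    have h2 := (val_mem_Iv (right (glue c d x y) p)).2
    norm_num [dig]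
    linarith
  · have h1 : val (left (glue c d x y) p) + val (right (glue c d x y) p) ≤ 133438486 / 100000000 := by
      rcases le_or_gt p 11 with h1 | h1
      · exact val_add_val_le_of_near hcd x y hp h1 h
      · exact val_add_val_le_of_far hc hx h1 h
    norm_num [dig]
    linarith

/-- The beginning of a central sequence. -/
def start (c : List Bool) : Word := ones 40 ++ c.reverse

lemma val_stream {c : List Bool} (hc : c.length = 11) (x : ℕ → Bool) :
    val (stream c x) = mob (start c) (val x) := by
  rw [val_eq_mob _ 51]
  congr 1
  · rw [pre_congr (x := stream c x) (y := fun n => c.getD n false) fun k hk => if_pos hk]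
    match c, hc with
    | [_, _, _, _, _, _, _, _, _, _, _], _ => rfl

lemma centre_bounds {ξ η : ℝ} (hξ : ξ ∈ Iv) (hη : η ∈ Iv) :
    1.33438486 < mob (start coreR) ξ + mob (start coreL) η ∧
      mob (start coreR) ξ + mob (start coreL) η ≤ 1.3343849341 := by
  rw [mem_Iv_iff] at hξ hη
  have h1 := lt_mob_add_mob (v := start coreR) (w := start coreL) (by norm_num) (by norm_num)
    (p := 133438486) (q := 100000000) (by norm_num) (by decide +kernel) hξ hη
  rw [← mem_Iv_iff] at hξ hη
  have h2 := mob_add_mob_le (v := start coreR) (w := start coreL) (p := 13343849341)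
    (q := 10000000000) (by norm_num) (by decide +kernel) hξ hη
  norm_num at h1 h2 ⊢
  exact ⟨h1, h2⟩

lemma markovValue_glue {x y : ℕ → Bool} (hx : ∀ n, 0 < weightL.u (pre x n))
    (hy : ∀ n, 0 < weightL.u (pre y n)) :
    markovValue (fun i => dig (glue coreR coreL x y i)) =
      2 + (mob (start coreR) (val x) + mob (start coreL) (val y)) := by
  have hc := centre_bounds (val_mem_Iv x) (val_mem_Iv y)
  have h0 : lambda0 (shiftZ 0 fun i => dig (glue coreR coreL x y i)) =
      2 + (mob (start coreR) (val x) + mob (start coreL) (val y)) := by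
    rw [lambda0_shiftZ, right_glue_zero, left_glue_zero, val_stream rfl, val_stream rfl]
    norm_num [glue, dig]
    ring
  have hle : ∀ p, lambda0 (shiftZ p fun i => dig (glue coreR coreL x y i)) ≤
      2 + (mob (start coreR) (val x) + mob (start coreL) (val y)) := by
    intro p
    rcases lt_trichotomy p 0 with hp | rfl | hp
    · obtain ⟨p, rfl⟩ : ∃ r, p = -r := ⟨-p, by ring⟩
      have h1 := lambda0_glue_le_of_pos (x := y) (y := x) (c := coreL) (d := coreR) rfl
        coreCheck_cores.2 hy (p := p) (by omega)
      rw [lambda0_shiftZ, glue_neg, left_glue_neg, right_glue_neg]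
      norm_num at h1 hc ⊢
      linarith
    · exact h0.le
    · have h1 := lambda0_glue_le_of_pos (x := x) (y := y) (c := coreR) (d := coreL) rfl
        coreCheck_cores.1 hx hp
      rw [lambda0_shiftZ]
      norm_num at h1 hc ⊢
      linarith
  rw [markovValue, ← h0]
  rw [← h0] at hle
  exact le_antisymm (ciSup_le hle) (le_ciSup ⟨_, Set.forall_mem_range.2 hle⟩ 0)

lemma dimH_Iic_inter_markovSpectrum : dimH (Set.Iic (3.3343849341 : ℝ) ∩ MarkovSpectrum) = 1 := by
  refine le_antisymm ?_ ?_
  · rw [← Real.dimH_univ]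
    exact dimH_mono (Set.subset_univ _)
  · refine le_of_forall_lt_imp_le_of_dense fun e he => ?_
    lift e to NNReal using (he.trans ENNReal.one_lt_top).ne
    rcases eq_zero_or_pos e with rfl | h0
    · simp
    refine (weightL_returning.le_dimH_sums (start coreR) (start coreL) h0
      (by exact_mod_cast he)).trans ?_
    rw [← (IsometryEquiv.addLeft (2 : ℝ)).dimH_image]
    refine dimH_mono ?_
    rintro _ ⟨t, ⟨x, y, hx, hy, rfl⟩, rfl⟩
    refine ⟨?_, fun i => dig (glue coreR coreL x y i), fun i => one_le_dig _, markovValue_glue hx hy⟩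
    have := (centre_bounds (val_mem_Iv x) (val_mem_Iv y)).2
    rw [Set.mem_Iic, IsometryEquiv.addLeft_apply]
    norm_num at this ⊢
    linarith

open MeasureTheory
open scoped ENNReal NNReal

/-- Distributes the digits of a word over two words with comparable continuants. -/
def splitWord : Word → Word × Word
  | [] => ([], [])
  | b :: z => if cont (splitWord z).1 ≤ cont (splitWord z).2 then
      (b :: (splitWord z).1, (splitWord z).2) else ((splitWord z).1, b :: (splitWord z).2)

lemma length_splitWord (z : Word) :
    (splitWord z).1.length + (splitWord z).2.length = z.length := by
  induction z with
  | nil => rfl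
  | cons b z ih => rw [splitWord]; split_ifs <;> simp only [List.length_cons] <;> omega

lemma cont_splitWord (z : Word) : cont (splitWord z).1 ≤ 3 * cont (splitWord z).2 ∧
    cont (splitWord z).2 ≤ 3 * cont (splitWord z).1 ∧
    cont (splitWord z).1 * cont (splitWord z).2 ≤ 3 ^ z.length := by
  induction z with
  | nil => simp [splitWord]
  | cons b z ih =>
    obtain ⟨h1, h2, h3⟩ := ih
    rw [splitWord, List.length_cons, pow_succ]
    split_ifs with h
    · have h4 := cont_cons_le b (splitWord z).1
      have h5 := cont_le_cont_cons b (splitWord z).1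
      have h6 := Nat.mul_le_mul_right (cont (splitWord z).2) h4
      refine ⟨by dsimp only; omega, by dsimp only; omega, by dsimp only; linarith⟩
    · have h4 := cont_cons_le b (splitWord z).2
      have h5 := cont_le_cont_cons b (splitWord z).2
      have h6 := Nat.mul_le_mul_left (cont (splitWord z).1) h4
      refine ⟨by dsimp only; omega, by dsimp only; omega, by dsimp only; linarith⟩

lemma exists_splitWord (x y : ℕ → Bool) (n : ℕ) : ∃ z : Fin n → Bool, ∃ i j,
    splitWord (List.ofFn z) = (pre x i, pre y j) := by
  induction n with
  | zero => exact ⟨fun _ => false, 0, 0, rfl⟩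
  | succ n ih =>
    obtain ⟨z, i, j, h⟩ := ih
    by_cases hc : cont (pre x i) ≤ cont (pre y j)
    · exact ⟨Fin.cons (x i) z, i + 1, j, by simp [List.ofFn_succ, splitWord, h, hc, pre]⟩
    · exact ⟨Fin.cons (y j) z, i, j + 1, by simp [List.ofFn_succ, splitWord, h, hc, pre]⟩

/-- The product of the weights of the two parts of a word. -/
noncomputable def splitWeight (u : Word → ℝ) (z : Word) : ℝ :=
  u (splitWord z).1 * u (splitWord z).2

lemma splitWeight_nonneg {u : Word → ℝ} (h0 : ∀ w, 0 ≤ u w) (z : Word) : 0 ≤ splitWeight u z :=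
  mul_nonneg (h0 _) (h0 _)

lemma splitWeight_decay {u : Word → ℝ} {ρ : ℝ} (h0 : ∀ w, 0 ≤ u w)
    (h : ∀ w, u (true :: w) + u (false :: w) ≤ ρ * u w) (z : Word) :
    splitWeight u (true :: z) + splitWeight u (false :: z) ≤ ρ * splitWeight u z := by
  simp only [splitWeight, splitWord]
  split_ifs
  · nlinarith [mul_le_mul_of_nonneg_right (h (splitWord z).1) (h0 (splitWord z).2)]
  · nlinarith [mul_le_mul_of_nonneg_left (h (splitWord z).2) (h0 (splitWord z).1)]

lemma sum_splitWeight_le {u : Word → ℝ} {ρ : ℝ} (hρ : 0 ≤ ρ) (h0 : ∀ w, 0 ≤ u w)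
    (h : ∀ w, u (true :: w) + u (false :: w) ≤ ρ * u w) (n : ℕ) :
    ∑ z : Fin n → Bool, splitWeight u (List.ofFn z) ≤ ρ ^ n * splitWeight u [] := by
  induction n with
  | zero => simp
  | succ n ih =>
    rw [← (Fin.consEquiv fun _ : Fin (n + 1) => Bool).sum_comp, Fintype.sum_prod_type,
      Fintype.sum_bool, ← Finset.sum_add_distrib, pow_succ', mul_assoc]
    refine le_trans ?_ (mul_le_mul_of_nonneg_left ih hρ)
    rw [Finset.mul_sum]
    refine Finset.sum_le_sum fun z _ => ?_
    simpa [Fin.consEquiv, List.ofFn_succ] using splitWeight_decay h0 h (List.ofFn z)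

/-- The digit plus the values of two sequences with positive weights. -/
def sumSet (u : Word → ℝ) : Set ℝ := {t | ∃ d : Bool, ∃ x y : ℕ → Bool,
  (∀ n, 0 < u (pre x n)) ∧ (∀ n, 0 < u (pre y n)) ∧ t = dig d + (val x + val y)}

/-- A neighbourhood of the sums determined by a digit and two words. -/
def cell (d : Bool) (p : Word × Word) : Set ℝ :=
  Metric.closedBall (dig d + (mob p.1 (1 / 2) + mob p.2 (1 / 2)))
    (1 / (cont p.1 : ℝ) ^ 2 + 1 / (cont p.2 : ℝ) ^ 2)

lemma abs_mob_sub_half_le (w : Word) {x : ℝ} (hx : x ∈ Iv) :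
    |mob w x - mob w (1 / 2)| ≤ 1 / (cont w : ℝ) ^ 2 := by
  have hc := cont_pos w
  refine (abs_mob_sub_le w hx (by norm_num [Iv])).trans (one_div_le_one_div_of_le (by positivity) ?_)
  nlinarith

lemma mem_cell (d : Bool) (x y : ℕ → Bool) (i j : ℕ) :
    dig d + (val x + val y) ∈ cell d (pre x i, pre y j) := by
  rw [cell, Metric.mem_closedBall, Real.dist_eq]
  have h1 := abs_mob_sub_half_le (pre x i) (val_mem_Iv fun k => x (k + i))
  have h2 := abs_mob_sub_half_le (pre y j) (val_mem_Iv fun k => y (k + j))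
  rw [← val_eq_mob] at h1 h2
  refine le_trans (le_of_eq ?_) ((abs_add_le _ _).trans (add_le_add h1 h2))
  congr 1
  ring

lemma ediam_cell_le (d : Bool) (z : Word) : Metric.ediam (cell d (splitWord z)) ≤
    ENNReal.ofReal (20 / (cont (splitWord z).1 * cont (splitWord z).2)) := by
  obtain ⟨h1, h2, -⟩ := cont_splitWord z
  have h3 := cont_pos (splitWord z).1
  have h4 := cont_pos (splitWord z).2
  have h1' : (cont (splitWord z).1 : ℝ) ≤ 3 * cont (splitWord z).2 := by exact_mod_cast h1
  have h2' : (cont (splitWord z).2 : ℝ) ≤ 3 * cont (splitWord z).1 := by exact_mod_cast h2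
  rw [cell, Real.closedBall_eq_Icc, Real.ediam_Icc]
  refine ENNReal.ofReal_le_ofReal ?_
  set p : ℝ := (cont (splitWord z).1 : ℝ)
  set q : ℝ := (cont (splitWord z).2 : ℝ)
  have h5 : 1 / p ^ 2 ≤ 3 / (p * q) := by
    rw [div_le_div_iff₀ (by positivity) (by positivity)]
    nlinarith
  have h6 : 1 / q ^ 2 ≤ 3 / (p * q) := by
    rw [div_le_div_iff₀ (by positivity) (by positivity)]
    nlinarith
  have h7 : 20 / (p * q) = 12 / (p * q) + 8 / (p * q) := by ring
  have h8 : 12 / (p * q) = 4 * (3 / (p * q)) := by ring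
  have h9 : 0 ≤ 8 / (p * q) := by positivity
  linarith

lemma rpow_le_of_splitWeight {u : Word → ℝ} {ρ η : ℝ} (hρ : 0 < ρ) (hη : 0 < η)
    (hηρ : (3 : ℝ) ^ η ≤ 1 / ρ) (hlo : ∀ w, 0 < u w → 1 / 4 / cont w ≤ u w) {z : Word}
    (h1 : 0 < u (splitWord z).1) (h2 : 0 < u (splitWord z).2) :
    (20 / ((cont (splitWord z).1 : ℝ) * cont (splitWord z).2)) ^ (1 - η) ≤
      320 * (1 / ρ) ^ z.length * splitWeight u z := by
  have h3 := cont_pos (splitWord z).1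
  have h4 := cont_pos (splitWord z).2
  have h5 : (cont (splitWord z).1 : ℝ) * cont (splitWord z).2 ≤ 3 ^ z.length := by
    exact_mod_cast (cont_splitWord z).2.2
  have h6 := mul_le_mul (hlo _ h1) (hlo _ h2) (by positivity) h1.le
  rw [splitWeight]
  set p : ℝ := (cont (splitWord z).1 : ℝ)
  set q : ℝ := (cont (splitWord z).2 : ℝ)
  have hpq : 0 < p * q := by positivity
  have h7 : 1 / (20 / (p * q)) ^ η ≤ (1 / ρ) ^ z.length := by
    rw [one_div, ← Real.inv_rpow (by positivity), inv_div]
    calc (p * q / 20) ^ η ≤ ((3 : ℝ) ^ z.length) ^ η :=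
          Real.rpow_le_rpow (by positivity) (by linarith) hη.le
      _ = ((3 : ℝ) ^ η) ^ z.length := by
          rw [← Real.rpow_natCast, ← Real.rpow_mul (by norm_num), mul_comm, Real.rpow_mul (by norm_num),
            Real.rpow_natCast]
      _ ≤ (1 / ρ) ^ z.length := pow_le_pow_left₀ (by positivity) hηρ _
  rw [Real.rpow_sub (by positivity), Real.rpow_one, div_eq_mul_one_div]
  calc 20 / (p * q) * (1 / (20 / (p * q)) ^ η) ≤ 20 / (p * q) * (1 / ρ) ^ z.length := by gcongr
    _ = 320 * (1 / ρ) ^ z.length * (1 / 4 / p * (1 / 4 / q)) := by field_simp; ring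
    _ ≤ _ := by gcongr

lemma exists_rpow_le {ρ : ℝ} (hρ : 0 < ρ) (hρ1 : ρ < 1) :
    ∃ η : ℝ, 0 < η ∧ η ≤ 1 / 2 ∧ (3 : ℝ) ^ η ≤ 1 / ρ := by
  have h : Tendsto (fun η : ℝ => (3 : ℝ) ^ η) (nhdsWithin 0 (Set.Ioi 0)) (nhds 1) := by
    have := (Real.continuous_const_rpow (show (3 : ℝ) ≠ 0 by norm_num)).tendsto 0
    rw [Real.rpow_zero] at this
    exact this.mono_left nhdsWithin_le_nhds
  have h1 := h.eventually_lt_const (show 1 < 1 / ρ by rw [lt_div_iff₀ hρ]; linarith)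
  obtain ⟨η, h2, h3⟩ := (h1.and (Ioc_mem_nhdsGT (show (0 : ℝ) < 1 / 2 by norm_num))).exists
  exact ⟨η, h3.1, h3.2, h2.le⟩

lemma dimH_closure_sumSet_lt {u : Word → ℝ} {ρ : ℝ} (hρ : 0 < ρ) (hρ1 : ρ < 1)
    (h0 : ∀ w, 0 ≤ u w) (h : ∀ w, u (true :: w) + u (false :: w) ≤ ρ * u w)
    (hlo : ∀ w, 0 < u w → 1 / 4 / cont w ≤ u w) : dimH (closure (sumSet u)) < 1 := by
  classical
  obtain ⟨η, hη, hη2, hηρ⟩ := exists_rpow_le hρ hρ1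
  obtain ⟨s, hs⟩ : ∃ s : ℝ≥0, (s : ℝ) = 1 - η := ⟨⟨1 - η, by linarith⟩, rfl⟩
  have hs1 : (s : ℝ≥0∞) < 1 := by
    rw [← ENNReal.coe_one, ENNReal.coe_lt_coe, ← NNReal.coe_lt_coe]
    rw [hs, NNReal.coe_one]
    linarith
  refine lt_of_le_of_lt (dimH_le_of_hausdorffMeasure_ne_top (d := s) (ne_of_lt ?_)) hs1
  let t : ∀ n : ℕ, Bool × (Fin n → Bool) → Set ℝ := fun n p =>
    if 0 < u (splitWord (List.ofFn p.2)).1 ∧ 0 < u (splitWord (List.ofFn p.2)).2 then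
      cell p.1 (splitWord (List.ofFn p.2)) else ∅
  have ht1 : ∀ n, 1 ≤ n → ∀ (p : Bool × (Fin n → Bool)), Metric.ediam (t n p) ≤ ENNReal.ofReal (40 / n) := by
    intro n hn p
    simp only [t]
    split_ifs with hp
    · refine (ediam_cell_le _ _).trans (ENNReal.ofReal_le_ofReal ?_)
      have h1 := length_splitWord (List.ofFn p.2)
      have h2 := length_le_cont (splitWord (List.ofFn p.2)).1
      have h3 := length_le_cont (splitWord (List.ofFn p.2)).2
      have h4 := one_le_cont (splitWord (List.ofFn p.2)).1
      have h5 := one_le_cont (splitWord (List.ofFn p.2)).2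
      rw [List.length_ofFn] at h1
      have h6 : n ≤ 2 * (cont (splitWord (List.ofFn p.2)).1 * cont (splitWord (List.ofFn p.2)).2) := by
        nlinarith
      have h7 : (n : ℝ) ≤ 2 * (cont (splitWord (List.ofFn p.2)).1 *
        cont (splitWord (List.ofFn p.2)).2) := by exact_mod_cast h6
      have h8 := cont_pos (splitWord (List.ofFn p.2)).1
      have h9 := cont_pos (splitWord (List.ofFn p.2)).2
      rw [div_le_div_iff₀ (by positivity) (by exact_mod_cast hn)]
      linarith
    · simp
  have ht2 : ∀ n, closure (sumSet u) ⊆ ⋃ p, t n p := by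
    intro n
    refine closure_minimal ?_ (isClosed_iUnion_of_finite fun p => ?_)
    · rintro _ ⟨d, x, y, hx, hy, rfl⟩
      obtain ⟨z, i, j, hz⟩ := exists_splitWord x y n
      refine Set.mem_iUnion.2 ⟨(d, z), ?_⟩
      simp only [t, hz]
      rw [if_pos ⟨hx i, hy j⟩]
      exact mem_cell d x y i j
    · simp only [t]
      split_ifs
      · exact Metric.isClosed_closedBall
      · exact isClosed_empty
  have ht3 : ∀ n, ∑ p, Metric.ediam (t n p) ^ (s : ℝ) ≤
      ENNReal.ofReal (2 * (320 * splitWeight u [])) := by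
    intro n
    have h1 : ∀ p : Bool × (Fin n → Bool), Metric.ediam (t n p) ^ (s : ℝ) ≤
        ENNReal.ofReal (320 * (1 / ρ) ^ n * splitWeight u (List.ofFn p.2)) := by
      intro p
      simp only [t]
      split_ifs with hp
      · refine (ENNReal.rpow_le_rpow (ediam_cell_le _ _) s.coe_nonneg).trans ?_
        rw [ENNReal.ofReal_rpow_of_nonneg (by positivity) s.coe_nonneg, hs]
        refine ENNReal.ofReal_le_ofReal ?_
        have := rpow_le_of_splitWeight hρ hη hηρ hlo hp.1 hp.2
        rwa [List.length_ofFn] at this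
      · rw [Metric.ediam_empty, ENNReal.zero_rpow_of_pos (by linarith)]
        exact bot_le
    refine (Finset.sum_le_sum fun p _ => h1 p).trans ?_
    rw [← ENNReal.ofReal_sum_of_nonneg fun p _ =>
      mul_nonneg (by positivity) (splitWeight_nonneg h0 _)]
    refine ENNReal.ofReal_le_ofReal ?_
    rw [Fintype.sum_prod_type, Fintype.sum_bool, ← two_mul, ← Finset.mul_sum]
    have h2 := mul_le_mul_of_nonneg_left (sum_splitWeight_le hρ.le h0 h n)
      (show 0 ≤ 320 * (1 / ρ) ^ n by positivity)
    have h3 : 320 * (1 / ρ) ^ n * (ρ ^ n * splitWeight u []) = 320 * splitWeight u [] := by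
      rw [one_div, inv_pow]
      field_simp
    rw [h3] at h2
    linarith
  refine lt_of_le_of_lt ((Measure.hausdorffMeasure_le_liminf_sum (s : ℝ) (closure (sumSet u))
    (l := atTop) (fun n : ℕ => ENNReal.ofReal (40 / n)) ?_ t ((eventually_ge_atTop 1).mono ht1)
    (Eventually.of_forall ht2)).trans (liminf_le_of_le (by isBoundedDefault) ?_))
    (ENNReal.ofReal_lt_top (r := 2 * (320 * splitWeight u [])))
  · rw [← ENNReal.ofReal_zero]
    exact ENNReal.tendsto_ofReal (tendsto_const_div_atTop_nhds_zero_nat 40)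
  · intro b hb
    obtain ⟨n, hn⟩ := hb.exists
    exact hn.trans (ht3 n)

lemma val_mem_of_val_mem {a b a' b' : ℝ} (ha : 0 ≤ a) (hb : a' * (2 + b) ≤ 1)
    (hb' : 1 ≤ b' * (1 + a)) (h : ∀ x, val x ∈ Set.Icc a b) (x : ℕ → Bool) :
    val x ∈ Set.Icc a' b' := by
  obtain ⟨h1, h2⟩ := h fun n => x (n + 1)
  have hd : (1 : ℝ) ≤ dig (x 0) := by exact_mod_cast one_le_dig (x 0)
  have hd' : (dig (x 0) : ℝ) ≤ 2 := by exact_mod_cast dig_le_two (x 0)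
  have hb0 : 0 ≤ b' := by
    by_contra hb0
    nlinarith
  rw [val_eq]
  constructor
  · rw [le_div_iff₀ (by linarith)]
    rcases le_total 0 a' with h3 | h3
    · nlinarith
    · nlinarith
  · rw [div_le_iff₀ (by linarith)]
    nlinarith

lemma val_mem_Icc (x : ℕ → Bool) : val x ∈ Set.Icc (frac (366, 1000)) (frac (7321, 10000)) := by
  have h1 := val_mem_of_val_mem (a' := 0.3636) (b' := 0.75) (by norm_num) (by norm_num)
    (by norm_num) val_mem_Iv
  have h2 := val_mem_of_val_mem (a' := 0.3636) (b' := 0.7334) (by norm_num) (by norm_num)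
    (by norm_num) h1
  have h3 := val_mem_of_val_mem (a' := 0.3658) (b' := 0.7334) (by norm_num) (by norm_num)
    (by norm_num) h2
  have h4 := val_mem_of_val_mem (a' := 0.3658) (b' := 0.7322) (by norm_num) (by norm_num)
    (by norm_num) h3
  have h5 := val_mem_of_val_mem (a' := 0.366) (b' := 0.7321) (by norm_num) (by norm_num)
    (by norm_num) (val_mem_of_val_mem (a' := 0.366) (b' := 0.7322) (by norm_num) (by norm_num)
    (by norm_num) h4) x
  norm_num [frac] at h5 ⊢
  exact h5

/-- Every word of `badU` has a digit two with a large value. -/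
def badCheck : Bool := badU.all fun c => (List.range c.length).any fun i => match c.drop i with
  | true :: B => ltSum 1334384009 1000000000
      (box (c.take i) (366, 1000) (7321, 10000)).1 (box B.reverse (366, 1000) (7321, 10000)).1
  | _ => false

lemma badCheck_eq : badCheck = true := by decide +kernel

lemma exists_large_of_mem_badU {c : Word} (hc : c ∈ badU) : ∃ A B : Word, c = A ++ true :: B ∧
    ∀ ξ η, ξ ∈ Set.Icc (frac (366, 1000)) (frac (7321, 10000)) →
      η ∈ Set.Icc (frac (366, 1000)) (frac (7321, 10000)) →
      1.334384009 < mob A ξ + mob B.reverse η := by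
  obtain ⟨i, -, hi⟩ := List.any_eq_true.1 (List.all_eq_true.1 badCheck_eq c hc)
  split at hi
  · rename_i B hB
    refine ⟨c.take i, B, by rw [← hB, List.take_append_drop], fun ξ η hξ hη => ?_⟩
    have := lt_mob_add_mob (by norm_num) (by norm_num) (by norm_num) hi hξ hη
    norm_num at this ⊢
    exact this
  · simp at hi

lemma pre_eq_append {x : ℕ → Bool} {n : ℕ} {u v : Word} (h : pre x n = u ++ v) :
    pre x v.length = v ∧ pre (fun k => x (k + v.length)) u.length = u := by
  have hn : n = u.length + v.length := by
    rw [← List.length_append, ← h, length_pre]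
  rw [hn, pre_append] at h
  exact (List.append_inj h (length_pre _ _)).symm

/-- Words with a large value do not occur on the right of a position. -/
lemma not_infix_right {a : ℤ → Bool}
    (ha : ∀ p, dig (a p) + (val (left a p) + val (right a p)) ≤ 3.334384009) (p : ℤ) (n : ℕ)
    {c : Word} (hc : c ∈ badU) : ¬ c <:+: pre (right a p) n := by
  rintro ⟨s, t, h⟩
  obtain ⟨A, B, rfl, hAB⟩ := exists_large_of_mem_badU hc
  have h1 : pre (right a p) n = (s ++ A) ++ (true :: (B ++ t)) := by rw [← h]; simp
  obtain ⟨h2, -⟩ := pre_eq_append h1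
  rw [List.length_cons, pre, List.cons.injEq] at h2
  have h3 : pre (right a p) n = s ++ (A ++ (true :: (B ++ t))) := by rw [← h]; simp
  have h4 := pre_eq_append (pre_eq_append h3).1
  set m := (B ++ t).length with hm
  have hBm : B.length ≤ m := by rw [hm, List.length_append]; omega
  have h5 := pre_eq_reverse_append (S := right a p) (y := left a (p + (m + 1))) hBm
    fun k hk => by
      simp only [left, right]
      congr 1
      omega
  rw [h2.2] at h5
  have h6 := (List.append_inj h5 (by rw [List.length_reverse, length_pre])).1
  have h7 : pre (right a (p + (m + 1))) A.length = A := by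
    refine Eq.trans (pre_congr fun k _ => ?_) h4.2
    simp only [right, List.length_cons, ← hm]
    congr 1
    push_cast
    ring
  have h8 : a (p + (m + 1)) = true := h2.1
  have h11 : pre (left a (p + (m + 1))) B.length = B.reverse := by
    have := congrArg List.reverse h6
    rw [List.reverse_reverse] at this
    exact this.symm
  have h9 := ha (p + (m + 1))
  rw [val_eq_mob (left _ _) B.length, val_eq_mob (right _ _) A.length, h7, h8,
    h11] at h9
  have h10 := hAB _ _ (val_mem_Icc fun k => right a (p + (m + 1)) (k + A.length))
    (val_mem_Icc fun k => left a (p + (m + 1)) (k + B.length))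
  norm_num [dig] at h9 h10
  linarith

lemma tableWeight_right_pos {a : ℤ → Bool}
    (ha : ∀ p, dig (a p) + (val (left a p) + val (right a p)) ≤ 3.334384009) (p : ℤ) (n : ℕ) :
    0 < tableWeight tableU (pre (right a p) n) :=
  (tableWeight_pos_iff tableU_valid _).2 (run_lt_of_sound (by rw [length_tableU]; norm_num) rfl
    tableU_sound _ fun _ hc => not_infix_right ha p n hc).1

lemma right_comp_neg (a : ℤ → Bool) (p : ℤ) : right (fun q => a (-q)) p = left a (-p) := by
  ext k
  simp only [right, left]
  congr 1
  ring

lemma left_comp_neg (a : ℤ → Bool) (p : ℤ) : left (fun q => a (-q)) p = right a (-p) := by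
  ext k
  simp only [right, left]
  congr 1
  ring

lemma lambda0_mem_sumSet {a : ℤ → Bool}
    (ha : ∀ p, lambda0 (shiftZ p fun i => dig (a i)) ≤ 3.334384009) (p : ℤ) :
    lambda0 (shiftZ p fun i => dig (a i)) ∈ sumSet (tableWeight tableU) := by
  simp only [lambda0_shiftZ] at ha ⊢
  refine ⟨a p, left a p, right a p, fun n => ?_, tableWeight_right_pos ha p, rfl⟩
  have h := tableWeight_right_pos (a := fun q => a (-q)) (fun q => ?_) (-p) n
  · rwa [right_comp_neg, neg_neg] at h
  · rw [right_comp_neg, left_comp_neg, add_comm (val _)]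
    exact ha (-q)

lemma eq_dig_of_lambda0_le {α : ℤ → ℕ} (hα : ∀ i, 1 ≤ α i)
    (h : ∀ p, lambda0 (shiftZ p α) ≤ 3.334384009) : ∃ a : ℤ → Bool, α = fun i => dig (a i) := by
  have hs : ∀ p i, 1 ≤ shiftZ p α i := fun p i => hα _
  have h3 : ∀ p, α p ≤ 3 := by
    intro p
    have h1 := (cfVal_bounds fun n : ℕ => hs p n).1
    have h2 := (cf01_bounds fun n : ℕ => hs p (-((n : ℤ) + 1))).1
    have h4 := h p
    rw [lambda0] at h4
    have h5 : shiftZ p α ((0 : ℕ) : ℤ) = α p := by simp [shiftZ]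
    rw [h5] at h1
    by_contra h6
    have h7 : (4 : ℝ) ≤ α p := by exact_mod_cast not_le.1 h6
    linarith
  have hquarter : ∀ b : ℕ → ℕ, (∀ i, 1 ≤ b i) → (∀ i, b i ≤ 3) → 1 / 4 ≤ cf01 b := by
    intro b hb hb3
    have h1 := cfVal_bounds hb
    have h2 : (b 0 : ℝ) ≤ 3 := by exact_mod_cast hb3 0
    have h3 := one_le_cfVal hb
    rw [cf01]
    exact one_div_le_one_div_of_le (by linarith) (by linarith)
  have h2 : ∀ p, α p ≤ 2 := by
    intro p
    have h1 := h p
    rw [lambda0, cfVal_eq fun n : ℕ => hs p n] at h1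
    have h5 : shiftZ p α ((0 : ℕ) : ℤ) = α p := by simp [shiftZ]
    have h4 := hquarter (fun n : ℕ => shiftZ p α ((n + 1 : ℕ) : ℤ)) (fun i => hs _ _) fun i => h3 _
    have h6 := hquarter (fun n : ℕ => shiftZ p α (-((n : ℤ) + 1))) (fun i => hs _ _) fun i => h3 _
    rw [cf01] at h4
    rw [h5] at h1
    by_contra h7
    have h8 : (3 : ℝ) ≤ α p := by exact_mod_cast not_le.1 h7
    linarith
  refine ⟨fun i => α i == 2, funext fun i => ?_⟩
  have h4 := hα i
  have h5 := h2 i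
  interval_cases h6 : α i <;> simp [h6, dig]

lemma Iic_inter_markovSpectrum_subset :
    Set.Iic 3.334384009 ∩ MarkovSpectrum ⊆ {0} ∪ closure (sumSet (tableWeight tableU)) := by
  rintro _ ⟨hm, α, hα, rfl⟩
  by_cases hb : BddAbove (Set.range fun n : ℤ => lambda0 (shiftZ n α))
  · have h : ∀ p, lambda0 (shiftZ p α) ≤ 3.334384009 := fun p => (le_ciSup hb p).trans hm
    obtain ⟨a, rfl⟩ := eq_dig_of_lambda0_le hα h
    refine Or.inr (closure_mono ?_ (csSup_mem_closure (Set.range_nonempty _) hb))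
    rintro _ ⟨p, rfl⟩
    exact lambda0_mem_sumSet h p
  · exact Or.inl (Real.sSup_of_not_bddAbove hb)

lemma dimH_Iic_inter_markovSpectrum_lt :
    dimH (Set.Iic (3.334384009 : ℝ) ∩ MarkovSpectrum) < 1 := by
  refine (dimH_mono Iic_inter_markovSpectrum_subset).trans_lt ?_
  rw [dimH_union, dimH_singleton]
  refine max_lt (by norm_num) (dimH_closure_sumSet_lt (ρ := 1 - 5 / 10 ^ 8) (by norm_num)
    (by norm_num) (tableWeight_nonneg tableU_valid) (fun w => ?_)
    fun w h => le_tableWeight tableU_valid ((tableWeight_pos_iff tableU_valid w).1 h))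
  have h := tableWeight_grow (by norm_num) tableU_valid tableU_grow w
  push_cast at h
  linarith

end CF

/-- **Theorem A** (Matheus–Moreira–Pollicott–Vytnova).
Let `t₁ = inf { t : dim_H ((-∞, t] ∩ M) = 1 }` be the first phase transition point of the
Markov spectrum.  Then `3.334384009 ≤ t₁ ≤ 3.3343849341`; in particular `t₁ = 3.334384…`
accurately to the six decimal places shown. -/
theorem first_transition_point_bounds :
    3.334384009 ≤ sInf { t : ℝ | dimH (Set.Iic t ∩ MarkovSpectrum) = 1 } ∧
    sInf { t : ℝ | dimH (Set.Iic t ∩ MarkovSpectrum) = 1 } ≤ 3.3343849341 := by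
  have h : ∀ t ∈ {t : ℝ | dimH (Set.Iic t ∩ MarkovSpectrum) = 1}, 3.334384009 ≤ t := by
    intro t ht
    by_contra hlt
    have h1 := (dimH_mono (Set.inter_subset_inter_left MarkovSpectrum
      (Set.Iic_subset_Iic.2 (not_le.1 hlt).le))).trans_lt CF.dimH_Iic_inter_markovSpectrum_lt
    have ht' : dimH (Set.Iic t ∩ MarkovSpectrum) = 1 := ht
    rw [ht'] at h1
    exact lt_irrefl _ h1
  exact ⟨le_csInf ⟨_, CF.dimH_Iic_inter_markovSpectrum⟩ h,
    csInf_le ⟨_, h⟩ CF.dimH_Iic_inter_markovSpectrum⟩
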